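/- arXiv:2002.09733 — 4 statements merged into one kernel-verified Lean document; each statement's English description precedes it below -/
import Mathlib

section
/- Fix ν ∈ (0,1), Δx > 0 and an integer N ≥ 2. The discrete complementary kernels satisfy: (i) 0 ≤ P_{n−j}^n ≤ 9·Γ(2−ν)·Δx^ν for all integers 3 ≤ j ≤ n ≤ 2N; and (ii) Σ_{j=3}^{n} P_{n−j}^n · ω_{1−ν}(x_j) ≤ 9 for all integers 3 ≤ n ≤ 2N, where ω_{1−ν}(x) = x^{−ν}/Γ(1−ν) and x_j = j·Δx. -/
open Real Finset

noncomputable section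

/-- α₀ = (ν+2)/(2^ν·Γ(3−ν)). -/
def alpha0 (ν : ℝ) : ℝ := (ν + 2) / ((2 : ℝ) ^ ν * Real.Gamma (3 - ν))

/-- θ = 2ν/(2+ν). -/
def theta (ν : ℝ) : ℝ := 2 * ν / (2 + ν)

/-- The coefficients D̄_k^(m). -/
def Dbar (ν : ℝ) (m k : ℕ) : ℝ :=
  if k = 0 then
    (1 / Real.Gamma (3 - ν)) *
      (-((2 - ν) / 2) * ((2 * m : ℝ) ^ (1 - ν) + 3 * ((2 * m : ℝ) + 2) ^ (1 - ν))
        - (2 * m : ℝ) ^ (2 - ν) + ((2 * m : ℝ) + 2) ^ (2 - ν))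
  else if k % 2 = 0 then
    (1 / Real.Gamma (3 - ν)) *
      (-((2 - ν) / 2) * (((2 * m : ℝ) - 2 * (k / 2 : ℕ)) ^ (1 - ν)
          + 6 * ((2 * m : ℝ) - 2 * (k / 2 : ℕ) + 2) ^ (1 - ν)
          + ((2 * m : ℝ) - 2 * (k / 2 : ℕ) + 4) ^ (1 - ν))
        - ((2 * m : ℝ) - 2 * (k / 2 : ℕ)) ^ (2 - ν)
        + ((2 * m : ℝ) - 2 * (k / 2 : ℕ) + 4) ^ (2 - ν))
  else
    (2 / Real.Gamma (3 - ν)) *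
      ((2 - ν) * (((2 * m : ℝ) - 2 * (k / 2 : ℕ)) ^ (1 - ν)
          + ((2 * m : ℝ) - 2 * (k / 2 : ℕ) + 2) ^ (1 - ν))
        + ((2 * m : ℝ) - 2 * (k / 2 : ℕ)) ^ (2 - ν)
        - ((2 * m : ℝ) - 2 * (k / 2 : ℕ) + 2) ^ (2 - ν))

/-- The coefficients D_k^(m); for k ≥ 3 one has D_k^(m) = D̄_{k+1}^(m). -/
def Dco (ν : ℝ) (m k : ℕ) : ℝ :=
  if k = 0 then
    (1 / Real.Gamma (3 - ν)) *
      (((2 - ν) / 2) * ((2 * m : ℝ) ^ (1 - ν) - 3 * ((2 * m : ℝ) + 1) ^ (1 - ν))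
        - (2 * m : ℝ) ^ (2 - ν) + ((2 * m : ℝ) + 1) ^ (2 - ν))
  else if k = 1 then
    (1 / Real.Gamma (3 - ν)) *
      (-((2 - ν) / 2) * (((2 * m : ℝ) - 2) ^ (1 - ν) + 3 * (2 * m : ℝ) ^ (1 - ν)
          - 4 * ((2 * m : ℝ) + 1) ^ (1 - ν))
        - ((2 * m : ℝ) - 2) ^ (2 - ν) + 3 * (2 * m : ℝ) ^ (2 - ν)
        - 2 * ((2 * m : ℝ) + 1) ^ (2 - ν))
  else if k = 2 then
    (1 / Real.Gamma (3 - ν)) *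
      (((2 - ν) / 2) * (4 * ((2 * m : ℝ) - 2) ^ (1 - ν) + 3 * (2 * m : ℝ) ^ (1 - ν)
          - ((2 * m : ℝ) + 1) ^ (1 - ν))
        + 2 * ((2 * m : ℝ) - 2) ^ (2 - ν) - 3 * (2 * m : ℝ) ^ (2 - ν)
        + ((2 * m : ℝ) + 1) ^ (2 - ν))
  else Dbar ν m (k + 1)

/-- The scheme coefficients d_k^j. -/
def dco (ν : ℝ) (j k : ℕ) : ℝ :=
  if j % 2 = 1 then -Dco ν (j / 2) k / alpha0 ν
  else -Dbar ν (j / 2 - 1) k / alpha0 ν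

/-- The transformed coefficients d̄_k^j. -/
def dbarco (ν : ℝ) (j k : ℕ) : ℝ :=
  if k = j then -1
  else if j = 3 then
    if k = 2 then dco ν 3 2 - theta ν
    else if k = 1 then theta ν * (dco ν 3 2 - theta ν) + dco ν 3 1
    else theta ν * (theta ν * (dco ν 3 2 - theta ν) + dco ν 3 1) + dco ν 3 0
  else
    theta ν ^ (j - k) + ∑ k' ∈ Finset.Icc k (j - 2), dco ν j k' * theta ν ^ (k' - k)

/-- The coefficients B̄_i^n: B̄_0^n = Δx^{−ν}α₀ and
    B̄_{n−k}^n = B̄_{n−k−1}^n − Δx^{−ν}·α₀·d̄_k^n for k = n−1,…,1. -/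
def Bbar (ν Δx : ℝ) (n : ℕ) : ℕ → ℝ
  | 0 => Δx ^ (-ν) * alpha0 ν
  | i + 1 => Bbar ν Δx n i - Δx ^ (-ν) * alpha0 ν * dbarco ν n (n - (i + 1))

/-- The complementary discrete kernels P_j^n. -/
def Pker (ν Δx : ℝ) (n : ℕ) : ℕ → ℝ
  | 0 => 1 / Bbar ν Δx n 0
  | j + 1 =>
    if n ≤ j + 3 then 0
    else (1 / Bbar ν Δx (n - (j + 1)) 0) *
      ∑ k ∈ (Finset.range (j + 1)).attach,
        (Bbar ν Δx (n - k.1) (j - k.1) - Bbar ν Δx (n - k.1) (j + 1 - k.1)) * Pker ν Δx n k.1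
  decreasing_by
    have := Finset.mem_range.mp k.2; omega

/-- D̂_0, D̂_1, D̂_2, D̃_0, D̃_1, D̃_2 : first/second-step coefficients. -/
def Dhat0 (ν : ℝ) : ℝ := (3 * ν - 4) / (2 * Real.Gamma (3 - ν))
def Dhat1 (ν : ℝ) : ℝ := 2 * (1 - ν) / Real.Gamma (3 - ν)
def Dhat2 (ν : ℝ) : ℝ := ν / (2 * Real.Gamma (3 - ν))
def Dtil0 (ν : ℝ) : ℝ := (3 * ν - 2) / ((2 : ℝ) ^ ν * Real.Gamma (3 - ν))
def Dtil1 (ν : ℝ) : ℝ := -(4 * ν) / ((2 : ℝ) ^ ν * Real.Gamma (3 - ν))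
def Dtil2 (ν : ℝ) : ℝ := (ν + 2) / ((2 : ℝ) ^ ν * Real.Gamma (3 - ν))

/-- The Caputo fractional derivative of order ν. -/
def caputo (ν : ℝ) (y : ℝ → ℝ) (x : ℝ) : ℝ :=
  (1 / Real.Gamma (1 - ν)) * ∫ s in (0:ℝ)..x, (x - s) ^ (-ν) * deriv y s

/-- The discrete Caputo derivative of a function y at the grid point x_j = jΔx. -/
def discCaputo (ν Δx : ℝ) (y : ℝ → ℝ) (j : ℕ) : ℝ :=
  if j = 1 then
    Δx ^ (-ν) * (Dhat0 ν * y 0 + Dhat1 ν * y Δx + Dhat2 ν * y (2 * Δx))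
  else if j = 2 then
    Δx ^ (-ν) * (Dtil0 ν * y 0 + Dtil1 ν * y Δx + Dtil2 ν * y (2 * Δx))
  else if j % 2 = 1 then
    Δx ^ (-ν) * ((∑ k ∈ Finset.range j, Dco ν (j / 2) k * y ((k : ℝ) * Δx))
      + alpha0 ν * y ((j : ℝ) * Δx))
  else
    Δx ^ (-ν) * ((∑ k ∈ Finset.range j, Dbar ν (j / 2 - 1) k * y ((k : ℝ) * Δx))
      + alpha0 ν * y ((j : ℝ) * Δx))

/-- Truncation error r_j(Δx). -/
def trunc (ν Δx : ℝ) (y : ℝ → ℝ) (j : ℕ) : ℝ :=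
  caputo ν y ((j : ℝ) * Δx) - discCaputo ν Δx y j

/-- The Mittag–Leffler function E_ν(z) = Σ_{k≥0} z^k/Γ(1+kν). -/
def mlE (ν z : ℝ) : ℝ := ∑' k : ℕ, z ^ k / Real.Gamma (1 + (k : ℝ) * ν)

end

namespace FractionalKernel

/-- The Bernoulli-type tangent bound `p (y - x) y^(p-1) ≤ y^p - x^p`. -/
lemma tangent_le_rpow_sub {p x y : ℝ} (hp0 : 0 ≤ p) (hp1 : p ≤ 1) (hx : 0 ≤ x) (hy : 0 < y) :
    p * (y - x) * y ^ (p - 1) ≤ y ^ p - x ^ p := by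
  have h := rpow_one_add_le_one_add_mul_self (s := x / y - 1)
    (by linarith [div_nonneg hx hy.le]) hp0 hp1
  rw [add_sub_cancel, Real.div_rpow hx hy.le] at h
  have hY : 0 < y ^ p := Real.rpow_pos_of_pos hy p
  rw [div_le_iff₀ hY] at h
  rw [Real.rpow_sub_one hy.ne']
  have e : p * (y - x) * (y ^ p / y) = y ^ p - (1 + p * (x / y - 1)) * y ^ p := by
    field_simp
    ring
  linarith

/-- The trapezoidal rule underestimates the integral of the concave function `t^p`. -/
lemma trapezoid_le {p x s : ℝ} (hp0 : 0 < p) (hp1 : p ≤ 1) (hx : 0 ≤ x) (hs : 0 ≤ s) :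
    (1 + p) * (s / 2) * (x ^ p + (x + s) ^ p) ≤ (x + s) ^ (1 + p) - x ^ (1 + p) := by
  let R : ℝ → ℝ := fun s ↦
    (x + s) ^ (1 + p) - x ^ (1 + p) - (1 + p) * (s / 2) * (x ^ p + (x + s) ^ p)
  have hmono : MonotoneOn R (Set.Ici 0) := by
    apply monotoneOn_of_hasDerivWithinAt_nonneg (convex_Ici 0)
      (f' := fun s ↦ (1 + p) / 2 * ((x + s) ^ p - x ^ p - p * (x + s - x) * (x + s) ^ (p - 1)))
    · have h1 : Continuous fun s : ℝ ↦ (x + s) ^ (1 + p) :=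
        (continuous_const.add continuous_id).rpow_const fun _ ↦ Or.inr (by linarith)
      have h2 : Continuous fun s : ℝ ↦ (x + s) ^ p :=
        (continuous_const.add continuous_id).rpow_const fun _ ↦ Or.inr hp0.le
      have : Continuous R := by fun_prop
      exact this.continuousOn
    · intro s hs
      rw [interior_Ici, Set.mem_Ioi] at hs
      have hpos : 0 < x + s := by linarith
      have hid : HasDerivAt (fun s : ℝ ↦ x + s) 1 s := (hasDerivAt_id s).const_add x
      have h1 := hid.rpow_const (p := 1 + p) (Or.inl hpos.ne')
      have h2 := hid.rpow_const (p := p) (Or.inl hpos.ne')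
      have h3 := (((hasDerivAt_id s).div_const 2).const_mul (1 + p)).mul (h2.const_add (x ^ p))
      have h4 := (h1.sub_const (x ^ (1 + p))).sub h3
      refine (h4.congr_deriv ?_).hasDerivWithinAt
      rw [add_sub_cancel_left 1 p]
      simp only [id]
      ring
    · intro s hs
      rw [interior_Ici, Set.mem_Ioi] at hs
      have := tangent_le_rpow_sub hp0.le hp1 hx (show 0 < x + s by linarith)
      exact mul_nonneg (by linarith) (by linarith)
  have h := hmono (Set.mem_Ici.mpr le_rfl) (Set.mem_Ici.mpr hs) hs
  simp only [R, add_zero, sub_self, zero_div, mul_zero, zero_mul] at h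
  linarith

/-- A weakened trapezoidal bound for the convex function `t^(-1-ν)`, on intervals `[A, B]` with
`B ≤ 3 A`. -/
lemma quarter_trapezoid_le {ν A B : ℝ} (hν0 : 0 ≤ ν) (hν1 : ν ≤ 1) (hA : 0 < A) (hAB : A ≤ B)
    (hB : B ≤ 3 * A) :
    ν * ((B - A) / 4) * (A ^ (-ν - 1) + B ^ (-ν - 1)) ≤ A ^ (-ν) - B ^ (-ν) := by
  have hBpos : 0 < B := hA.trans_le hAB
  have h := rpow_one_add_le_one_add_mul_self (s := A / B - 1)
    (by linarith [div_nonneg hA.le hBpos.le]) hν0 hν1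
  rw [add_sub_cancel, Real.div_rpow hA.le hBpos.le] at h
  rw [Real.rpow_sub_one hA.ne', Real.rpow_sub_one hBpos.ne', Real.rpow_neg hA.le,
    Real.rpow_neg hBpos.le]
  have hX : 0 < A ^ ν := Real.rpow_pos_of_pos hA ν
  have hY : 0 < B ^ ν := Real.rpow_pos_of_pos hBpos ν
  set X := A ^ ν
  set Y := B ^ ν
  rw [div_le_iff₀ hY] at h
  have h' : X * B ≤ (B - ν * (B - A)) * Y := by
    have e : (1 + ν * (A / B - 1)) * Y * B = (B - ν * (B - A)) * Y := by
      field_simp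
      ring
    nlinarith [mul_le_mul_of_nonneg_right h hBpos.le]
  have key : ν * (B - A) * (B * Y + A * X) ≤ 4 * A * B * (Y - X) := by
    have hw : 0 ≤ ν * (B - A) := mul_nonneg hν0 (by linarith)
    have h1 : X * B * (4 * A * B + ν * (B - A) * A) ≤
        (B - ν * (B - A)) * Y * (4 * A * B + ν * (B - A) * A) := by
      apply mul_le_mul_of_nonneg_right h'
      positivity
    have h2 : (B - ν * (B - A)) * (4 * A * B + ν * (B - A) * A) ≤
        (4 * A * B - ν * (B - A) * B) * B := by
      have : 0 ≤ ν * (B - A) * (B * (3 * A - B) + ν * (B - A) * A) := by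
        apply mul_nonneg hw
        have := mul_nonneg hBpos.le (sub_nonneg.mpr hB)
        positivity
      nlinarith
    have h3 := mul_le_mul_of_nonneg_right h2 hY.le
    have h4 : 0 ≤ B * (4 * A * B * (Y - X) - ν * (B - A) * (B * Y + A * X)) := by nlinarith
    have := nonneg_of_mul_nonneg_right h4 hBpos
    linarith
  have e : X⁻¹ - Y⁻¹ - ν * ((B - A) / 4) * (X⁻¹ / A + Y⁻¹ / B) =
      (4 * A * B * (Y - X) - ν * (B - A) * (B * Y + A * X)) / (4 * A * B * X * Y) := by
    field_simp
  have : 0 ≤ (4 * A * B * (Y - X) - ν * (B - A) * (B * Y + A * X)) / (4 * A * B * X * Y) :=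
    div_nonneg (by linarith) (by positivity)
  linarith

/-- The rule with weights `1/8, 3/4, 1/8` overestimates the integral of `t^(1-ν)` over
`[t - s, t + s]`. -/
lemma integral_le_weighted {ν t s : ℝ} (hν0 : 0 ≤ ν) (hν1 : ν ≤ 1) (ht : 0 < t) (hs : 0 ≤ s)
    (hst : 2 * s ≤ t) :
    (t + s) ^ (2 - ν) - (t - s) ^ (2 - ν) ≤
      (2 - ν) * (s / 4) * ((t - s) ^ (1 - ν) + 6 * t ^ (1 - ν) + (t + s) ^ (1 - ν)) := by
  have dpow : ∀ q u : ℝ, u ∈ Set.Icc 0 (t / 2) →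
      HasDerivAt (fun s ↦ (t + s) ^ q) (q * (t + u) ^ (q - 1)) u ∧
      HasDerivAt (fun s ↦ (t - s) ^ q) (-(q * (t - u) ^ (q - 1))) u := by
    intro q u hu
    have h1 := ((hasDerivAt_id u).const_add t).rpow_const (p := q)
      (Or.inl (by simp only [id]; linarith [hu.1]))
    have h2 := ((hasDerivAt_id u).const_sub t).rpow_const (p := q)
      (Or.inl (by simp only [id]; linarith [hu.2]))
    exact ⟨h1.congr_deriv (by simp), h2.congr_deriv (by simp)⟩
  let Q' : ℝ → ℝ := fun s ↦ 3 / 2 * t ^ (1 - ν) - 3 / 4 * ((t - s) ^ (1 - ν) + (t + s) ^ (1 - ν))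
    + (1 - ν) * (s / 4) * ((t + s) ^ (-ν) - (t - s) ^ (-ν))
  let Q'' : ℝ → ℝ := fun s ↦ (1 - ν) / 2 * ((t - s) ^ (-ν) - (t + s) ^ (-ν)
    - ν * ((t + s - (t - s)) / 4) * ((t - s) ^ (-ν - 1) + (t + s) ^ (-ν - 1)))
  let Q : ℝ → ℝ := fun s ↦
    (2 - ν) * (s / 4) * ((t - s) ^ (1 - ν) + 6 * t ^ (1 - ν) + (t + s) ^ (1 - ν)) -
      ((t + s) ^ (2 - ν) - (t - s) ^ (2 - ν))
  have dQ' : ∀ u ∈ Set.Icc 0 (t / 2), HasDerivAt Q' (Q'' u) u := by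
    intro u hu
    have h1 := dpow (1 - ν) u hu
    have h2 := dpow (-ν) u hu
    have h := (((h1.2.add h1.1).const_mul (3 / 4)).const_sub (3 / 2 * t ^ (1 - ν))).add
      ((((hasDerivAt_id u).div_const 4).const_mul (1 - ν)).mul (h2.1.sub h2.2))
    refine h.congr_deriv ?_
    simp only [Q'', id, show 1 - ν - 1 = -ν by ring, Pi.sub_apply]
    ring
  have dQ : ∀ u ∈ Set.Icc 0 (t / 2), HasDerivAt Q ((2 - ν) * Q' u) u := by
    intro u hu
    have h1 := dpow (1 - ν) u hu
    have h2 := dpow (2 - ν) u hu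
    have h := ((((hasDerivAt_id u).div_const 4).const_mul (2 - ν)).mul
      ((h1.2.add_const (6 * t ^ (1 - ν))).add h1.1)).sub (h2.1.sub h2.2)
    refine h.congr_deriv ?_
    simp only [Q', id, show 1 - ν - 1 = -ν by ring, show 2 - ν - 1 = 1 - ν by ring, Pi.add_apply]
    ring
  have h0 : (0 : ℝ) ∈ Set.Icc 0 (t / 2) := ⟨le_rfl, by linarith⟩
  have mQ' : MonotoneOn Q' (Set.Icc 0 (t / 2)) := by
    apply monotoneOn_of_hasDerivWithinAt_nonneg (convex_Icc _ _)
      (fun u hu ↦ (dQ' u hu).continuousAt.continuousWithinAt)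
      (fun u hu ↦ (dQ' u (interior_subset hu)).hasDerivWithinAt)
    intro u hu
    have hu := interior_subset hu
    have := quarter_trapezoid_le hν0 hν1 (A := t - u) (B := t + u)
      (by linarith [hu.2]) (by linarith [hu.1]) (by linarith [hu.2])
    exact mul_nonneg (by linarith) (by linarith)
  have mQ : MonotoneOn Q (Set.Icc 0 (t / 2)) := by
    apply monotoneOn_of_hasDerivWithinAt_nonneg (convex_Icc _ _)
      (fun u hu ↦ (dQ u hu).continuousAt.continuousWithinAt)
      (fun u hu ↦ (dQ u (interior_subset hu)).hasDerivWithinAt)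
    intro u hu
    have hu := interior_subset hu
    have h := mQ' h0 hu hu.1
    have e : Q' 0 = 0 := by
      simp only [Q', add_zero, sub_zero]
      ring
    exact mul_nonneg (by linarith) (e ▸ h)
  have h := mQ h0 ⟨hs, by linarith⟩ hs
  have e : Q 0 = 0 := by simp [Q]
  rw [e] at h
  simp only [Q] at h
  linarith

/-- The quadratic Taylor bound for `2^ν`, in the form needed for the second kernel value. -/
lemma quadratic_bound_two_rpow {ν : ℝ} (hν0 : 0 ≤ ν) (hν1 : ν ≤ 1) :
    12 + 8 * ν + ν ^ 2 ≤ 2 ^ ν * (12 - ν ^ 2) := by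
  have hL : 0.69 < Real.log 2 := by linarith [Real.log_two_gt_d9]
  have h1 : 1 + 0.69 * ν + (0.69 * ν) ^ 2 / 2 ≤ 2 ^ ν := by
    rw [Real.rpow_def_of_pos two_pos]
    have h := Real.quadratic_le_exp_of_nonneg (x := 0.69 * ν) (by positivity)
    exact h.trans (Real.exp_le_exp.mpr (mul_le_mul_of_nonneg_right hL.le hν0))
  have h2 : 0 ≤ 12 - ν ^ 2 := by nlinarith
  have h3 := mul_le_mul_of_nonneg_right h1 h2
  have h4 : 0 ≤ ν * (1 - ν) := mul_nonneg hν0 (by linarith)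
  have h5 : 0 ≤ ν * (ν * (1 - ν)) := mul_nonneg hν0 h4
  have h6 : 0 ≤ ν * (ν * (ν * (1 - ν))) := mul_nonneg hν0 h5
  nlinarith

/-- Any solution of the renewal equation `p_j = ∑_{k<j} f_{j-k} p_k` is dual to the tails of `f`. -/
lemma renewal_sum {f p : ℕ → ℝ} {M : ℕ}
    (hp : ∀ j < M, p (j + 1) = ∑ k ∈ range (j + 1), f (j + 1 - k) * p k) :
    ∀ j ≤ M, ∑ k ∈ range (j + 1), (1 - ∑ i ∈ range (j - k), f (i + 1)) * p k = p 0 := by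
  intro j
  induction j with
  | zero => simp
  | succ j ih =>
    intro hj
    rw [sum_range_succ, ← ih (by omega), hp j (by omega)]
    simp only [Nat.sub_self, range_zero, sum_empty, sub_zero, one_mul]
    rw [← sum_add_distrib]
    refine sum_congr rfl fun k hk ↦ ?_
    have hk := mem_range.mp hk
    rw [show j + 1 - k = j - k + 1 by omega, sum_range_succ]
    ring

/-- Numerators of the Toeplitz coefficients of the scheme. -/
noncomputable def weight (ν : ℝ) (r : ℕ) : ℝ :=
  if r % 2 = 1 then
    2 * ((2 * (r / 2 : ℕ) + 2) ^ (2 - ν) - (2 * (r / 2 : ℕ)) ^ (2 - ν)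
      - (2 - ν) * ((2 * (r / 2 : ℕ)) ^ (1 - ν) + (2 * (r / 2 : ℕ) + 2) ^ (1 - ν)))
  else
    (2 - ν) / 2 * ((2 * (r / 2 - 1 : ℕ)) ^ (1 - ν) + 6 * (2 * (r / 2 - 1 : ℕ) + 2) ^ (1 - ν)
      + (2 * (r / 2 - 1 : ℕ) + 4) ^ (1 - ν))
    - ((2 * (r / 2 - 1 : ℕ) + 4) ^ (2 - ν) - (2 * (r / 2 - 1 : ℕ)) ^ (2 - ν))

/-- The Toeplitz coefficients: `dco ν j k = coeff ν (j - k)` for `3 ≤ k < j`. -/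
noncomputable def coeff (ν : ℝ) (r : ℕ) : ℝ := weight ν r / ((ν + 2) / 2 ^ ν)

/-- The transformed Toeplitz coefficients: `dbarco ν j k = kernel ν (j - k)` for `3 ≤ k < j`. -/
noncomputable def kernel (ν : ℝ) : ℕ → ℝ
  | 0 => 1
  | 1 => theta ν
  | r + 2 => theta ν * kernel ν (r + 1) + coeff ν (r + 2)

/-- The partial tails of `kernel`. -/
noncomputable def tail (ν : ℝ) (R : ℕ) : ℝ := 1 - ∑ i ∈ range R, kernel ν (i + 1)

lemma weight_odd (ν : ℝ) (h : ℕ) : weight ν (2 * h + 1) =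
    2 * ((2 * (h : ℝ) + 2) ^ (2 - ν) - (2 * (h : ℝ)) ^ (2 - ν)
      - (2 - ν) * ((2 * (h : ℝ)) ^ (1 - ν) + (2 * (h : ℝ) + 2) ^ (1 - ν))) := by
  rw [weight, if_pos (by omega), show (2 * h + 1) / 2 = h by omega]

lemma weight_even (ν : ℝ) (h : ℕ) : weight ν (2 * h + 2) =
    (2 - ν) / 2 * ((2 * (h : ℝ)) ^ (1 - ν) + 6 * (2 * (h : ℝ) + 2) ^ (1 - ν)
      + (2 * (h : ℝ) + 4) ^ (1 - ν))
    - ((2 * (h : ℝ) + 4) ^ (2 - ν) - (2 * (h : ℝ)) ^ (2 - ν)) := by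
  rw [weight, if_neg (by omega), show (2 * h + 2) / 2 - 1 = h by omega]

lemma neg_Dbar_div_alpha0 {ν : ℝ} (hν : ν < 1) {m k : ℕ} (hk : 1 ≤ k) (hkm : k ≤ 2 * m + 1) :
    -Dbar ν m k / alpha0 ν = coeff ν (2 * m + 2 - k) := by
  have hΓ : Real.Gamma (3 - ν) ≠ 0 := (Real.Gamma_pos_of_pos (by linarith)).ne'
  have hsimp : ∀ x : ℝ, -(1 / Real.Gamma (3 - ν) * x) / alpha0 ν = -x / ((ν + 2) / 2 ^ ν) := by
    intro x
    rw [alpha0]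
    field_simp
  rcases Nat.even_or_odd' k with ⟨l, rfl | rfl⟩
  · obtain ⟨h, rfl⟩ : ∃ h, m = l + h := Nat.exists_eq_add_of_le (by omega)
    rw [Dbar, if_neg (by omega), if_pos (by omega), hsimp, coeff,
      show 2 * (l + h) + 2 - 2 * l = 2 * h + 2 by omega, weight_even,
      show 2 * l / 2 = l by omega]
    push_cast
    rw [show 2 * ((l : ℝ) + h) - 2 * l = 2 * h by ring]
    congr 1
    ring
  · obtain ⟨h, rfl⟩ : ∃ h, m = l + h := Nat.exists_eq_add_of_le (by omega)
    rw [Dbar, if_neg (by omega), if_neg (by omega), ← mul_one_div 2, mul_comm (2 : ℝ), mul_assoc,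
      hsimp, coeff, show 2 * (l + h) + 2 - (2 * l + 1) = 2 * h + 1 by omega, weight_odd,
      show (2 * l + 1) / 2 = l by omega]
    push_cast
    rw [show 2 * ((l : ℝ) + h) - 2 * l = 2 * h by ring]
    congr 1
    ring

lemma dco_eq_coeff {ν : ℝ} (hν : ν < 1) {j k : ℕ} (hk : 3 ≤ k) (hkj : k < j) :
    dco ν j k = coeff ν (j - k) := by
  rw [dco]
  split_ifs with h
  · rw [Dco, if_neg (by omega), if_neg (by omega), if_neg (by omega),
      neg_Dbar_div_alpha0 hν (by omega) (by omega)]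
    congr 1
    omega
  · rw [neg_Dbar_div_alpha0 hν (by omega) (by omega)]
    congr 1
    omega

lemma dbarco_eq_kernel {ν : ℝ} (hν : ν < 1) {j k r : ℕ} (hk : 3 ≤ k) (hr : j = k + r + 1) :
    dbarco ν j k = kernel ν (r + 1) := by
  induction r generalizing k with
  | zero =>
    rw [dbarco, if_neg (by omega), if_neg (by omega), Icc_eq_empty (by omega), hr]
    simp [kernel]
  | succ r ih =>
    rw [kernel, ← ih (k := k + 1) (by omega) (by omega), dbarco, if_neg (by omega),
      if_neg (by omega), dbarco, if_neg (by omega), if_neg (by omega),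
      show r + 2 = j - k by omega, ← dco_eq_coeff hν hk (by omega),
      ← add_sum_Ioc_eq_sum_Icc (show k ≤ j - 2 by omega), mul_add, mul_sum,
      ← pow_succ', show j - (k + 1) + 1 = j - k by omega, Nat.sub_self, pow_zero, mul_one]
    have : ∑ x ∈ Ioc k (j - 2), dco ν j x * theta ν ^ (x - k) =
        ∑ x ∈ Icc (k + 1) (j - 2), theta ν * (dco ν j x * theta ν ^ (x - (k + 1))) := by
      refine sum_congr (by ext; simp only [mem_Ioc, mem_Icc]; omega) fun x hx ↦ ?_
      rw [mem_Icc] at hx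
      rw [show x - k = x - (k + 1) + 1 by omega, pow_succ]
      ring
    rw [this]
    ring

lemma rpow_two_sub {ν x : ℝ} (hν : ν < 1) (hx : 0 ≤ x) : x ^ (2 - ν) = x * x ^ (1 - ν) := by
  rw [show 2 - ν = 1 + (1 - ν) by ring, Real.rpow_add' hx (by linarith), Real.rpow_one]

lemma trapezoid_two {ν : ℝ} (hν0 : 0 < ν) (hν1 : ν < 1) (h : ℕ) :
    (2 - ν) * ((2 * (h : ℝ)) ^ (1 - ν) + (2 * (h : ℝ) + 2) ^ (1 - ν)) ≤
      (2 * (h : ℝ) + 2) ^ (2 - ν) - (2 * (h : ℝ)) ^ (2 - ν) := by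
  have := trapezoid_le (p := 1 - ν) (x := 2 * h) (s := 2) (by linarith) (by linarith)
    (by positivity) (by norm_num)
  rw [show 1 + (1 - ν) = 2 - ν by ring] at this
  linarith

lemma weight_nonneg {ν : ℝ} (hν0 : 0 < ν) (hν1 : ν < 1) {r : ℕ} (hr : 3 ≤ r) :
    0 ≤ weight ν r := by
  rcases Nat.even_or_odd' r with ⟨l, rfl | rfl⟩
  · obtain ⟨h, rfl⟩ : ∃ h, l = h + 2 := Nat.exists_eq_add_of_le' (by omega)
    rw [show 2 * (h + 2) = 2 * (h + 1) + 2 by ring, weight_even]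
    have hh : (0 : ℝ) ≤ h := h.cast_nonneg
    have := integral_le_weighted (t := 2 * ((h + 1 : ℕ) : ℝ) + 2) (s := 2) hν0.le hν1.le
      (by positivity) (by norm_num) (by push_cast; linarith)
    rw [show 2 * ((h + 1 : ℕ) : ℝ) + 2 + 2 = 2 * ((h + 1 : ℕ) : ℝ) + 4 by ring,
      add_sub_cancel_right] at this
    linarith
  · rw [weight_odd]
    linarith [trapezoid_two hν0 hν1 l]

lemma two_rpow_one_sub (ν : ℝ) : (2 : ℝ) ^ (1 - ν) = 2 / 2 ^ ν := by
  rw [Real.rpow_sub two_pos, Real.rpow_one]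

lemma coeff_one {ν : ℝ} (hν0 : 0 < ν) (hν1 : ν < 1) : coeff ν 1 = 2 * theta ν := by
  have hw := weight_odd ν 0
  have h2 : (0 : ℝ) < 2 ^ ν := by positivity
  simp only [Nat.cast_zero, mul_zero, zero_add] at hw
  rw [coeff, hw, rpow_two_sub hν1 two_pos.le, two_rpow_one_sub, theta,
    Real.zero_rpow (by linarith), Real.zero_rpow (by linarith)]
  field_simp
  ring

lemma theta_sq_add_coeff_two {ν : ℝ} (hν0 : 0 < ν) (hν1 : ν < 1) :
    0 ≤ theta ν * theta ν + coeff ν 2 := by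
  have hw := weight_even ν 0
  have h2 : (0 : ℝ) < 2 ^ ν := by positivity
  have h4 : (4 : ℝ) ^ (1 - ν) = 4 / (2 ^ ν * 2 ^ ν) := by
    rw [show (4 : ℝ) = 2 * 2 by norm_num, Real.mul_rpow two_pos.le two_pos.le, two_rpow_one_sub]
    field_simp
  simp only [Nat.cast_zero, mul_zero, zero_add] at hw
  rw [coeff, hw, rpow_two_sub hν1 zero_lt_four.le, h4, two_rpow_one_sub, theta,
    Real.zero_rpow (by linarith), Real.zero_rpow (by linarith)]
  have key := quadratic_bound_two_rpow hν0.le hν1.le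
  have e : 2 * ν / (2 + ν) * (2 * ν / (2 + ν)) + ((2 - ν) / 2 * (0 + 6 * (2 / 2 ^ ν)
      + 4 / (2 ^ ν * 2 ^ ν)) - (4 * (4 / (2 ^ ν * 2 ^ ν)) - 0)) / ((ν + 2) / 2 ^ ν) =
      2 * (2 ^ ν * (12 - ν ^ 2) - (12 + 8 * ν + ν ^ 2)) / ((2 + ν) ^ 2 * 2 ^ ν) := by
    field_simp
    ring
  rw [e]
  exact div_nonneg (by linarith) (by positivity)

lemma theta_nonneg {ν : ℝ} (hν0 : 0 < ν) : 0 ≤ theta ν := by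
  rw [theta]
  positivity

lemma kernel_nonneg {ν : ℝ} (hν0 : 0 < ν) (hν1 : ν < 1) : ∀ r, 0 ≤ kernel ν r
  | 0 => zero_le_one
  | 1 => theta_nonneg hν0
  | 2 => theta_sq_add_coeff_two hν0 hν1
  | r + 3 => by
    rw [kernel]
    exact add_nonneg (mul_nonneg (theta_nonneg hν0) (kernel_nonneg hν0 hν1 (r + 2)))
      (div_nonneg (weight_nonneg hν0 hν1 (by omega)) (by positivity))

lemma tail_succ (ν : ℝ) (R : ℕ) : tail ν (R + 1) = tail ν R - kernel ν (R + 1) := by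
  rw [tail, tail, sum_range_succ]
  ring

lemma tail_succ_eq {ν : ℝ} (hν0 : 0 < ν) (hν1 : ν < 1) (R : ℕ) :
    tail ν (R + 1) = 1 - ∑ i ∈ range (R + 1), coeff ν (i + 1) + theta ν * tail ν R := by
  induction R with
  | zero =>
    simp only [tail, zero_add, sum_range_one, range_zero, sum_empty, coeff_one hν0 hν1, kernel]
    ring
  | succ R ih =>
    rw [sum_range_succ, tail_succ, kernel]
    have := tail_succ ν R
    linear_combination ih + (- theta ν) * this

lemma coeff_tail_even {ν : ℝ} (hν0 : 0 < ν) (hν1 : ν < 1) (H : ℕ) :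
    (1 - ∑ i ∈ range (2 * H), coeff ν (i + 1)) * ((ν + 2) / 2 ^ ν) =
      (2 * (H : ℝ) + 2) ^ (2 - ν) - (2 * (H : ℝ)) ^ (2 - ν)
        - (2 - ν) / 2 * (3 * (2 * (H : ℝ)) ^ (1 - ν) + (2 * (H : ℝ) + 2) ^ (1 - ν)) := by
  have h2 : (0 : ℝ) < 2 ^ ν := by positivity
  induction H with
  | zero =>
    simp only [mul_zero, range_zero, sum_empty, sub_zero, Nat.cast_zero, zero_add, one_mul]
    rw [rpow_two_sub hν1 two_pos.le, two_rpow_one_sub,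
      Real.zero_rpow (by linarith), Real.zero_rpow (by linarith)]
    field_simp
    ring
  | succ H ih =>
    have hK : (ν + 2) / 2 ^ ν ≠ 0 := by positivity
    have e : ∀ r, coeff ν r * ((ν + 2) / 2 ^ ν) = weight ν r := fun r ↦ div_mul_cancel₀ _ hK
    rw [show 2 * (H + 1) = 2 * H + 1 + 1 by ring, sum_range_succ, sum_range_succ, sub_mul, add_mul,
      add_mul, e, e, show 2 * H + 1 + 1 = 2 * H + 2 by ring, weight_odd, weight_even]
    rw [sub_mul] at ih
    push_cast
    rw [show 2 * ((H : ℝ) + 1) + 2 = 2 * H + 4 by ring, show 2 * ((H : ℝ) + 1) = 2 * H + 2 by ring]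
    linear_combination ih

lemma theta_lt_one {ν : ℝ} (hν0 : 0 < ν) (hν1 : ν < 1) : theta ν < 1 := by
  rw [theta, div_lt_one (by linarith)]
  linarith

lemma alpha0_pos {ν : ℝ} (hν0 : 0 < ν) (hν1 : ν < 1) : 0 < alpha0 ν := by
  have := Real.Gamma_pos_of_pos (show 0 < 3 - ν by linarith)
  rw [alpha0]
  positivity

lemma Gamma_three_sub {ν : ℝ} (hν1 : ν < 1) :
    Real.Gamma (3 - ν) = (2 - ν) * Real.Gamma (2 - ν) := by
  rw [← Real.Gamma_add_one (by linarith)]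
  ring_nf

lemma Gamma_two_sub {ν : ℝ} (hν1 : ν < 1) :
    Real.Gamma (2 - ν) = (1 - ν) * Real.Gamma (1 - ν) := by
  rw [← Real.Gamma_add_one (by linarith)]
  ring_nf

lemma le_alpha0_mul_coeff_tail {ν : ℝ} (hν0 : 0 < ν) (hν1 : ν < 1) (H : ℕ) :
    (2 * (H : ℝ) + 2) ^ (-ν) / Real.Gamma (1 - ν) ≤
      alpha0 ν * (1 - ∑ i ∈ range (2 * H), coeff ν (i + 1)) := by
  have hΓ := Real.Gamma_pos_of_pos (show 0 < 1 - ν by linarith)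
  have htan := tangent_le_rpow_sub (p := 1 - ν) (x := 2 * H) (y := 2 * H + 2) (by linarith)
    (by linarith) (by positivity) (by positivity)
  rw [show 1 - ν - 1 = -ν by ring] at htan
  have hK : (2 - ν) * (1 - ν) * (2 * (H : ℝ) + 2) ^ (-ν) ≤
      (1 - ∑ i ∈ range (2 * H), coeff ν (i + 1)) * ((ν + 2) / 2 ^ ν) := by
    rw [coeff_tail_even hν0 hν1]
    nlinarith [trapezoid_two hν0 hν1 H]
  have e : alpha0 ν = (ν + 2) / 2 ^ ν / ((2 - ν) * (1 - ν) * Real.Gamma (1 - ν)) := by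
    rw [alpha0, Gamma_three_sub hν1, Gamma_two_sub hν1, div_div, ← mul_assoc, ← mul_assoc,
      ← mul_assoc, ← mul_assoc]
  have h1 : 0 < 1 - ν := by linarith
  have h2 : 0 < 2 - ν := by linarith
  rw [e, div_mul_eq_mul_div, div_le_div_iff₀ hΓ (by positivity)]
  nlinarith [mul_le_mul_of_nonneg_right hK hΓ.le]

lemma tail_even_bound {ν : ℝ} (hν0 : 0 < ν) (hν1 : ν < 1) (H : ℕ) :
    (2 * (H : ℝ) + 4) ^ (-ν) / Real.Gamma (1 - ν) ≤ alpha0 ν * tail ν (2 * H + 2) := by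
  have hb := le_alpha0_mul_coeff_tail hν0 hν1 (H + 1)
  have hα := alpha0_pos hν0 hν1
  push_cast at hb
  rw [show 2 * ((H : ℝ) + 1) + 2 = 2 * H + 4 by ring, show 2 * (H + 1) = 2 * H + 2 by ring] at hb
  have hΓ := Real.Gamma_pos_of_pos (show 0 < 1 - ν by linarith)
  have hω : 0 ≤ (2 * (H : ℝ) + 4) ^ (-ν) / Real.Gamma (1 - ν) := by positivity
  have ht := tail_succ_eq hν0 hν1 (2 * H + 1)
  have hs := tail_succ ν (2 * H + 1)
  have hk := kernel_nonneg hν0 hν1 (2 * H + 2)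
  rw [show 2 * H + 1 + 1 = 2 * H + 2 by ring] at ht hs
  have hC := nonneg_of_mul_nonneg_right (hω.trans hb) hα
  have hθ := theta_nonneg hν0
  have h1 : theta ν * tail ν (2 * H + 2) ≤ theta ν * tail ν (2 * H + 1) :=
    mul_le_mul_of_nonneg_left (by linarith) hθ
  have hpos : 0 ≤ tail ν (2 * H + 2) :=
    nonneg_of_mul_nonneg_right (b := tail ν (2 * H + 2)) (a := 1 - theta ν) (by linarith)
      (by linarith [theta_lt_one hν0 hν1])
  refine hb.trans (mul_le_mul_of_nonneg_left ?_ hα.le)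
  linarith [mul_nonneg hθ hpos]

lemma tail_bound {ν : ℝ} (hν0 : 0 < ν) (hν1 : ν < 1) (R : ℕ) :
    ((R : ℝ) + 3) ^ (-ν) / Real.Gamma (1 - ν) ≤ alpha0 ν * tail ν R := by
  have hα := alpha0_pos hν0 hν1
  have hΓ := Real.Gamma_pos_of_pos (show 0 < 1 - ν by linarith)
  have anti : ∀ {x y : ℝ}, 0 < x → x ≤ y →
      y ^ (-ν) / Real.Gamma (1 - ν) ≤ x ^ (-ν) / Real.Gamma (1 - ν) := fun hx hxy ↦
    div_le_div_of_nonneg_right (Real.rpow_le_rpow_of_nonpos hx hxy (by linarith)) hΓ.le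
  rcases Nat.even_or_odd' R with ⟨H, rfl | rfl⟩
  · rcases H with _ | H
    · refine (anti (x := 2) two_pos (by norm_num)).trans ?_
      simpa [tail] using le_alpha0_mul_coeff_tail hν0 hν1 0
    · have h := tail_even_bound hν0 hν1 H
      rw [show 2 * (H + 1) = 2 * H + 2 by ring]
      refine (anti (by positivity) ?_).trans h
      push_cast
      linarith
  · have h := tail_even_bound hν0 hν1 H
    rw [show 2 * H + 2 = 2 * H + 1 + 1 by ring, tail_succ, mul_sub] at h
    push_cast
    rw [show 2 * (H : ℝ) + 1 + 3 = 2 * H + 4 by ring]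
    linarith [mul_nonneg hα.le (kernel_nonneg hν0 hν1 (2 * H + 1 + 1))]

lemma tail_nonneg {ν : ℝ} (hν0 : 0 < ν) (hν1 : ν < 1) (R : ℕ) : 0 ≤ tail ν R := by
  have hΓ := Real.Gamma_pos_of_pos (show 0 < 1 - ν by linarith)
  exact nonneg_of_mul_nonneg_right
    ((show (0 : ℝ) ≤ ((R : ℝ) + 3) ^ (-ν) / Real.Gamma (1 - ν) by positivity).trans
      (tail_bound hν0 hν1 R)) (alpha0_pos hν0 hν1)

lemma Pker_zero (ν Δx : ℝ) (n : ℕ) : Pker ν Δx n 0 = 1 / (Δx ^ (-ν) * alpha0 ν) := by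
  rw [Pker, Bbar]

lemma Pker_succ {ν Δx : ℝ} (hν0 : 0 < ν) (hν1 : ν < 1) (hΔx : 0 < Δx) {n j : ℕ}
    (hj : j < n - 3) :
    Pker ν Δx n (j + 1) = ∑ k ∈ range (j + 1), kernel ν (j + 1 - k) * Pker ν Δx n k := by
  have hβ : Δx ^ (-ν) * alpha0 ν ≠ 0 :=
    (mul_pos (Real.rpow_pos_of_pos hΔx _) (alpha0_pos hν0 hν1)).ne'
  rw [Pker, if_neg (by omega), Bbar, sum_attach (range (j + 1)) fun k ↦
    (Bbar ν Δx (n - k) (j - k) - Bbar ν Δx (n - k) (j + 1 - k)) * Pker ν Δx n k, mul_sum]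
  refine sum_congr rfl fun k hk ↦ ?_
  have hk := mem_range.mp hk
  rw [show j + 1 - k = j - k + 1 by omega, Bbar,
    dbarco_eq_kernel hν1 (r := j - k) (by omega) (by omega), sub_sub_cancel, ← mul_assoc,
    ← mul_assoc, one_div_mul_cancel hβ, one_mul]

lemma Pker_nonneg {ν Δx : ℝ} (hν0 : 0 < ν) (hν1 : ν < 1) (hΔx : 0 < Δx) {n j : ℕ}
    (hj : j ≤ n - 3) : 0 ≤ Pker ν Δx n j := by
  induction j using Nat.strong_induction_on with
  | _ j ih =>
    rcases j with _ | j
    · rw [Pker_zero]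
      have := alpha0_pos hν0 hν1
      positivity
    · rw [Pker_succ hν0 hν1 hΔx (by omega)]
      refine sum_nonneg fun k hk ↦ mul_nonneg (kernel_nonneg hν0 hν1 _) (ih k ?_ ?_) <;>
      · have := mem_range.mp hk
        omega

lemma sum_tail_mul_Pker {ν Δx : ℝ} (hν0 : 0 < ν) (hν1 : ν < 1) (hΔx : 0 < Δx) {n j : ℕ}
    (hj : j ≤ n - 3) :
    ∑ k ∈ range (j + 1), tail ν (j - k) * Pker ν Δx n k = 1 / (Δx ^ (-ν) * alpha0 ν) := by
  rw [← Pker_zero ν Δx n]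
  exact renewal_sum (fun i hi ↦ Pker_succ hν0 hν1 hΔx hi) j hj

lemma inv_alpha0_le {ν : ℝ} (hν0 : 0 < ν) (hν1 : ν < 1) :
    1 / alpha0 ν ≤ 2 * Real.Gamma (2 - ν) := by
  have hΓ := Real.Gamma_pos_of_pos (show 0 < 2 - ν by linarith)
  have h2 : (2 : ℝ) ^ ν ≤ 2 := by
    simpa using Real.rpow_le_rpow_of_exponent_le one_le_two hν1.le
  rw [alpha0, Gamma_three_sub hν1, one_div_div, div_le_iff₀ (by linarith), ← mul_assoc,
    mul_right_comm _ _ (ν + 2)]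
  refine mul_le_mul_of_nonneg_right ?_ hΓ.le
  exact mul_le_mul h2 (by linarith) (by linarith) two_pos.le

lemma Pker_le {ν Δx : ℝ} (hν0 : 0 < ν) (hν1 : ν < 1) (hΔx : 0 < Δx) {n j : ℕ}
    (hj : j ≤ n - 3) : Pker ν Δx n j ≤ 2 * Real.Gamma (2 - ν) * Δx ^ ν := by
  have h := sum_tail_mul_Pker hν0 hν1 hΔx hj
  have hle : tail ν (j - j) * Pker ν Δx n j ≤ 1 / (Δx ^ (-ν) * alpha0 ν) := by
    rw [← h]
    refine single_le_sum (f := fun k ↦ tail ν (j - k) * Pker ν Δx n k) (fun k hk ↦ ?_)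
      (self_mem_range_succ j)
    have hk := mem_range.mp hk
    exact mul_nonneg (tail_nonneg hν0 hν1 _) (Pker_nonneg hν0 hν1 hΔx (by omega))
  rw [Nat.sub_self, show tail ν 0 = 1 by simp [tail], one_mul] at hle
  have e : 1 / (Δx ^ (-ν) * alpha0 ν) = 1 / alpha0 ν * Δx ^ ν := by
    rw [Real.rpow_neg hΔx.le]
    field_simp
  rw [e] at hle
  exact hle.trans (mul_le_mul_of_nonneg_right (inv_alpha0_le hν0 hν1) (by positivity))

lemma sum_Pker_mul_le_one {ν Δx : ℝ} (hν0 : 0 < ν) (hν1 : ν < 1) (hΔx : 0 < Δx) {n : ℕ}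
    (hn : 3 ≤ n) :
    ∑ j ∈ Icc 3 n, Pker ν Δx n (n - j) * (((j : ℝ) * Δx) ^ (-ν) / Real.Gamma (1 - ν)) ≤ 1 := by
  have hβ : 0 < Δx ^ (-ν) * alpha0 ν :=
    mul_pos (Real.rpow_pos_of_pos hΔx _) (alpha0_pos hν0 hν1)
  calc
    _ ≤ ∑ j ∈ Icc 3 n, Δx ^ (-ν) * alpha0 ν * (tail ν (j - 3) * Pker ν Δx n (n - j)) := by
      refine sum_le_sum fun j hj ↦ ?_
      obtain ⟨hj3, hjn⟩ := mem_Icc.mp hj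
      have hb := tail_bound hν0 hν1 (j - 3)
      rw [Nat.cast_sub hj3, Nat.cast_ofNat, sub_add_cancel] at hb
      have hP := Pker_nonneg hν0 hν1 hΔx (n := n) (j := n - j) (by omega)
      have hx : 0 < Δx ^ (-ν) := Real.rpow_pos_of_pos hΔx _
      rw [Real.mul_rpow j.cast_nonneg hΔx.le]
      have := mul_le_mul_of_nonneg_left hb (mul_nonneg hP hx.le)
      calc
        _ = Pker ν Δx n (n - j) * Δx ^ (-ν) * ((j : ℝ) ^ (-ν) / Real.Gamma (1 - ν)) := by ring
        _ ≤ _ := this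
        _ = _ := by ring
    _ = Δx ^ (-ν) * alpha0 ν * ∑ k ∈ range (n - 3 + 1), tail ν (n - 3 - k) * Pker ν Δx n k := by
      rw [← mul_sum]
      congr 1
      refine sum_nbij' (fun j ↦ n - j) (fun k ↦ n - k) ?_ ?_ ?_ ?_ ?_ <;>
        simp only [mem_Icc, mem_range] <;> intro i hi
      · omega
      · omega
      · omega
      · omega
      · rw [show n - 3 - (n - i) = i - 3 by omega]
    _ = 1 := by
      rw [sum_tail_mul_Pker hν0 hν1 hΔx le_rfl, mul_one_div_cancel hβ.ne']

end FractionalKernel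

theorem stmt11 (ν Δx : ℝ) (hν : ν ∈ Set.Ioo (0:ℝ) 1) (hΔx : 0 < Δx) (N : ℕ) (hN : 2 ≤ N) :
    (∀ j n : ℕ, 3 ≤ j → j ≤ n → n ≤ 2 * N →
      0 ≤ Pker ν Δx n (n - j) ∧ Pker ν Δx n (n - j) ≤ 9 * Real.Gamma (2 - ν) * Δx ^ ν) ∧
    (∀ n : ℕ, 3 ≤ n → n ≤ 2 * N →
      ∑ j ∈ Finset.Icc 3 n,
        Pker ν Δx n (n - j) * (((j : ℝ) * Δx) ^ (-ν) / Real.Gamma (1 - ν)) ≤ 9) := by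
  obtain ⟨hν0, hν1⟩ := hν
  refine ⟨fun j n hj hjn _ ↦ ⟨FractionalKernel.Pker_nonneg hν0 hν1 hΔx (by omega), ?_⟩,
    fun n hn _ ↦ (FractionalKernel.sum_Pker_mul_le_one hν0 hν1 hΔx hn).trans (by norm_num)⟩
  refine (FractionalKernel.Pker_le hν0 hν1 hΔx (by omega)).trans ?_
  have := Real.Gamma_pos_of_pos (show 0 < 2 - ν by linarith)
  gcongr
  norm_num
end

section
/- Fix ν ∈ (0,1), Δx > 0, an integer N ≥ 2 and μ > 0. Then for every integer n with 3 ≤ n ≤ 2N, Σ_{j=3}^{n−1} P_{n−j}^n · E_ν(μ·x_j^ν) ≤ (9/μ)·(E_ν(μ·x_n^ν) − 1), where E_ν(z) = Σ_{k=0}^{∞} z^k/Γ(1+kν) is the Mittag–Leffler function and x_j = j·Δx. -/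
open Real Finset

/-- A primitive of `x ↦ ν (c₂ x² + c₁ x + c₀) x^(-ν-1)` on the positive reals. -/
noncomputable def weightedPrim (ν c₂ c₁ c₀ x : ℝ) : ℝ :=
  (ν * (c₂ * x ^ 2 / (2 - ν) + c₁ * x / (1 - ν)) - c₀) * x ^ (-ν)

/-- A primitive of `x ↦ c₂ x² + c₁ x + c₀`. -/
noncomputable def quadPrim (c₂ c₁ c₀ x : ℝ) : ℝ := c₂ * x ^ 3 / 3 + c₁ * x ^ 2 / 2 + c₀ * x

lemma hasDerivAt_weightedPrim {ν x : ℝ} (hν : ν ∈ Set.Ioo (0:ℝ) 1) (c₂ c₁ c₀ : ℝ) (hx : 0 < x) :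
    HasDerivAt (weightedPrim ν c₂ c₁ c₀)
      (ν * (c₂ * x ^ 2 + c₁ * x + c₀) * x ^ (-ν - 1)) x := by
  have h1 : (1 - ν) ≠ 0 := by linarith [hν.2]
  have h2 : (2 - ν) ≠ 0 := by linarith [hν.2]
  have hp : HasDerivAt (fun y : ℝ => y ^ (-ν)) (-ν * x ^ (-ν - 1)) x :=
    Real.hasDerivAt_rpow_const (Or.inl hx.ne')
  have hq : HasDerivAt (fun y : ℝ => ν * (c₂ * y ^ 2 / (2 - ν) + c₁ * y / (1 - ν)) - c₀)
      (ν * (c₂ * (2 * x) / (2 - ν) + c₁ / (1 - ν))) x := by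
    have := (((((hasDerivAt_pow 2 x).const_mul c₂).div_const (2 - ν)).add
      (((hasDerivAt_id x).const_mul c₁).div_const (1 - ν))).const_mul ν).sub_const c₀
    exact this.congr_deriv (by norm_num)
  refine (hq.mul hp).congr_deriv ?_
  have : x ^ (-ν) = x * x ^ (-ν - 1) := by
    rw [mul_comm, ← Real.rpow_add_one hx.ne']; ring_nf
  rw [this]
  field_simp
  ring

lemma hasDerivAt_quadPrim (c₂ c₁ c₀ x : ℝ) :
    HasDerivAt (quadPrim c₂ c₁ c₀) (c₂ * x ^ 2 + c₁ * x + c₀) x := by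
  have := ((((hasDerivAt_pow 3 x).const_mul c₂).div_const 3).add
      (((hasDerivAt_pow 2 x).const_mul c₁).div_const 2)).add ((hasDerivAt_id x).const_mul c₀)
  exact this.congr_deriv (by norm_num; ring)

lemma le_of_hasDerivAt_nonneg {F F' : ℝ → ℝ} {a b : ℝ} (hab : a ≤ b)
    (hF : ∀ x ∈ Set.Icc a b, HasDerivAt F (F' x) x) (h0 : ∀ x ∈ Set.Icc a b, 0 ≤ F' x) :
    F a ≤ F b := by
  refine monotoneOn_of_deriv_nonneg (convex_Icc a b)
    (fun x hx => (hF x hx).continuousAt.continuousWithinAt)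
    (fun x hx => (hF x (interior_subset hx)).differentiableAt.differentiableWithinAt)
    (fun x hx => ?_) (Set.left_mem_Icc.2 hab) (Set.right_mem_Icc.2 hab) hab
  rw [(hF x (interior_subset hx)).deriv]
  exact h0 x (interior_subset hx)

lemma weightedPrim_sub_lower {ν a b : ℝ} (hν : ν ∈ Set.Ioo (0:ℝ) 1) (c₂ c₁ c₀ : ℝ) (ha : 0 < a)
    (hab : a ≤ b) (hp : ∀ x ∈ Set.Icc a b, 0 ≤ c₂ * x ^ 2 + c₁ * x + c₀) :
    ν * b ^ (-ν - 1) * (quadPrim c₂ c₁ c₀ b - quadPrim c₂ c₁ c₀ a)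
      ≤ weightedPrim ν c₂ c₁ c₀ b - weightedPrim ν c₂ c₁ c₀ a := by
  have := le_of_hasDerivAt_nonneg hab
    (fun x hx => (hasDerivAt_weightedPrim hν c₂ c₁ c₀ (ha.trans_le hx.1)).sub
      ((hasDerivAt_quadPrim c₂ c₁ c₀ x).const_mul (ν * b ^ (-ν - 1)))) (fun x hx => ?_)
  · simp only [Pi.sub_apply] at this
    linarith
  · have h1 : b ^ (-ν - 1) ≤ x ^ (-ν - 1) :=
      Real.rpow_le_rpow_of_nonpos (ha.trans_le hx.1) hx.2 (by linarith [hν.1])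
    nlinarith [mul_nonneg (mul_nonneg hν.1.le (hp x hx)) (sub_nonneg.2 h1)]

lemma weightedPrim_sub_upper {ν a b : ℝ} (hν : ν ∈ Set.Ioo (0:ℝ) 1) (c₂ c₁ c₀ : ℝ) (ha : 0 < a)
    (hab : a ≤ b) (hp : ∀ x ∈ Set.Icc a b, 0 ≤ c₂ * x ^ 2 + c₁ * x + c₀) :
    weightedPrim ν c₂ c₁ c₀ b - weightedPrim ν c₂ c₁ c₀ a
      ≤ ν * a ^ (-ν - 1) * (quadPrim c₂ c₁ c₀ b - quadPrim c₂ c₁ c₀ a) := by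
  have := le_of_hasDerivAt_nonneg hab
    (fun x hx => ((hasDerivAt_quadPrim c₂ c₁ c₀ x).const_mul (ν * a ^ (-ν - 1))).sub
      (hasDerivAt_weightedPrim hν c₂ c₁ c₀ (ha.trans_le hx.1))) (fun x hx => ?_)
  · simp only [Pi.sub_apply] at this
    linarith
  · have h1 : x ^ (-ν - 1) ≤ a ^ (-ν - 1) :=
      Real.rpow_le_rpow_of_nonpos ha hx.1 (by linarith [hν.1])
    nlinarith [mul_nonneg (mul_nonneg hν.1.le (hp x hx)) (sub_nonneg.2 h1)]

/-- `Γ(3-ν)/Γ(1-ν) · ∫_q^{q+2} x^(-ν) (q + 3/2 - x) dx`. -/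
noncomputable def wA (ν q : ℝ) : ℝ :=
  (q + 2) ^ (2 - ν) - q ^ (2 - ν) - (2 - ν) / 2 * ((q + 2) ^ (1 - ν) + 3 * q ^ (1 - ν))

/-- `Γ(3-ν)/Γ(1-ν) · ∫_q^{q+2} x^(-ν) (x - q - 1/2) dx`. -/
noncomputable def wC (ν q : ℝ) : ℝ :=
  (2 - ν) / 2 * (3 * (q + 2) ^ (1 - ν) + q ^ (1 - ν)) - (q + 2) ^ (2 - ν) + q ^ (2 - ν)

/-- `Γ(3-ν)/Γ(1-ν) · ∫_p^{p+1} x^(-ν) (p + 1/2 - x) dx`. -/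
noncomputable def wE (ν p : ℝ) : ℝ :=
  (p + 1) ^ (2 - ν) - p ^ (2 - ν) - (2 - ν) / 2 * ((p + 1) ^ (1 - ν) + p ^ (1 - ν))

/-- `Γ(3-ν)/Γ(1-ν) · ∫_p^{p+1} x^(-ν) (x - p + 1/2) dx`. -/
noncomputable def wF (ν p : ℝ) : ℝ :=
  (2 - ν) / 2 * (3 * (p + 1) ^ (1 - ν) - p ^ (1 - ν)) - (p + 1) ^ (2 - ν) + p ^ (2 - ν)

lemma rpow_one_sub' {ν x : ℝ} (hx : 0 < x) : x ^ (1 - ν) = x * x ^ (-ν) := by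
  rw [mul_comm, ← Real.rpow_add_one hx.ne']; ring_nf

lemma rpow_two_sub {ν x : ℝ} (hx : 0 < x) : x ^ (2 - ν) = x ^ 2 * x ^ (-ν) := by
  rw [← Real.rpow_natCast x 2, ← Real.rpow_add hx]; norm_num [sub_eq_add_neg]

lemma rpow_neg_sub_one_le {ν q : ℝ} (hν : ν ∈ Set.Ioo (0:ℝ) 1) (hq : 2 ≤ q) :
    q ^ (-ν - 1) ≤ 4 * (q + 2) ^ (-ν - 1) := by
  have h0 : 0 < q := by linarith
  have h : (2 * q) ^ (-ν - 1) ≤ (q + 2) ^ (-ν - 1) :=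
    Real.rpow_le_rpow_of_nonpos (by linarith) (by linarith) (by linarith [hν.1])
  have h2 : (1:ℝ) / 4 ≤ 2 ^ (-ν - 1) := by
    have : (2:ℝ) ^ (-2 : ℝ) ≤ 2 ^ (-ν - 1) :=
      Real.rpow_le_rpow_of_exponent_le (by norm_num) (by linarith [hν.2])
    norm_num [Real.rpow_neg] at this ⊢
    linarith
  rw [Real.mul_rpow (by norm_num) h0.le] at h
  nlinarith [Real.rpow_pos_of_pos h0 (-ν - 1)]

lemma rpow_neg_le_two_mul {ν x y : ℝ} (hν : ν ∈ Set.Ioo (0:ℝ) 1) (hx : 0 < x) (hy : 0 < y)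
    (hxy : y ≤ 2 * x) : x ^ (-ν) ≤ 2 * y ^ (-ν) := by
  have h : (2 * x) ^ (-ν) ≤ y ^ (-ν) :=
    Real.rpow_le_rpow_of_nonpos hy hxy (by linarith [hν.1])
  have h2 : (1:ℝ) / 2 ≤ 2 ^ (-ν) := by
    have : (2:ℝ) ^ (-1 : ℝ) ≤ 2 ^ (-ν) :=
      Real.rpow_le_rpow_of_exponent_le (by norm_num) (by linarith [hν.2])
    norm_num [Real.rpow_neg] at this ⊢
    linarith
  rw [Real.mul_rpow (by norm_num) hx.le] at h
  nlinarith [Real.rpow_pos_of_pos hx (-ν)]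

section Weights

variable {ν : ℝ}

lemma wC_eq (hν : ν ∈ Set.Ioo (0:ℝ) 1) {q : ℝ} (hq : 0 < q) :
    wC ν q = (2 - ν) * (1 - ν) * ((q + 2) ^ (-ν)
      + (weightedPrim ν (1 / 2) (-(q + 1 / 2)) ((q ^ 2 + q) / 2) (q + 2)
        - weightedPrim ν (1 / 2) (-(q + 1 / 2)) ((q ^ 2 + q) / 2) q)) := by
  have h1 : (1 - ν) ≠ 0 := by linarith [hν.2]
  have h2 : (2 - ν) ≠ 0 := by linarith [hν.2]
  have h3 : 0 < q + 2 := by linarith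
  simp only [wC, weightedPrim, rpow_one_sub' hq, rpow_two_sub hq, rpow_one_sub' h3,
    rpow_two_sub h3]
  field_simp
  ring

lemma rpow_add_two_le_wC_aux (hν : ν ∈ Set.Ioo (0:ℝ) 1) {q : ℝ} (hq : 2 ≤ q) :
    0 ≤ weightedPrim ν (1 / 2) (-(q + 1 / 2)) ((q ^ 2 + q) / 2) (q + 2)
        - weightedPrim ν (1 / 2) (-(q + 1 / 2)) ((q ^ 2 + q) / 2) q := by
  have h1 := weightedPrim_sub_upper hν (-1 / 2) (q + 1 / 2) (-(q ^ 2 + q) / 2)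
    (show 0 < q by linarith) (show q ≤ q + 1 by linarith) (fun x hx => by
      nlinarith [mul_nonneg (sub_nonneg.2 hx.1) (sub_nonneg.2 hx.2)])
  have h2 := weightedPrim_sub_lower hν (1 / 2) (-(q + 1 / 2)) ((q ^ 2 + q) / 2)
    (show 0 < q + 1 by linarith) (show q + 1 ≤ q + 2 by linarith) (fun x hx => by
      nlinarith [mul_nonneg (sub_nonneg.2 hx.1) (sub_nonneg.2 ((le_add_of_nonneg_right zero_le_one).trans hx.1))])
  have h3 := mul_le_mul_of_nonneg_left (rpow_neg_sub_one_le hν hq) hν.1.le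
  have h4 := mul_nonneg hν.1.le (Real.rpow_pos_of_pos (show 0 < q + 2 by linarith) (-ν - 1)).le
  have e1 : quadPrim (-1 / 2) (q + 1 / 2) (-(q ^ 2 + q) / 2) (q + 1)
    - quadPrim (-1 / 2) (q + 1 / 2) (-(q ^ 2 + q) / 2) q = 1 / 12 := by
    simp only [quadPrim]; ring
  have e2 : quadPrim (1 / 2) (-(q + 1 / 2)) ((q ^ 2 + q) / 2) (q + 2)
    - quadPrim (1 / 2) (-(q + 1 / 2)) ((q ^ 2 + q) / 2) (q + 1) = 5 / 12 := by
    simp only [quadPrim]; ring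
  have e3 : ∀ x, weightedPrim ν (-1 / 2) (q + 1 / 2) (-(q ^ 2 + q) / 2) x
      = -weightedPrim ν (1 / 2) (-(q + 1 / 2)) ((q ^ 2 + q) / 2) x := by
    intro x; simp only [weightedPrim]; ring
  rw [e1, e3, e3] at h1
  rw [e2] at h2
  linarith

lemma const_pos (hν : ν ∈ Set.Ioo (0:ℝ) 1) : 0 < (2 - ν) * (1 - ν) :=
  mul_pos (by linarith [hν.2]) (by linarith [hν.2])

lemma rpow_le_wC (hν : ν ∈ Set.Ioo (0:ℝ) 1) {q : ℝ} (hq : 2 ≤ q) :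
    (2 - ν) * (1 - ν) * (q + 2) ^ (-ν) ≤ wC ν q := by
  rw [wC_eq hν (by linarith)]
  exact mul_le_mul_of_nonneg_left (by linarith [rpow_add_two_le_wC_aux hν hq]) (const_pos hν).le

lemma wA_sub_wC_eq (hν : ν ∈ Set.Ioo (0:ℝ) 1) {q : ℝ} (hq : 0 < q) :
    wA ν q - wC ν q = (2 - ν) * (1 - ν) *
      (weightedPrim ν (-1) (2 * (q + 1)) (-(q ^ 2 + 2 * q)) (q + 2)
        - weightedPrim ν (-1) (2 * (q + 1)) (-(q ^ 2 + 2 * q)) q) := by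
  have h1 : (1 - ν) ≠ 0 := by linarith [hν.2]
  have h2 : (2 - ν) ≠ 0 := by linarith [hν.2]
  have h3 : 0 < q + 2 := by linarith
  simp only [wA, wC, weightedPrim, rpow_one_sub' hq, rpow_two_sub hq, rpow_one_sub' h3,
    rpow_two_sub h3]
  field_simp
  ring

lemma wE_eq (hν : ν ∈ Set.Ioo (0:ℝ) 1) {p : ℝ} (hp : 0 < p) :
    wE ν p = (2 - ν) * (1 - ν) *
      (weightedPrim ν (-1 / 2) (p + 1 / 2) (-(p ^ 2 + p) / 2) (p + 1)
        - weightedPrim ν (-1 / 2) (p + 1 / 2) (-(p ^ 2 + p) / 2) p) := by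
  have h1 : (1 - ν) ≠ 0 := by linarith [hν.2]
  have h2 : (2 - ν) ≠ 0 := by linarith [hν.2]
  have h3 : 0 < p + 1 := by linarith
  simp only [wE, weightedPrim, rpow_one_sub' hp, rpow_two_sub hp, rpow_one_sub' h3,
    rpow_two_sub h3]
  field_simp
  ring

lemma wE_bounds (hν : ν ∈ Set.Ioo (0:ℝ) 1) {p : ℝ} (hp : 0 < p) :
    0 ≤ wE ν p ∧ wE ν p ≤ (2 - ν) * (1 - ν) * (ν * p ^ (-ν - 1) * (1 / 12)) := by
  have hw : ∀ x ∈ Set.Icc p (p + 1), 0 ≤ -1 / 2 * x ^ 2 + (p + 1 / 2) * x + -(p ^ 2 + p) / 2 :=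
    fun x hx => by nlinarith [mul_nonneg (sub_nonneg.2 hx.1) (sub_nonneg.2 hx.2)]
  have h1 := weightedPrim_sub_upper hν (-1 / 2) (p + 1 / 2) (-(p ^ 2 + p) / 2) hp
    (show p ≤ p + 1 by linarith) hw
  have h2 := weightedPrim_sub_lower hν (-1 / 2) (p + 1 / 2) (-(p ^ 2 + p) / 2) hp
    (show p ≤ p + 1 by linarith) hw
  have e1 : quadPrim (-1 / 2) (p + 1 / 2) (-(p ^ 2 + p) / 2) (p + 1)
    - quadPrim (-1 / 2) (p + 1 / 2) (-(p ^ 2 + p) / 2) p = 1 / 12 := by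
    simp only [quadPrim]; ring
  rw [e1] at h1 h2
  have h4 := mul_nonneg hν.1.le (Real.rpow_pos_of_pos (show 0 < p + 1 by linarith) (-ν - 1)).le
  rw [wE_eq hν hp]
  exact ⟨mul_nonneg (const_pos hν).le (by linarith),
    mul_le_mul_of_nonneg_left h1 (const_pos hν).le⟩

lemma wC_add_wE_le_wA (hν : ν ∈ Set.Ioo (0:ℝ) 1) {q : ℝ} (hq : 0 < q) :
    wC ν q + wE ν (q + 2) ≤ wA ν q := by
  have h1 := weightedPrim_sub_lower hν (-1) (2 * (q + 1)) (-(q ^ 2 + 2 * q)) hq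
    (show q ≤ q + 2 by linarith) (fun x hx => by
      nlinarith [mul_nonneg (sub_nonneg.2 hx.1) (sub_nonneg.2 hx.2)])
  have e1 : quadPrim (-1) (2 * (q + 1)) (-(q ^ 2 + 2 * q)) (q + 2)
    - quadPrim (-1) (2 * (q + 1)) (-(q ^ 2 + 2 * q)) q = 4 / 3 := by
    simp only [quadPrim]; ring
  rw [e1] at h1
  have h2 := (wE_bounds hν (show 0 < q + 2 by linarith)).2
  have h3 := mul_le_mul_of_nonneg_left h1 (const_pos hν).le
  have h4 := mul_nonneg (const_pos hν).le
    (mul_nonneg hν.1.le (Real.rpow_pos_of_pos (show 0 < q + 2 by linarith) (-ν - 1)).le)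
  rw [← wA_sub_wC_eq hν hq] at h3
  linarith

lemma wC_le_wA (hν : ν ∈ Set.Ioo (0:ℝ) 1) {q : ℝ} (hq : 0 < q) : wC ν q ≤ wA ν q := by
  linarith [wC_add_wE_le_wA hν hq, (wE_bounds hν (show 0 < q + 2 by linarith)).1]

lemma wF_eq (hν : ν ∈ Set.Ioo (0:ℝ) 1) {p : ℝ} (hp : 0 < p) :
    wF ν p = (2 - ν) * (1 - ν) * ((p + 1) ^ (-ν)
      + (weightedPrim ν (1 / 2) (1 / 2 - p) ((p ^ 2 - p) / 2) (p + 1)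
        - weightedPrim ν (1 / 2) (1 / 2 - p) ((p ^ 2 - p) / 2) p)) := by
  have h1 : (1 - ν) ≠ 0 := by linarith [hν.2]
  have h2 : (2 - ν) ≠ 0 := by linarith [hν.2]
  have h3 : 0 < p + 1 := by linarith
  simp only [wF, weightedPrim, rpow_one_sub' hp, rpow_two_sub hp, rpow_one_sub' h3,
    rpow_two_sub h3]
  field_simp
  ring

lemma rpow_le_wF (hν : ν ∈ Set.Ioo (0:ℝ) 1) {p : ℝ} (hp : 0 < p) :
    (2 - ν) * (1 - ν) * (p + 1) ^ (-ν) ≤ wF ν p := by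
  have h1 := le_of_hasDerivAt_nonneg (show p ≤ p + 1 by linarith)
    (fun x hx => hasDerivAt_weightedPrim hν (1 / 2) (1 / 2 - p) ((p ^ 2 - p) / 2)
      (hp.trans_le hx.1)) (fun x hx => mul_nonneg (mul_nonneg hν.1.le
        (by nlinarith [mul_nonneg (sub_nonneg.2 hx.1) (sub_nonneg.2 hx.1), hx.1]))
        (Real.rpow_pos_of_pos (hp.trans_le hx.1) _).le)
  rw [wF_eq hν hp]
  exact mul_le_mul_of_nonneg_left (by linarith) (const_pos hν).le

lemma wF_le_rpow (hν : ν ∈ Set.Ioo (0:ℝ) 1) {p : ℝ} (hp : 0 < p) :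
    wF ν p ≤ (2 - ν) * (1 - ν) * p ^ (-ν) := by
  have h1 := le_of_hasDerivAt_nonneg (show p ≤ p + 1 by linarith)
    (fun x hx => hasDerivAt_weightedPrim hν (-1 / 2) (p - 1 / 2) (1 - (p ^ 2 - p) / 2)
      (hp.trans_le hx.1)) (fun x hx => mul_nonneg (mul_nonneg hν.1.le
        (by nlinarith [mul_nonneg (sub_nonneg.2 hx.1) (sub_nonneg.2 hx.2), hx.1, hx.2]))
        (Real.rpow_pos_of_pos (hp.trans_le hx.1) _).le)
  have e : ∀ x, weightedPrim ν (-1 / 2) (p - 1 / 2) (1 - (p ^ 2 - p) / 2) x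
      = -weightedPrim ν (1 / 2) (1 / 2 - p) ((p ^ 2 - p) / 2) x - x ^ (-ν) := by
    intro x; simp only [weightedPrim]; ring
  rw [e, e] at h1
  rw [wF_eq hν hp]
  exact mul_le_mul_of_nonneg_left (by linarith) (const_pos hν).le

lemma wF_le_wC_add_wE (hν : ν ∈ Set.Ioo (0:ℝ) 1) {q : ℝ} (hq : 2 ≤ q) :
    wF ν (q + 2) ≤ wC ν q + wE ν (q + 2) := by
  have := rpow_le_wC hν hq
  linarith [wF_le_rpow hν (show 0 < q + 2 by linarith), (wE_bounds hν (show 0 < q + 2 by linarith)).1]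

lemma wA_eq (hν : ν ∈ Set.Ioo (0:ℝ) 1) {q : ℝ} (hq : 0 < q) :
    wA ν q = (2 - ν) * (1 - ν) * (q ^ (-ν)
      - (weightedPrim ν (1 / 2) (-(q + 3 / 2)) ((q + 1) * (q + 2) / 2) (q + 2)
        - weightedPrim ν (1 / 2) (-(q + 3 / 2)) ((q + 1) * (q + 2) / 2) q)) := by
  have h1 : (1 - ν) ≠ 0 := by linarith [hν.2]
  have h2 : (2 - ν) ≠ 0 := by linarith [hν.2]
  have h3 : 0 < q + 2 := by linarith
  simp only [wA, weightedPrim, rpow_one_sub' hq, rpow_two_sub hq, rpow_one_sub' h3,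
    rpow_two_sub h3]
  field_simp
  ring

lemma wA_le_rpow (hν : ν ∈ Set.Ioo (0:ℝ) 1) {q : ℝ} (hq : 0 < q) :
    wA ν q ≤ (2 - ν) * (1 - ν) * q ^ (-ν) := by
  have h1 := weightedPrim_sub_lower hν (1 / 2) (-(q + 3 / 2)) ((q + 1) * (q + 2) / 2)
    hq (show q ≤ q + 1 by linarith) (fun x hx => by
      nlinarith [mul_nonneg (sub_nonneg.2 hx.2) (sub_nonneg.2 hx.2), hx.2])
  have h2 := weightedPrim_sub_upper hν (-1 / 2) (q + 3 / 2) (-((q + 1) * (q + 2)) / 2)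
    (show 0 < q + 1 by linarith) (show q + 1 ≤ q + 2 by linarith) (fun x hx => by
      nlinarith [mul_nonneg (sub_nonneg.2 hx.1) (sub_nonneg.2 hx.2)])
  have e1 : quadPrim (1 / 2) (-(q + 3 / 2)) ((q + 1) * (q + 2) / 2) (q + 1)
    - quadPrim (1 / 2) (-(q + 3 / 2)) ((q + 1) * (q + 2) / 2) q = 5 / 12 := by
    simp only [quadPrim]; ring
  have e2 : quadPrim (-1 / 2) (q + 3 / 2) (-((q + 1) * (q + 2)) / 2) (q + 2)
    - quadPrim (-1 / 2) (q + 3 / 2) (-((q + 1) * (q + 2)) / 2) (q + 1) = 1 / 12 := by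
    simp only [quadPrim]; ring
  have e3 : ∀ x, weightedPrim ν (-1 / 2) (q + 3 / 2) (-((q + 1) * (q + 2)) / 2) x
      = -weightedPrim ν (1 / 2) (-(q + 3 / 2)) ((q + 1) * (q + 2) / 2) x := by
    intro x; simp only [weightedPrim]; ring
  have h4 := mul_nonneg hν.1.le (Real.rpow_pos_of_pos (show 0 < q + 1 by linarith) (-ν - 1)).le
  rw [e1] at h1
  rw [e2, e3, e3] at h2
  rw [wA_eq hν hq]
  exact mul_le_mul_of_nonneg_left (by linarith) (const_pos hν).le

lemma wA_add_two_le_wC (hν : ν ∈ Set.Ioo (0:ℝ) 1) {q : ℝ} (hq : 2 ≤ q) :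
    wA ν (q + 2) ≤ wC ν q :=
  (wA_le_rpow hν (by linarith)).trans (rpow_le_wC hν hq)

lemma wA_zero (hν : ν ∈ Set.Ioo (0:ℝ) 1) : wA ν 0 = (2 + ν) * 2 ^ (-ν) := by
  simp only [wA, zero_add, rpow_two_sub (two_pos (α := ℝ)), rpow_one_sub' (two_pos (α := ℝ))]
  rw [Real.zero_rpow (by linarith [hν.2]), Real.zero_rpow (by linarith [hν.2])]
  ring

lemma wC_zero (hν : ν ∈ Set.Ioo (0:ℝ) 1) : wC ν 0 = (2 - 3 * ν) * 2 ^ (-ν) := by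
  simp only [wC, zero_add, rpow_two_sub (two_pos (α := ℝ)), rpow_one_sub' (two_pos (α := ℝ))]
  rw [Real.zero_rpow (by linarith [hν.2]), Real.zero_rpow (by linarith [hν.2])]
  ring

end Weights

/-- The weight, scaled by `Γ(3-ν)`, of the increment `y_{j-i} - y_{j-i-1}` in the discrete Caputo
derivative at level `j`. -/
noncomputable def incrWeight (ν : ℝ) (j i : ℕ) : ℝ :=
  if j % 2 = 1 ∧ i + 1 = j then wF ν i
  else if j % 2 = 1 ∧ i + 2 = j then wC ν ((i : ℝ) - 1) + wE ν ((i : ℝ) + 1)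
  else if i % 2 = 0 then wA ν i
  else wC ν ((i : ℝ) - 1)

/-- The `θ`-discounted sums of the increment weights; these are the `B̄_i^j` up to scaling. -/
noncomputable def thetaSum (ν : ℝ) (j : ℕ) : ℕ → ℝ
  | 0 => wA ν 0
  | i + 1 => theta ν * thetaSum ν j i + incrWeight ν j (i + 1)

lemma incrWeight_zero (ν : ℝ) {j : ℕ} (hj : 3 ≤ j) : incrWeight ν j 0 = wA ν 0 := by
  unfold incrWeight
  rw [if_neg (by omega), if_neg (by omega)]
  simp

section Levels

variable {ν : ℝ}

lemma theta_mem (hν : ν ∈ Set.Ioo (0:ℝ) 1) : 0 < theta ν ∧ theta ν < 1 := by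
  unfold theta
  constructor
  · exact div_pos (by linarith [hν.1]) (by linarith [hν.1])
  · rw [div_lt_one (by linarith [hν.1])]; linarith [hν.2]

lemma theta_mul_wA_zero (hν : ν ∈ Set.Ioo (0:ℝ) 1) : theta ν * wA ν 0 = 2 * ν * 2 ^ (-ν) := by
  have : 2 + ν ≠ 0 := by linarith [hν.1]
  rw [wA_zero hν, theta]; field_simp

lemma half_le_two_rpow_neg (hν : ν ∈ Set.Ioo (0:ℝ) 1) : (1:ℝ) / 2 ≤ 2 ^ (-ν) := by
  have := rpow_neg_le_two_mul hν one_pos two_pos (by norm_num)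
  rw [Real.one_rpow] at this
  linarith

lemma incrWeight_succ_le (hν : ν ∈ Set.Ioo (0:ℝ) 1) {j i : ℕ} (hi : 2 ≤ i)
    (hij : i + 1 < j) : incrWeight ν j (i + 1) ≤ incrWeight ν j i := by
  have hi2 : (2:ℝ) ≤ i := by exact_mod_cast hi
  unfold incrWeight
  rcases Nat.mod_two_eq_zero_or_one i with h | h
  · have h4 : ¬ (i + 1) % 2 = 0 := by omega
    have h1 : ¬ (j % 2 = 1 ∧ i + 1 + 1 = j) := by omega
    have h2 : ¬ (j % 2 = 1 ∧ i + 1 = j) := by omega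
    have h3 : ¬ (j % 2 = 1 ∧ i + 2 = j) := by omega
    rw [if_neg h1, if_neg h2, if_neg h3, if_pos h, if_neg h4]
    push_cast
    have e1 : (i:ℝ) + 1 - 1 = i := by ring
    have e2 : (i:ℝ) + 1 + 1 = i + 2 := by ring
    rw [e1, e2]
    split_ifs
    · exact wC_add_wE_le_wA hν (by linarith)
    · exact wC_le_wA hν (by linarith)
  · have hi3 : (3:ℝ) ≤ i := by exact_mod_cast (by omega : 3 ≤ i)
    have h4 : (i + 1) % 2 = 0 := by omega
    have h5 : ¬ i % 2 = 0 := by omega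
    have h1 : ¬ (j % 2 = 1 ∧ i + 1 + 2 = j) := by omega
    have h2 : ¬ (j % 2 = 1 ∧ i + 1 = j) := by omega
    rw [if_neg h1, if_neg h2, if_pos h4, if_neg h5]
    push_cast
    have e1 : (i:ℝ) + 1 = (i - 1) + 2 := by ring
    by_cases h6 : j % 2 = 1 ∧ i + 1 + 1 = j
    · have h7 : j % 2 = 1 ∧ i + 2 = j := by omega
      rw [if_pos h6, if_pos h7, e1]
      exact wF_le_wC_add_wE hν (by linarith)
    · have h7 : ¬ (j % 2 = 1 ∧ i + 2 = j) := by omega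
      rw [if_neg h6, if_neg h7, e1]
      exact wA_add_two_le_wC hν (by linarith)

lemma thetaSum_one_le (hν : ν ∈ Set.Ioo (0:ℝ) 1) {j : ℕ} (hj : 3 ≤ j) :
    thetaSum ν j 1 ≤ thetaSum ν j 0 ∧ (2 - ν) * 2 ^ (-ν) ≤ thetaSum ν j 1 := by
  have hE := wE_bounds hν two_pos
  have h2 : (2:ℝ) ^ (-ν - 1) = 2 ^ (-ν) / 2 := Real.rpow_sub_one two_ne_zero _
  have hp : (0:ℝ) < 2 ^ (-ν) := Real.rpow_pos_of_pos two_pos _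
  have hE' : wE ν 2 ≤ ν * 2 ^ (-ν) := by
    refine hE.2.trans ?_
    rw [h2]
    have h3 := mul_nonneg hν.1.le hp.le
    have : (2 - ν) * (1 - ν) ≤ 2 := by nlinarith [hν.1, hν.2]
    nlinarith
  simp only [thetaSum, theta_mul_wA_zero hν]
  rw [wA_zero hν, incrWeight, if_neg (by omega), Nat.zero_add, Nat.cast_one, sub_self, wC_zero hν,
    one_add_one_eq_two]
  have := mul_nonneg hν.1.le hp.le
  split_ifs
  · constructor <;> nlinarith [hE.1]
  · contradiction
  · constructor <;> nlinarith [hE.1]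

lemma thetaSum_two_le (hν : ν ∈ Set.Ioo (0:ℝ) 1) {j : ℕ} (hj : 3 ≤ j) :
    thetaSum ν j 2 ≤ thetaSum ν j 1 := by
  have hlow := (thetaSum_one_le hν hj).2
  have hp : (0:ℝ) < 2 ^ (-ν) := Real.rpow_pos_of_pos two_pos _
  have hθ : 1 - theta ν = (2 - ν) / (2 + ν) := by
    have : 2 + ν ≠ 0 := by linarith [hν.1]
    unfold theta; field_simp; ring
  have hw : incrWeight ν j 2 ≤ (2 - ν) * (1 - ν) * 2 ^ (-ν) := by
    unfold incrWeight
    rw [if_neg (by omega : ¬ (j % 2 = 1 ∧ 2 + 2 = j))]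
    split_ifs
    · exact_mod_cast wF_le_rpow hν two_pos
    · exact_mod_cast wA_le_rpow hν two_pos
    · omega
  have h3 : (2 - ν) * (1 - ν) * 2 ^ (-ν) ≤ (1 - theta ν) * ((2 - ν) * 2 ^ (-ν)) := by
    have : 1 - ν ≤ 1 - theta ν := by
      rw [hθ, le_div_iff₀ (by linarith [hν.1])]; nlinarith [hν.1, hν.2]
    have h5 : 0 ≤ (2 - ν) * 2 ^ (-ν) := mul_nonneg (by linarith [hν.2]) hp.le
    nlinarith
  have h4 := mul_le_mul_of_nonneg_left hlow (sub_nonneg.2 (theta_mem hν).2.le)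
  rw [show thetaSum ν j 2 = theta ν * thetaSum ν j 1 + incrWeight ν j 2 from rfl]
  linarith

lemma thetaSum_succ_le (hν : ν ∈ Set.Ioo (0:ℝ) 1) {j : ℕ} (hj : 3 ≤ j) :
    ∀ i, i + 1 < j → thetaSum ν j (i + 1) ≤ thetaSum ν j i
  | 0, _ => (thetaSum_one_le hν hj).1
  | 1, _ => thetaSum_two_le hν hj
  | i + 2, h => by
    have ih := thetaSum_succ_le hν hj (i + 1) (by omega)
    have hw := incrWeight_succ_le hν (by omega : 2 ≤ i + 2) h
    have := mul_le_mul_of_nonneg_left ih (theta_mem hν).1.le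
    rw [show thetaSum ν j (i + 2 + 1)
      = theta ν * thetaSum ν j (i + 2) + incrWeight ν j (i + 2 + 1) from rfl,
      show thetaSum ν j (i + 2)
      = theta ν * thetaSum ν j (i + 1) + incrWeight ν j (i + 2) from rfl]
    rw [show thetaSum ν j (i + 1 + 1)
      = theta ν * thetaSum ν j (i + 1) + incrWeight ν j (i + 2) from rfl] at ih this
    linarith

lemma incrWeight_lower (hν : ν ∈ Set.Ioo (0:ℝ) 1) {j i : ℕ} (hi : 2 ≤ i) :
    (2 - ν) * (1 - ν) * (i : ℝ) ^ (-ν) ≤ 3 * incrWeight ν j i := by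
  have hi2 : (2:ℝ) ≤ i := by exact_mod_cast hi
  have hc := const_pos hν
  have key : ∀ {y w : ℝ}, 0 < y → y ≤ 2 * i → (2 - ν) * (1 - ν) * y ^ (-ν) ≤ w →
      (2 - ν) * (1 - ν) * (i : ℝ) ^ (-ν) ≤ 3 * w := by
    intro y w hy hyi hw
    have h1 := rpow_neg_le_two_mul hν (show (0:ℝ) < i by linarith) hy hyi
    have h2 := mul_le_mul_of_nonneg_left h1 hc.le
    have h3 := mul_pos hc (Real.rpow_pos_of_pos hy (-ν))
    linarith
  unfold incrWeight
  split_ifs with h1 h2 h3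
  · exact key (by linarith) (by linarith) (rpow_le_wF hν (by linarith))
  · have hi3 : (3:ℝ) ≤ i := by exact_mod_cast (by omega : 3 ≤ i)
    refine key (y := (i : ℝ) - 1 + 2) (by linarith) (by linarith)
      ((rpow_le_wC hν (by linarith)).trans ?_)
    linarith [(wE_bounds hν (show (0:ℝ) < i + 1 by linarith)).1]
  · exact key (by linarith) (by linarith) ((rpow_le_wC hν hi2).trans (wC_le_wA hν (by linarith)))
  · have hi3 : (3:ℝ) ≤ i := by exact_mod_cast (by omega : 3 ≤ i)
    exact key (by linarith) (by linarith) (rpow_le_wC hν (by linarith))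

lemma thetaSum_pos (hν : ν ∈ Set.Ioo (0:ℝ) 1) {j : ℕ} (hj : 3 ≤ j) : ∀ i, 0 < thetaSum ν j i
  | 0 => by
    rw [thetaSum, wA_zero hν]
    exact mul_pos (by linarith [hν.1]) (Real.rpow_pos_of_pos two_pos _)
  | 1 => lt_of_lt_of_le (mul_pos (by linarith [hν.2]) (Real.rpow_pos_of_pos two_pos _))
      (thetaSum_one_le hν hj).2
  | i + 2 => by
    have h1 := incrWeight_lower hν (j := j) (by omega : 2 ≤ i + 2)
    have h2 := mul_pos (const_pos hν)
      (Real.rpow_pos_of_pos (show (0:ℝ) < ((i + 2 : ℕ) : ℝ) by positivity) (-ν))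
    have h3 := mul_pos (theta_mem hν).1 (thetaSum_pos hν hj (i + 1))
    rw [thetaSum]
    linarith

/-- An upper bound for `∫_i^{i+1} x^(-ν) dx` that also bounds `x^(-ν)` on `[i, i+1]` if `i > 0`. -/
noncomputable def kernelBound (ν : ℝ) (i : ℕ) : ℝ :=
  if i = 0 then 1 / (1 - ν) else (i : ℝ) ^ (-ν)

lemma kernelBound_le_thetaSum (hν : ν ∈ Set.Ioo (0:ℝ) 1) {j : ℕ} (hj : 3 ≤ j) (i : ℕ) :
    (2 - ν) * (1 - ν) * kernelBound ν i ≤ 3 * thetaSum ν j i := by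
  have hh := half_le_two_rpow_neg hν
  match i with
  | 0 =>
    have h1 : 1 - ν ≠ 0 := by linarith [hν.2]
    rw [kernelBound, if_pos rfl, thetaSum, wA_zero hν]
    rw [mul_assoc, mul_one_div_cancel h1]
    nlinarith [hν.1, hν.2]
  | 1 =>
    have := (thetaSum_one_le hν hj).2
    rw [kernelBound, if_neg one_ne_zero, Nat.cast_one, Real.one_rpow]
    nlinarith [hν.1, hν.2]
  | i + 2 =>
    have h1 := incrWeight_lower hν (j := j) (by omega : 2 ≤ i + 2)
    have h3 := mul_pos (theta_mem hν).1 (thetaSum_pos hν hj (i + 1))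
    rw [kernelBound, if_neg (by omega), thetaSum]
    linarith

end Levels

section Coefficients

variable {ν : ℝ}

lemma Gamma_three_sub_pos (hν : ν ∈ Set.Ioo (0:ℝ) 1) : 0 < Real.Gamma (3 - ν) :=
  Real.Gamma_pos_of_pos (by linarith [hν.2])

lemma Gamma_mul_alpha0 (hν : ν ∈ Set.Ioo (0:ℝ) 1) :
    Real.Gamma (3 - ν) * alpha0 ν = wA ν 0 := by
  have hΓ := (Gamma_three_sub_pos hν).ne'
  have hp : (2:ℝ) ^ ν ≠ 0 := (Real.rpow_pos_of_pos two_pos _).ne'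
  rw [wA_zero hν, alpha0, Real.rpow_neg two_pos.le]
  field_simp
  ring

lemma alpha0_pos (hν : ν ∈ Set.Ioo (0:ℝ) 1) : 0 < alpha0 ν :=
  div_pos (by linarith [hν.1])
    (mul_pos (Real.rpow_pos_of_pos two_pos _) (Gamma_three_sub_pos hν))

lemma Gamma_mul_Dbar_even (hν : ν ∈ Set.Ioo (0:ℝ) 1) {m r i : ℕ} (hr : 1 ≤ r)
    (h : i + r = m) :
    Real.Gamma (3 - ν) * Dbar ν m (2 * r) = wA ν (2 * i + 2) - wC ν (2 * i) := by
  have hΓ := (Gamma_three_sub_pos hν).ne'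
  have e : (2 * m : ℝ) - 2 * (2 * r / 2 : ℕ) = 2 * i := by
    rw [Nat.mul_div_cancel_left _ two_pos, ← h]; push_cast; ring
  rw [Dbar, if_neg (by omega), if_pos (by omega), e, ← mul_assoc, mul_one_div_cancel hΓ, wA, wC]
  rw [show (2 * i + 2 + 2 : ℝ) = 2 * i + 4 by ring]
  ring

lemma Gamma_mul_Dbar_odd (hν : ν ∈ Set.Ioo (0:ℝ) 1) {m r i : ℕ} (h : i + r = m) :
    Real.Gamma (3 - ν) * Dbar ν m (2 * r + 1) = wC ν (2 * i) - wA ν (2 * i) := by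
  have hΓ := (Gamma_three_sub_pos hν).ne'
  have e : (2 * m : ℝ) - 2 * ((2 * r + 1) / 2 : ℕ) = 2 * i := by
    rw [show (2 * r + 1) / 2 = r by omega, ← h]; push_cast; ring
  rw [Dbar, if_neg (by omega), if_neg (by omega), e, ← mul_assoc, mul_div_cancel₀ _ hΓ, wA, wC]
  ring

lemma Gamma_mul_Dbar (hν : ν ∈ Set.Ioo (0:ℝ) 1) {j m k i : ℕ} (hk : 1 ≤ k)
    (h : i + k = 2 * m + 1) (h1 : j % 2 = 1 → i + 3 < j) :
    Real.Gamma (3 - ν) * Dbar ν m k = incrWeight ν j (i + 1) - incrWeight ν j i := by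
  unfold incrWeight
  rcases Nat.even_or_odd' k with ⟨r, rfl | rfl⟩
  · rw [if_neg (by omega), if_neg (by omega), if_pos (by omega), if_neg (by omega),
      if_neg (by omega), if_neg (by omega)]
    obtain ⟨s, rfl⟩ : ∃ s, i = 2 * s + 1 := ⟨i / 2, by omega⟩
    rw [Gamma_mul_Dbar_even hν (by omega) (show s + r = m by omega)]
    push_cast
    ring_nf
  · rw [if_neg (by omega), if_neg (by omega), if_neg (by omega), if_neg (by omega),
      if_neg (by omega), if_pos (by omega)]
    obtain ⟨s, rfl⟩ : ∃ s, i = 2 * s := ⟨i / 2, by omega⟩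
    rw [Gamma_mul_Dbar_odd hν (show s + r = m by omega)]
    push_cast
    ring_nf

lemma Gamma_mul_Dco_one (hν : ν ∈ Set.Ioo (0:ℝ) 1) {m : ℕ} (hm : 1 ≤ m) :
    Real.Gamma (3 - ν) * Dco ν m 1
      = incrWeight ν (2 * m + 1) (2 * m) - incrWeight ν (2 * m + 1) (2 * m - 1) := by
  have hΓ := (Gamma_three_sub_pos hν).ne'
  obtain ⟨s, rfl⟩ : ∃ s, m = s + 1 := ⟨m - 1, by omega⟩
  unfold incrWeight
  rw [if_pos (by omega), if_neg (by omega), if_pos (by omega), Dco, if_neg one_ne_zero, if_pos rfl,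
    ← mul_assoc, mul_one_div_cancel hΓ, wF, wC, wE, show 2 * (s + 1) - 1 = 2 * s + 1 by omega]
  push_cast
  rw [show (2 * ((s:ℝ) + 1) - 2) = 2 * s by ring, show (2 * (s:ℝ) + 1 - 1) = 2 * s by ring,
    show (2 * (s:ℝ) + 1 + 1) = 2 * (s + 1) by ring, show (2 * (s:ℝ) + 2) = 2 * (s + 1) by ring]
  ring

lemma Gamma_mul_Dco_two (hν : ν ∈ Set.Ioo (0:ℝ) 1) {m : ℕ} (hm : 1 ≤ m) :
    Real.Gamma (3 - ν) * Dco ν m 2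
      = incrWeight ν (2 * m + 1) (2 * m - 1) - incrWeight ν (2 * m + 1) (2 * m - 2) := by
  have hΓ := (Gamma_three_sub_pos hν).ne'
  obtain ⟨s, rfl⟩ : ∃ s, m = s + 1 := ⟨m - 1, by omega⟩
  unfold incrWeight
  rw [if_neg (by omega), if_pos (by omega), if_neg (by omega), if_neg (by omega),
    if_pos (by omega), Dco, if_neg two_ne_zero, if_neg (by norm_num), if_pos rfl,
    ← mul_assoc, mul_one_div_cancel hΓ, wA, wC, wE, show 2 * (s + 1) - 1 = 2 * s + 1 by omega,
    show 2 * (s + 1) - 2 = 2 * s by omega]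
  push_cast
  rw [show (2 * ((s:ℝ) + 1) - 2) = 2 * s by ring, show (2 * (s:ℝ) + 1 - 1) = 2 * s by ring,
    show (2 * (s:ℝ) + 1 + 1) = 2 * (s + 1) by ring, show (2 * (s:ℝ) + 2) = 2 * (s + 1) by ring]
  ring

lemma wA_zero_mul_dco (hν : ν ∈ Set.Ioo (0:ℝ) 1) {j i : ℕ} (hj : 3 ≤ j) (hi : i + 1 < j) :
    wA ν 0 * dco ν j (j - (i + 1)) = incrWeight ν j i - incrWeight ν j (i + 1) := by
  have hα := (alpha0_pos hν).ne'
  have e : ∀ D, wA ν 0 * (-D / alpha0 ν) = -(Real.Gamma (3 - ν) * D) := by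
    intro D; rw [← Gamma_mul_alpha0 hν]; field_simp
  rw [dco]
  split_ifs with h
  · obtain ⟨m, rfl⟩ : ∃ m, j = 2 * m + 1 := ⟨j / 2, by omega⟩
    rw [e, show (2 * m + 1) / 2 = m by omega]
    obtain rfl | rfl | hlt : i = 2 * m - 1 ∨ i = 2 * m - 2 ∨ i + 3 < 2 * m + 1 := by omega
    · rw [show 2 * m + 1 - (2 * m - 1 + 1) = 1 by omega, Gamma_mul_Dco_one hν (by omega),
        show 2 * m - 1 + 1 = 2 * m by omega]
      ring
    · rw [show 2 * m + 1 - (2 * m - 2 + 1) = 2 by omega, Gamma_mul_Dco_two hν (by omega),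
        show 2 * m - 2 + 1 = 2 * m - 1 by omega]
      ring
    · rw [Dco, if_neg (by omega), if_neg (by omega), if_neg (by omega),
        Gamma_mul_Dbar hν (j := 2 * m + 1) (i := i) (by omega) (by omega) (fun _ => hlt)]
      ring
  · rw [e, Gamma_mul_Dbar hν (j := j) (i := i) (by omega) (by omega) (fun h' => absurd h' h)]
    ring

lemma dbarco_rec (hν : ν ∈ Set.Ioo (0:ℝ) 1) {j k : ℕ} (hj : 3 ≤ j) (hk : 1 ≤ k) (hkj : k < j) :
    dbarco ν j k = theta ν * dbarco ν j (k + 1) + dco ν j k := by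
  rcases eq_or_lt_of_le hj with rfl | hj4
  · obtain rfl | rfl : k = 1 ∨ k = 2 := by omega
    · simp [dbarco]
    · simp [dbarco]; ring
  · have hj3 : ¬ j = 3 := by omega
    obtain rfl | hk2 : k = j - 1 ∨ k + 1 ≤ j - 1 := by omega
    · have h1 := wA_zero_mul_dco hν hj (show 0 + 1 < j by omega)
      have hA : 0 < wA ν 0 := by
        rw [wA_zero hν]; exact mul_pos (by linarith [hν.1]) (Real.rpow_pos_of_pos two_pos _)
      have h2 : dco ν j (j - 1) = 2 * theta ν := by
        have h3 := theta_mul_wA_zero hν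
        rw [incrWeight_zero ν hj, incrWeight, if_neg (by omega), if_neg (by omega),
          if_neg (by omega)] at h1
        simp only [zero_add, Nat.cast_one, sub_self, wC_zero hν] at h1
        refine mul_left_cancel₀ hA.ne' ?_
        rw [h1]
        nlinarith [wA_zero hν]
      rw [h2, dbarco, if_neg (by omega), if_neg hj3, Finset.Icc_eq_empty (by omega),
        Finset.sum_empty, show j - 1 + 1 = j by omega, show j - (j - 1) = 1 by omega, dbarco,
        if_pos rfl]
      ring
    · rw [dbarco, if_neg (by omega), if_neg hj3, dbarco, if_neg (by omega), if_neg hj3,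
        ← Finset.add_sum_Ioc_eq_sum_Icc (by omega : k ≤ j - 2), show j - k = j - (k + 1) + 1 by omega,
        pow_succ, mul_add, Finset.mul_sum, Nat.sub_self, pow_zero, mul_one]
      have : ∑ x ∈ Finset.Ioc k (j - 2), dco ν j x * theta ν ^ (x - k)
          = ∑ x ∈ Finset.Icc (k + 1) (j - 2), theta ν * (dco ν j x * theta ν ^ (x - (k + 1))) := by
        refine Finset.sum_congr (by ext x; simp) (fun x hx => ?_)
        rw [Finset.mem_Icc] at hx
        rw [show x - k = x - (k + 1) + 1 by omega, pow_succ]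
        ring
      rw [this]
      ring

lemma wA_zero_mul_dbarco (hν : ν ∈ Set.Ioo (0:ℝ) 1) {j : ℕ} (hj : 3 ≤ j) :
    ∀ i, i + 1 < j →
      -(wA ν 0 * dbarco ν j (j - (i + 1))) = thetaSum ν j (i + 1) - thetaSum ν j i
  | 0, h => by
    have h1 := wA_zero_mul_dco hν hj h
    have h2 : dbarco ν j j = -1 := by rw [dbarco, if_pos rfl]
    rw [dbarco_rec hν hj (by omega) (by omega), show j - (0 + 1) + 1 = j by omega, h2, mul_add, h1,
      incrWeight_zero ν hj]
    simp only [thetaSum]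
    ring
  | i + 1, h => by
    have h1 := wA_zero_mul_dco hν hj h
    have ih := wA_zero_mul_dbarco hν hj i (by omega)
    rw [dbarco_rec hν hj (by omega) (by omega),
      show j - (i + 1 + 1) + 1 = j - (i + 1) by omega, mul_add, h1]
    have e1 : thetaSum ν j (i + 1 + 1)
      = theta ν * thetaSum ν j (i + 1) + incrWeight ν j (i + 1 + 1) := rfl
    have e2 : thetaSum ν j (i + 1)
      = theta ν * thetaSum ν j i + incrWeight ν j (i + 1) := rfl
    rw [e1]
    linear_combination theta ν * ih + e2

lemma Bbar_eq (hν : ν ∈ Set.Ioo (0:ℝ) 1) (Δx : ℝ) {j : ℕ} (hj : 3 ≤ j) :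
    ∀ i, i < j → Bbar ν Δx j i = Δx ^ (-ν) / Real.Gamma (3 - ν) * thetaSum ν j i
  | 0, _ => by
    have hΓ := (Gamma_three_sub_pos hν).ne'
    rw [Bbar, thetaSum, ← Gamma_mul_alpha0 hν]
    field_simp
  | i + 1, h => by
    have hΓ := (Gamma_three_sub_pos hν).ne'
    have h1 := wA_zero_mul_dbarco hν hj i h
    rw [Bbar, Bbar_eq hν Δx hj i (by omega), eq_add_of_sub_eq h1.symm, ← Gamma_mul_alpha0 hν]
    field_simp
    ring

end Coefficients

section Kernel

variable {ν Δx : ℝ}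

lemma Bbar_pos (hν : ν ∈ Set.Ioo (0:ℝ) 1) (hΔx : 0 < Δx) {j i : ℕ} (hj : 3 ≤ j) (hi : i < j) :
    0 < Bbar ν Δx j i := by
  rw [Bbar_eq hν Δx hj i hi]
  exact mul_pos (div_pos (rpow_pos_of_pos hΔx _) (Gamma_three_sub_pos hν)) (thetaSum_pos hν hj i)

lemma Bbar_succ_le (hν : ν ∈ Set.Ioo (0:ℝ) 1) (hΔx : 0 < Δx) {j i : ℕ} (hj : 3 ≤ j)
    (hi : i + 1 < j) : Bbar ν Δx j (i + 1) ≤ Bbar ν Δx j i := by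
  rw [Bbar_eq hν Δx hj _ hi, Bbar_eq hν Δx hj i (by omega)]
  exact mul_le_mul_of_nonneg_left (thetaSum_succ_le hν hj i hi)
    (div_pos (rpow_pos_of_pos hΔx _) (Gamma_three_sub_pos hν)).le

lemma Bbar_le_Bbar (hν : ν ∈ Set.Ioo (0:ℝ) 1) (hΔx : 0 < Δx) {j i i' : ℕ} (hj : 3 ≤ j)
    (h : i ≤ i') (hi : i' < j) : Bbar ν Δx j i' ≤ Bbar ν Δx j i := by
  induction i', h using Nat.le_induction with
  | base => exact le_rfl
  | succ k hk ih => exact (Bbar_succ_le hν hΔx hj hi).trans (ih (by omega))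

lemma Pker_succ (ν Δx : ℝ) {n j : ℕ} (h : j + 3 < n) :
    Pker ν Δx n (j + 1) = (1 / Bbar ν Δx (n - (j + 1)) 0) *
      ∑ k ∈ Finset.range (j + 1),
        (Bbar ν Δx (n - k) (j - k) - Bbar ν Δx (n - k) (j + 1 - k)) * Pker ν Δx n k := by
  rw [Pker, if_neg (by omega), Finset.sum_attach (Finset.range (j + 1)) (fun k =>
    (Bbar ν Δx (n - k) (j - k) - Bbar ν Δx (n - k) (j + 1 - k)) * Pker ν Δx n k)]

lemma Pker_nonneg (hν : ν ∈ Set.Ioo (0:ℝ) 1) (hΔx : 0 < Δx) {n : ℕ} (hn : 3 ≤ n) (j : ℕ) :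
    0 ≤ Pker ν Δx n j := by
  induction j using Nat.strong_induction_on with
  | _ j ih =>
    rcases j with _ | j
    · rw [Pker]
      exact (one_div_pos.2 (Bbar_pos hν hΔx hn (by omega))).le
    · by_cases h : j + 3 < n
      · rw [Pker_succ ν Δx h]
        refine mul_nonneg (one_div_pos.2 (Bbar_pos hν hΔx (by omega) (by omega))).le
          (Finset.sum_nonneg fun k hk => ?_)
        have hk' := Finset.mem_range.1 hk
        refine mul_nonneg (sub_nonneg.2 ?_) (ih k hk')
        exact Bbar_le_Bbar hν hΔx (by omega) (by omega) (by omega)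
      · rw [Pker, if_pos (by omega)]

lemma sum_Pker_mul_Bbar (hν : ν ∈ Set.Ioo (0:ℝ) 1) (hΔx : 0 < Δx) {n : ℕ} (i : ℕ)
    (hi : i + 3 ≤ n) :
    ∑ k ∈ Finset.range (i + 1), Pker ν Δx n k * Bbar ν Δx (n - k) (i - k) = 1 := by
  induction i with
  | zero =>
    have := (Bbar_pos hν hΔx (j := n) (i := 0) (by omega) (by omega)).ne'
    simp [Pker, this]
  | succ i ih =>
    have h0 := (Bbar_pos hν hΔx (j := n - (i + 1)) (i := 0) (by omega) (by omega)).ne'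
    rw [Finset.sum_range_succ, Pker_succ ν Δx (by omega), Nat.sub_self, mul_right_comm,
      one_div_mul_cancel h0, one_mul, ← Finset.sum_add_distrib, ← ih (by omega)]
    exact Finset.sum_congr rfl fun k _ => by ring

lemma sum_Icc_Pker_mul_Bbar (hν : ν ∈ Set.Ioo (0:ℝ) 1) (hΔx : 0 < Δx) {n L : ℕ} (hL : 3 ≤ L)
    (hn : L ≤ n) : ∑ j ∈ Finset.Icc L n, Pker ν Δx n (n - j) * Bbar ν Δx j (j - L) = 1 := by
  rw [← sum_Pker_mul_Bbar hν hΔx (n - L) (by omega : n - L + 3 ≤ n)]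
  refine Finset.sum_bij' (fun j _ => n - j) (fun k _ => n - k) ?_ ?_ ?_ ?_ ?_
  · intro j hj; simp only [Finset.mem_Icc] at hj; simp only [Finset.mem_range]; omega
  · intro j hj; simp only [Finset.mem_range] at hj; simp only [Finset.mem_Icc]; omega
  · intro j hj; simp only [Finset.mem_Icc] at hj; omega
  · intro j hj; simp only [Finset.mem_range] at hj; omega
  · intro j hj
    simp only [Finset.mem_Icc] at hj
    rw [show n - (n - j) = j by omega, show n - L - (n - j) = j - L by omega]

lemma sum_Icc_Pker_mul_Bbar_le (hν : ν ∈ Set.Ioo (0:ℝ) 1) (hΔx : 0 < Δx) {n l : ℕ} (hn : 3 ≤ n)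
    (hl : 1 ≤ l) (hln : l ≤ n) :
    ∑ j ∈ Finset.Icc (max 3 l) (n - 1), Pker ν Δx n (n - j) * Bbar ν Δx j (j - l) ≤ 1 := by
  rw [← sum_Icc_Pker_mul_Bbar hν hΔx (le_max_left 3 l) (by omega : max 3 l ≤ n)]
  calc _ ≤ ∑ j ∈ Finset.Icc (max 3 l) (n - 1),
        Pker ν Δx n (n - j) * Bbar ν Δx j (j - max 3 l) := by
        refine Finset.sum_le_sum fun j hj => mul_le_mul_of_nonneg_left ?_ (Pker_nonneg hν hΔx hn _)
        rw [Finset.mem_Icc] at hj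
        exact Bbar_le_Bbar hν hΔx (by omega) (by omega) (by omega)
    _ ≤ _ := by
        refine Finset.sum_le_sum_of_subset_of_nonneg
          (Finset.Icc_subset_Icc_right (by omega)) fun j hj _ => ?_
        rw [Finset.mem_Icc] at hj
        exact mul_nonneg (Pker_nonneg hν hΔx hn _) (Bbar_pos hν hΔx (by omega) (by omega)).le

lemma sum_Pker_mul_le (hν : ν ∈ Set.Ioo (0:ℝ) 1) (hΔx : 0 < Δx) {n : ℕ} (hn : 3 ≤ n)
    {u c : ℕ → ℝ} (hc : ∀ l, 0 ≤ c l)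
    (hu : ∀ j, 3 ≤ j → u j ≤ ∑ l ∈ Finset.Icc 1 j, c l * Bbar ν Δx j (j - l)) :
    ∑ j ∈ Finset.Icc 3 (n - 1), Pker ν Δx n (n - j) * u j ≤ ∑ l ∈ Finset.Icc 1 (n - 1), c l := by
  calc _ ≤ ∑ j ∈ Finset.Icc 3 (n - 1), ∑ l ∈ Finset.Icc 1 j,
        c l * (Pker ν Δx n (n - j) * Bbar ν Δx j (j - l)) := by
        refine Finset.sum_le_sum fun j hj => ?_
        refine (mul_le_mul_of_nonneg_left (hu j (Finset.mem_Icc.1 hj).1)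
          (Pker_nonneg hν hΔx hn _)).trans_eq ?_
        rw [Finset.mul_sum]
        exact Finset.sum_congr rfl fun l _ => by ring
    _ = ∑ l ∈ Finset.Icc 1 (n - 1), ∑ j ∈ Finset.Icc (max 3 l) (n - 1),
        c l * (Pker ν Δx n (n - j) * Bbar ν Δx j (j - l)) := by
        refine Finset.sum_comm' fun j l => ?_
        simp only [Finset.mem_Icc]
        omega
    _ ≤ _ := by
        refine Finset.sum_le_sum fun l hl => ?_
        rw [Finset.mem_Icc] at hl
        rw [← Finset.mul_sum]
        exact mul_le_of_le_one_right (hc l)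
          (sum_Icc_Pker_mul_Bbar_le hν hΔx hn hl.1 (by omega))

end Kernel

section FractionalIntegral

open intervalIntegral

variable {ν β : ℝ}

lemma integral_rpow_mul_sub_rpow (hν : ν ∈ Set.Ioo (0:ℝ) 1) (hβ : 0 < β) {x : ℝ} (hx : 0 < x) :
    ∫ s in (0:ℝ)..x, s ^ (β - 1) * (x - s) ^ (-ν)
      = x ^ (β - ν) * (Real.Gamma β * Real.Gamma (1 - ν) / Real.Gamma (β + 1 - ν)) := by
  have h1ν : 0 < 1 - ν := by linarith [hν.2]
  have h := Complex.betaIntegral_scaled (β : ℂ) ((1 - ν : ℝ) : ℂ) hx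
  rw [Complex.betaIntegral_eq_Gamma_mul_div _ _ (by simpa) (by simpa using hν.2),
    ← Complex.ofReal_add, Complex.Gamma_ofReal, Complex.Gamma_ofReal, Complex.Gamma_ofReal] at h
  rw [← Complex.ofReal_inj, ← integral_ofReal, show β + 1 - ν = β + (1 - ν) by ring]
  convert h using 1
  · refine integral_congr fun s hs => ?_
    rw [Set.uIcc_of_le hx.le] at hs
    have h1 : ((1 - ν : ℝ) : ℂ) - 1 = ((-ν : ℝ) : ℂ) := by push_cast; ring
    simp only [Complex.ofReal_mul]
    rw [Complex.ofReal_cpow hs.1, Complex.ofReal_cpow (sub_nonneg.2 hs.2), h1]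
    push_cast
    rfl
  · rw [Complex.ofReal_mul, Complex.ofReal_cpow hx.le]
    push_cast
    congr 2
    ring

lemma intervalIntegrable_rpow_mul_sub_rpow (hν : ν ∈ Set.Ioo (0:ℝ) 1) (hβ : 0 < β) {x : ℝ}
    (hx : 0 < x) :
    IntervalIntegrable (fun s : ℝ => s ^ (β - 1) * (x - s) ^ (-ν)) MeasureTheory.volume 0 x := by
  by_contra h
  have h0 := integral_rpow_mul_sub_rpow hν hβ hx
  rw [integral_undef h] at h0
  have h1 := Real.Gamma_pos_of_pos hβ
  have h2 := Real.Gamma_pos_of_pos (by linarith [hν.2] : 0 < 1 - ν)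
  have h3 := Real.Gamma_pos_of_pos (by linarith [hν.2] : 0 < β + 1 - ν)
  have := Real.rpow_pos_of_pos hx (β - ν)
  exact absurd h0 (by positivity)

lemma rpow_sub_one_le_three_mul (hβ : 0 < β) {s t : ℝ} (hs : 0 < s) (hst : s ≤ t)
    (hts : t ≤ 3 * s) : s ^ (β - 1) ≤ 3 * t ^ (β - 1) := by
  have hs' := Real.rpow_pos_of_pos hs (β - 1)
  rcases le_total 1 β with h | h
  · have := Real.rpow_le_rpow hs.le hst (sub_nonneg.2 h)
    linarith
  · have h1 : (3 * s) ^ (β - 1) ≤ t ^ (β - 1) :=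
      Real.rpow_le_rpow_of_nonpos (hs.trans_le hst) hts (by linarith)
    have h2 : (3:ℝ) ^ (-1 : ℝ) ≤ 3 ^ (β - 1) :=
      Real.rpow_le_rpow_of_exponent_le (by norm_num) (by linarith)
    rw [Real.rpow_neg_one] at h2
    rw [Real.mul_rpow (by norm_num) hs.le] at h1
    nlinarith

lemma mul_rpow_sub_one_le (hβ : 0 < β) {l s : ℝ} (hl : 2 ≤ l) (hs : s ∈ Set.Icc (l - 1) l) :
    β * s ^ (β - 1) ≤ 3 * ((l + 1) ^ β - l ^ β) := by
  have hs0 : 0 < s := by linarith [hs.1]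
  have h := le_of_hasDerivAt_nonneg (F := fun t => 3 * t ^ β - β * s ^ (β - 1) * t)
    (F' := fun t => 3 * (β * t ^ (β - 1)) - β * s ^ (β - 1)) (by linarith : l ≤ l + 1)
    (fun t ht => by
      have ht0 : t ≠ 0 := by linarith [ht.1]
      have := ((Real.hasDerivAt_rpow_const (p := β) (Or.inl ht0)).const_mul 3).sub
        ((hasDerivAt_id t).const_mul (β * s ^ (β - 1)))
      exact this.congr_deriv (by ring))
    (fun t ht => by
      have := rpow_sub_one_le_three_mul hβ hs0 (hs.2.trans ht.1) (by linarith [hs.1, ht.2])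
      nlinarith)
  linarith

lemma integral_sub_rpow_le_kernelBound (hν : ν ∈ Set.Ioo (0:ℝ) 1) {j l : ℕ} (hlj : l ≤ j) :
    ∫ s in ((l : ℝ) - 1)..l, ((j : ℝ) - s) ^ (-ν) ≤ kernelBound ν (j - l) := by
  rw [integral_comp_sub_left (fun t : ℝ => t ^ (-ν))]
  have hc : (j : ℝ) - l = ((j - l : ℕ) : ℝ) := by rw [Nat.cast_sub hlj]
  rw [show (j : ℝ) - (l - 1) = ((j - l : ℕ) : ℝ) + 1 by rw [← hc]; ring, hc]
  generalize j - l = i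
  rw [kernelBound]
  split_ifs with hi
  · subst hi
    rw [integral_rpow (Or.inl (by linarith [hν.2]))]
    have h1 : 1 - ν ≠ 0 := by linarith [hν.2]
    simp [neg_add_eq_sub, Real.zero_rpow h1]
  · have hi' : (0:ℝ) < i := Nat.cast_pos.2 (Nat.pos_of_ne_zero hi)
    have := integral_mono_on (μ := MeasureTheory.volume) (f := fun t : ℝ => t ^ (-ν))
      (g := fun _ => (i : ℝ) ^ (-ν))
      (by linarith : (i : ℝ) ≤ i + 1) (intervalIntegrable_rpow' (by linarith [hν.2]))
      intervalIntegrable_const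
      (fun t ht => Real.rpow_le_rpow_of_nonpos hi' ht.1 (by linarith [hν.1]))
    simpa using this

/-- Weights dominating `β ∫_{l-1}^l s^(β-1) ds`. -/
noncomputable def stepWeight (β : ℝ) (l : ℕ) : ℝ :=
  if l = 1 then 1 else 3 * (((l : ℝ) + 1) ^ β - (l : ℝ) ^ β)

lemma stepWeight_nonneg (hβ : 0 < β) (l : ℕ) : 0 ≤ stepWeight β l := by
  rw [stepWeight]
  split_ifs
  · exact zero_le_one
  · have := Real.rpow_le_rpow (Nat.cast_nonneg l) (by linarith : (l : ℝ) ≤ l + 1) hβ.le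
    linarith

lemma sum_stepWeight_le (hβ : 0 < β) {n : ℕ} (hn : 1 ≤ n) :
    ∑ l ∈ Finset.Icc 1 n, stepWeight β l ≤ 3 * ((n : ℝ) + 1) ^ β := by
  induction n, hn using Nat.le_induction with
  | base =>
    have : (1:ℝ) ≤ (1 + 1) ^ β := Real.one_le_rpow (by norm_num) hβ.le
    simp [stepWeight]
    linarith
  | succ n hn ih =>
    rw [Finset.sum_Icc_succ_top (by omega), stepWeight, if_neg (by omega)]
    push_cast
    linarith

lemma mul_integral_step_le (hν : ν ∈ Set.Ioo (0:ℝ) 1) (hβ : 0 < β) {j l : ℕ} (hj : 2 ≤ j)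
    (hl : 1 ≤ l) (hlj : l ≤ j)
    (hint : IntervalIntegrable (fun s : ℝ => s ^ (β - 1) * ((j : ℝ) - s) ^ (-ν))
      MeasureTheory.volume ((l : ℝ) - 1) l) :
    β * ∫ s in ((l : ℝ) - 1)..l, s ^ (β - 1) * ((j : ℝ) - s) ^ (-ν)
      ≤ stepWeight β l * kernelBound ν (j - l) := by
  rw [← integral_const_mul]
  rw [stepWeight]
  split_ifs with h1
  · subst h1
    have hj' : (2:ℝ) ≤ j := by exact_mod_cast hj
    have hc : ((j - 1 : ℕ) : ℝ) = (j : ℝ) - 1 := by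
      rw [Nat.cast_sub hlj, Nat.cast_one]
    have hβ1 : (β - 1 + 1 : ℝ) = β := by ring
    rw [kernelBound, if_neg (by omega), hc]
    have h0 : IntervalIntegrable (fun s : ℝ => s ^ (β - 1)) MeasureTheory.volume
        (((1 : ℕ) : ℝ) - 1) (1 : ℕ) := intervalIntegrable_rpow' (by linarith)
    refine (integral_mono_on (by simp) (hint.const_mul β)
      (h0.mul_const (β * ((j : ℝ) - 1) ^ (-ν))) fun s hs => ?_).trans_eq ?_
    · simp only [Nat.cast_one, sub_self] at hs
      have h2 : ((j : ℝ) - s) ^ (-ν) ≤ ((j : ℝ) - 1) ^ (-ν) :=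
        Real.rpow_le_rpow_of_nonpos (by linarith) (by linarith [hs.2]) (by linarith [hν.1])
      have h3 := mul_le_mul_of_nonneg_left h2 (mul_nonneg hβ.le (Real.rpow_nonneg hs.1 (β - 1)))
      linarith
    · rw [integral_mul_const, integral_rpow (Or.inl (by linarith)), hβ1]
      simp [Real.zero_rpow hβ.ne']
      field_simp
  · have hl' : (2:ℝ) ≤ l := by exact_mod_cast (by omega : 2 ≤ l)
    have hlj' : (l : ℝ) ≤ j := by exact_mod_cast hlj
    have hk : IntervalIntegrable (fun s : ℝ => ((j : ℝ) - s) ^ (-ν)) MeasureTheory.volume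
        ((l : ℝ) - 1) l := by
      have h4 : IntervalIntegrable (fun t : ℝ => t ^ (-ν)) MeasureTheory.volume
        ((j : ℝ) - (l - 1)) (j - l) := intervalIntegrable_rpow' (by linarith [hν.2])
      simpa using h4.comp_sub_left (j : ℝ)
    refine (integral_mono_on (by linarith) (hint.const_mul β)
      (hk.const_mul (3 * (((l : ℝ) + 1) ^ β - (l : ℝ) ^ β))) fun s hs => ?_).trans ?_
    · have h3 := mul_le_mul_of_nonneg_right (mul_rpow_sub_one_le hβ hl' hs)
        (Real.rpow_nonneg (by linarith [hs.2] : 0 ≤ (j : ℝ) - s) (-ν))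
      linarith
    · rw [integral_const_mul]
      refine mul_le_mul_of_nonneg_left (integral_sub_rpow_le_kernelBound hν hlj) ?_
      have h5 := Real.rpow_le_rpow (Nat.cast_nonneg l) (by linarith : (l : ℝ) ≤ l + 1) hβ.le
      linarith

lemma rpow_le_sum_stepWeight_mul (hν : ν ∈ Set.Ioo (0:ℝ) 1) (hβ : 0 < β) {j : ℕ} (hj : 2 ≤ j) :
    (j : ℝ) ^ (β - ν) * (Real.Gamma (β + 1) * Real.Gamma (1 - ν) / Real.Gamma (β + 1 - ν))
      ≤ ∑ l ∈ Finset.Icc 1 j, stepWeight β l * kernelBound ν (j - l) := by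
  have hj0 : (0:ℝ) < j := by exact_mod_cast (by omega : 0 < j)
  have hI := intervalIntegrable_rpow_mul_sub_rpow hν hβ hj0
  have hint : ∀ k < j, IntervalIntegrable (fun s : ℝ => s ^ (β - 1) * ((j : ℝ) - s) ^ (-ν))
      MeasureTheory.volume (k : ℝ) ((k + 1 : ℕ) : ℝ) := fun k hk => by
    refine hI.mono_set ?_
    have h1 : ((k + 1 : ℕ) : ℝ) ≤ j := by exact_mod_cast hk
    rw [Set.uIcc_of_le hj0.le, Set.uIcc_of_le (by push_cast; linarith)]
    exact Set.Icc_subset_Icc (Nat.cast_nonneg k) h1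
  calc _ = β * ∫ s in (0:ℝ)..j, s ^ (β - 1) * ((j : ℝ) - s) ^ (-ν) := by
        rw [integral_rpow_mul_sub_rpow hν hβ hj0, Real.Gamma_add_one hβ.ne']
        ring
    _ = ∑ k ∈ Finset.range j,
        β * ∫ s in (k : ℝ)..((k + 1 : ℕ) : ℝ), s ^ (β - 1) * ((j : ℝ) - s) ^ (-ν) := by
        rw [← Finset.mul_sum, sum_integral_adjacent_intervals hint, Nat.cast_zero]
    _ ≤ ∑ k ∈ Finset.range j, stepWeight β (1 + k) * kernelBound ν (j - (1 + k)) := by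
        refine Finset.sum_le_sum fun k hk => ?_
        rw [Finset.mem_range] at hk
        have hk1 : (k : ℝ) = ((1 + k : ℕ) : ℝ) - 1 := by push_cast; ring
        have h := hint k hk
        rw [add_comm k 1] at h ⊢
        rw [hk1] at h ⊢
        exact mul_integral_step_le hν hβ hj (by omega) (by omega) h
    _ = _ := by
        rw [← Finset.Ico_add_one_right_eq_Icc, Finset.sum_Ico_eq_sum_range, Nat.add_sub_cancel]

end FractionalIntegral

section MittagLeffler

variable {ν Δx β : ℝ}

lemma kernelBound_le_Bbar (hν : ν ∈ Set.Ioo (0:ℝ) 1) (hΔx : 0 < Δx) {j i : ℕ} (hj : 3 ≤ j)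
    (hi : i < j) :
    kernelBound ν i ≤ 3 * Real.Gamma (1 - ν) * Δx ^ ν * Bbar ν Δx j i := by
  have h := kernelBound_le_thetaSum hν hj i
  have h1 : 1 - ν ≠ 0 := by linarith [hν.2]
  have h2 : 2 - ν ≠ 0 := by linarith [hν.2]
  have hΓ : Real.Gamma (3 - ν) = (2 - ν) * (1 - ν) * Real.Gamma (1 - ν) := by
    rw [show 3 - ν = (2 - ν) + 1 by ring, Real.Gamma_add_one h2,
      show 2 - ν = (1 - ν) + 1 by ring, Real.Gamma_add_one h1]
    ring
  have hΓ1 := Real.Gamma_pos_of_pos (by linarith [hν.2] : 0 < 1 - ν)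
  have hx := Real.rpow_pos_of_pos hΔx ν
  have hc := const_pos hν
  rw [Bbar_eq hν Δx hj i hi, hΓ, Real.rpow_neg hΔx.le]
  have e : 3 * Real.Gamma (1 - ν) * Δx ^ ν *
      ((Δx ^ ν)⁻¹ / ((2 - ν) * (1 - ν) * Real.Gamma (1 - ν)) * thetaSum ν j i)
      = 3 * thetaSum ν j i / ((2 - ν) * (1 - ν)) := by
    field_simp
  rw [e, le_div_iff₀ hc]
  linarith

lemma sum_Pker_mul_rpow_le (hν : ν ∈ Set.Ioo (0:ℝ) 1) (hΔx : 0 < Δx) (hβ : 0 < β) {n : ℕ}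
    (hn : 3 ≤ n) :
    ∑ j ∈ Finset.Icc 3 (n - 1), Pker ν Δx n (n - j) *
        (((j : ℝ) * Δx) ^ (β - ν) / Real.Gamma (β + 1 - ν))
      ≤ 9 * (((n : ℝ) * Δx) ^ β / Real.Gamma (β + 1)) := by
  have hΓ1 := Real.Gamma_pos_of_pos (by linarith [hν.2] : 0 < 1 - ν)
  have hΓβ := Real.Gamma_pos_of_pos (by linarith : 0 < β + 1)
  have hΓν := Real.Gamma_pos_of_pos (by linarith [hν.2] : 0 < β + 1 - ν)
  have hx := Real.rpow_pos_of_pos hΔx ν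
  have hxβ := Real.rpow_pos_of_pos hΔx β
  have hcoef : 0 ≤ 3 * Δx ^ β / Real.Gamma (β + 1) := by positivity
  refine (sum_Pker_mul_le hν hΔx hn
    (c := fun l => 3 * Δx ^ β / Real.Gamma (β + 1) * stepWeight β l)
    (fun l => mul_nonneg hcoef (stepWeight_nonneg hβ l)) fun j hj => ?_).trans ?_
  · have h := rpow_le_sum_stepWeight_mul hν hβ (j := j) (by omega)
    have h2 : ∑ l ∈ Finset.Icc 1 j, stepWeight β l * kernelBound ν (j - l)
        ≤ ∑ l ∈ Finset.Icc 1 j, stepWeight β l *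
          (3 * Real.Gamma (1 - ν) * Δx ^ ν * Bbar ν Δx j (j - l)) :=
      Finset.sum_le_sum fun l hl => by
        rw [Finset.mem_Icc] at hl
        exact mul_le_mul_of_nonneg_left (kernelBound_le_Bbar hν hΔx hj (by omega))
          (stepWeight_nonneg hβ l)
    have h3 := mul_le_mul_of_nonneg_left (h.trans h2)
      (by positivity : 0 ≤ Δx ^ (β - ν) / (Real.Gamma (β + 1) * Real.Gamma (1 - ν)))
    refine (le_of_eq ?_).trans (h3.trans_eq ?_)
    · rw [Real.mul_rpow (Nat.cast_nonneg j) hΔx.le]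
      field_simp
    · rw [Finset.mul_sum]
      refine Finset.sum_congr rfl fun l _ => ?_
      rw [Real.rpow_sub hΔx]
      field_simp
  · rw [← Finset.mul_sum]
    refine (mul_le_mul_of_nonneg_left (sum_stepWeight_le hβ (by omega)) hcoef).trans_eq ?_
    rw [Nat.cast_sub (by omega), Nat.cast_one, sub_add_cancel,
      Real.mul_rpow (Nat.cast_nonneg n) hΔx.le]
    ring

lemma rpow_mul_Gamma_le (hν : ν ∈ Set.Ioo (0:ℝ) 1) {x : ℝ} (hx : 0 < x) :
    x ^ ν * Real.Gamma (x + 1) ≤ Real.Gamma (x + 1 + ν) := by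
  have hν0 := hν.1
  have hΓ := Real.Gamma_pos_of_pos hx
  have hΓ2 := Real.Gamma_pos_of_pos (by linarith : 0 < x + 1 + ν)
  have h := Real.Gamma_mul_add_mul_le_rpow_Gamma_mul_rpow_Gamma hx
    (by linarith : 0 < x + 1 + ν) (by positivity : 0 < ν / (1 + ν))
    (by positivity : 0 < 1 / (1 + ν)) (by field_simp; ring)
  rw [show ν / (1 + ν) * x + 1 / (1 + ν) * (x + 1 + ν) = x + 1 by field_simp; ring] at h
  have hΓ1 := Real.Gamma_pos_of_pos (by linarith : 0 < x + 1)
  have h2 := Real.rpow_le_rpow hΓ1.le h (by linarith : 0 ≤ 1 + ν)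
  rw [Real.mul_rpow (by positivity) (by positivity), ← Real.rpow_mul hΓ.le,
    ← Real.rpow_mul hΓ2.le, div_mul_cancel₀ _ (by linarith), div_mul_cancel₀ _ (by linarith),
    Real.rpow_one, Real.rpow_add hΓ1, Real.rpow_one, Real.Gamma_add_one hx.ne',
    Real.mul_rpow hx.le hΓ.le] at h2
  have hpos := Real.rpow_pos_of_pos hΓ ν
  rw [Real.Gamma_add_one hx.ne']
  refine le_of_mul_le_mul_left ?_ hpos
  linarith

lemma summable_mlE (hν : ν ∈ Set.Ioo (0:ℝ) 1) (z : ℝ) :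
    Summable fun k : ℕ => z ^ k / Real.Gamma (1 + (k : ℝ) * ν) := by
  have hν0 := hν.1
  have ht : Filter.Tendsto (fun k : ℕ => ((k : ℝ) * ν) ^ ν) Filter.atTop Filter.atTop :=
    (tendsto_rpow_atTop hν0).comp
      (tendsto_natCast_atTop_atTop.atTop_mul_const hν0)
  refine summable_of_ratio_norm_eventually_le (r := 1 / 2) (by norm_num) ?_
  filter_upwards [ht.eventually_ge_atTop (2 * |z|), Filter.eventually_gt_atTop 0] with k hk hk0
  have hk0' : (0:ℝ) < k := Nat.cast_pos.2 hk0
  have h := rpow_mul_Gamma_le hν (mul_pos hk0' hν0)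
  have hΓ := Real.Gamma_pos_of_pos (by positivity : 0 < 1 + (k : ℝ) * ν)
  have hΓ' := Real.Gamma_pos_of_pos (by positivity : 0 < 1 + ((k + 1 : ℕ) : ℝ) * ν)
  rw [show (k : ℝ) * ν + 1 + ν = 1 + ((k + 1 : ℕ) : ℝ) * ν by push_cast; ring,
    add_comm ((k : ℝ) * ν) 1] at h
  rw [norm_div, norm_div, norm_pow, norm_pow, Real.norm_of_nonneg hΓ.le,
    Real.norm_of_nonneg hΓ'.le, Real.norm_eq_abs, pow_succ, ← mul_div_assoc,
    div_le_div_iff₀ hΓ' hΓ]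
  have h1 := (mul_le_mul_of_nonneg_right hk hΓ.le).trans h
  have h2 := mul_le_mul_of_nonneg_left h1 (pow_nonneg (abs_nonneg z) k)
  linarith

lemma mlE_sub_one (hν : ν ∈ Set.Ioo (0:ℝ) 1) (z : ℝ) :
    mlE ν z - 1 = ∑' k : ℕ, z ^ (k + 1) / Real.Gamma (1 + ((k + 1 : ℕ) : ℝ) * ν) := by
  rw [mlE, (summable_mlE hν z).tsum_eq_zero_add]
  simp

end MittagLeffler

theorem stmt12 (ν Δx μ : ℝ) (hν : ν ∈ Set.Ioo (0:ℝ) 1) (hΔx : 0 < Δx) (N : ℕ) (hN : 2 ≤ N)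
    (hμ : 0 < μ) :
    ∀ n : ℕ, 3 ≤ n → n ≤ 2 * N →
      ∑ j ∈ Finset.Icc 3 (n - 1), Pker ν Δx n (n - j) * mlE ν (μ * ((j : ℝ) * Δx) ^ ν)
        ≤ (9 / μ) * (mlE ν (μ * ((n : ℝ) * Δx) ^ ν) - 1) := by
  intro n hn _
  have hpow : ∀ (m k : ℕ), (μ * ((m : ℝ) * Δx) ^ ν) ^ k = μ ^ k * ((m : ℝ) * Δx) ^ ((k : ℝ) * ν) :=
    fun m k => by
      rw [mul_pow, mul_comm (k : ℝ) ν, Real.rpow_mul_natCast (by positivity)]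
  have hs : ∀ j : ℕ, Summable fun k : ℕ => Pker ν Δx n (n - j) *
      ((μ * ((j : ℝ) * Δx) ^ ν) ^ k / Real.Gamma (1 + (k : ℝ) * ν)) :=
    fun j => (summable_mlE hν _).mul_left _
  simp_rw [mlE_sub_one hν, mlE, ← tsum_mul_left]
  rw [← Summable.tsum_finsetSum fun j _ => hs j]
  refine Summable.tsum_le_tsum (fun k => ?_) (summable_sum fun j _ => hs j)
    (((summable_nat_add_iff 1).2 (summable_mlE hν _)).mul_left _)
  have hk : (0:ℝ) < ((k + 1 : ℕ) : ℝ) * ν := mul_pos (by positivity) hν.1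
  have h := mul_le_mul_of_nonneg_left (sum_Pker_mul_rpow_le hν hΔx hk hn) (pow_nonneg hμ.le k)
  rw [show ((k + 1 : ℕ) : ℝ) * ν - ν = k * ν by push_cast; ring,
    show ((k + 1 : ℕ) : ℝ) * ν + 1 - ν = 1 + k * ν by push_cast; ring, Finset.mul_sum] at h
  refine (Finset.sum_congr rfl fun j _ => ?_).trans_le (h.trans_eq ?_)
  · rw [hpow]
    ring
  · rw [hpow, pow_succ, add_comm 1 (((k + 1 : ℕ) : ℝ) * ν)]
    field_simp
end

section
/- Fix ν ∈ (0,1) and T > 0, and let y : [0,T] → ℝ be three times continuously differentiable. Then there exists a constant C₁ > 0, depending only on y and T, such that for every positive integer N, setting Δx = T/(2N), the truncation errors satisfy |r_j(Δx)| ≤ C₁·Δx^{3−ν} for all j = 1, 2, …, 2N. -/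
open Real Finset

noncomputable section

/-- The quadratic polynomial taking the values `Y₀`, `Y₁`, `Y₂` at `a`, `a + h`, `a + 2h`. -/
def quadInterp (h a Y₀ Y₁ Y₂ s : ℝ) : ℝ :=
  Y₁ + (s - (a + h)) * ((Y₂ - Y₀) / (2 * h))
    + (s - (a + h)) ^ 2 * ((Y₂ - 2 * Y₁ + Y₀) / (2 * h ^ 2))

/-- The derivative of `quadInterp h a Y₀ Y₁ Y₂`. -/
def quadInterpDeriv (h a Y₀ Y₁ Y₂ s : ℝ) : ℝ :=
  (Y₂ - Y₀) / (2 * h) + (s - (a + h)) * ((Y₂ - 2 * Y₁ + Y₀) / h ^ 2)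

/-- Weight of the left node in the product quadrature of the kernel `(t - s)^(-ν)` on
`[t - p h, t - q h]` with nodes `t - p h`, `t - (p - 1) h`, `t - (p - 2) h`. -/
def leftWeight (ν p q : ℝ) : ℝ :=
  (1 / Real.Gamma (3 - ν)) * ((2 - ν) * (p - 3 / 2) * (p ^ (1 - ν) - q ^ (1 - ν))
    - (1 - ν) * (p ^ (2 - ν) - q ^ (2 - ν)))

/-- Weight of the middle node, in the situation of `leftWeight`. -/
def midWeight (ν p q : ℝ) : ℝ :=
  (1 / Real.Gamma (3 - ν)) * (-2 * ((2 - ν) * (p - 1) * (p ^ (1 - ν) - q ^ (1 - ν))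
    - (1 - ν) * (p ^ (2 - ν) - q ^ (2 - ν))))

/-- Weight of the right node, in the situation of `leftWeight`. -/
def rightWeight (ν p q : ℝ) : ℝ :=
  (1 / Real.Gamma (3 - ν)) * ((2 - ν) * (p - 1 / 2) * (p ^ (1 - ν) - q ^ (1 - ν))
    - (1 - ν) * (p ^ (2 - ν) - q ^ (2 - ν)))

/-- `y₁` is a continuous derivative of `y` on `[0, T]`, and on every three-point stencil of step `h`
it is approximated by the derivative of the quadratic interpolant up to `K h²`. -/
structure QuadApprox (T K : ℝ) (y y₁ : ℝ → ℝ) : Prop where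
  contOn : ContinuousOn y (Set.Icc 0 T)
  contOn_deriv : ContinuousOn y₁ (Set.Icc 0 T)
  hasDerivAt : ∀ x ∈ Set.Ioo 0 T, HasDerivAt y (y₁ x) x
  abs_sub_le : ∀ h a : ℝ, 0 < h → 0 ≤ a → a + 2 * h ≤ T → ∀ s ∈ Set.Icc a (a + 2 * h),
    |y₁ s - quadInterpDeriv h a (y a) (y (a + h)) (y (a + 2 * h)) s| ≤ K * h ^ 2

end

lemma hasDerivAt_quadInterp {h : ℝ} (hh : h ≠ 0) (a Y₀ Y₁ Y₂ s : ℝ) :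
    HasDerivAt (quadInterp h a Y₀ Y₁ Y₂) (quadInterpDeriv h a Y₀ Y₁ Y₂ s) s := by
  have h1 : HasDerivAt (fun s : ℝ => s - (a + h)) 1 s := (hasDerivAt_id s).sub_const _
  have h2 := ((h1.mul_const ((Y₂ - Y₀) / (2 * h))).const_add Y₁).add
    ((h1.pow 2).mul_const ((Y₂ - 2 * Y₁ + Y₀) / (2 * h ^ 2)))
  refine h2.congr_deriv ?_
  unfold quadInterpDeriv
  field_simp
  push_cast
  ring

lemma hasDerivAt_quadInterpDeriv (h a Y₀ Y₁ Y₂ s : ℝ) :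
    HasDerivAt (quadInterpDeriv h a Y₀ Y₁ Y₂) ((Y₂ - 2 * Y₁ + Y₀) / h ^ 2) s := by
  have h1 : HasDerivAt (fun s : ℝ => s - (a + h)) 1 s := (hasDerivAt_id s).sub_const _
  have h2 := (h1.mul_const ((Y₂ - 2 * Y₁ + Y₀) / h ^ 2)).const_add ((Y₂ - Y₀) / (2 * h))
  exact h2.congr_deriv (one_mul _)

lemma continuous_quadInterpDeriv (h a Y₀ Y₁ Y₂ : ℝ) :
    Continuous (quadInterpDeriv h a Y₀ Y₁ Y₂) := by
  unfold quadInterpDeriv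
  fun_prop

lemma abs_sub_le_of_abs_hasDerivAt_le {f f' : ℝ → ℝ} {a b M : ℝ}
    (hf : ContinuousOn f (Set.Icc a b)) (hd : ∀ x ∈ Set.Ioo a b, HasDerivAt f (f' x) x)
    (hM : ∀ x ∈ Set.Ioo a b, |f' x| ≤ M) {x z : ℝ} (hx : x ∈ Set.Icc a b)
    (hz : z ∈ Set.Icc a b) : |f x - f z| ≤ M * |x - z| := by
  wlog hxz : z ≤ x generalizing x z
  · rw [abs_sub_comm, abs_sub_comm x z]
    exact this hz hx (le_of_not_ge hxz)
  rcases hxz.eq_or_lt with rfl | hlt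
  · simp
  have hsub : Set.Ioo z x ⊆ Set.Ioo a b := Set.Ioo_subset_Ioo hz.1 hx.2
  obtain ⟨c, hc, hc'⟩ := exists_hasDerivAt_eq_slope f f' hlt
    (hf.mono (Set.Icc_subset_Icc hz.1 hx.2)) fun u hu => hd u (hsub hu)
  have hpos : 0 < x - z := sub_pos.2 hlt
  rw [eq_div_iff hpos.ne'] at hc'
  rw [← hc', abs_mul]
  exact mul_le_mul_of_nonneg_right (hM c (hsub hc)) (abs_nonneg _)

/-- Error bound for the derivative of the quadratic interpolant. -/
lemma abs_sub_quadInterpDeriv_le {y y₁ y₂ y₃ : ℝ → ℝ} {a h M : ℝ} (hh : 0 < h)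
    (hy : ContinuousOn y (Set.Icc a (a + 2 * h))) (hy₁ : ContinuousOn y₁ (Set.Icc a (a + 2 * h)))
    (hy₂ : ContinuousOn y₂ (Set.Icc a (a + 2 * h)))
    (hd : ∀ x ∈ Set.Ioo a (a + 2 * h), HasDerivAt y (y₁ x) x)
    (hd₁ : ∀ x ∈ Set.Ioo a (a + 2 * h), HasDerivAt y₁ (y₂ x) x)
    (hd₂ : ∀ x ∈ Set.Ioo a (a + 2 * h), HasDerivAt y₂ (y₃ x) x)
    (hM : ∀ x ∈ Set.Ioo a (a + 2 * h), |y₃ x| ≤ M) {s : ℝ} (hs : s ∈ Set.Icc a (a + 2 * h)) :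
    |y₁ s - quadInterpDeriv h a (y a) (y (a + h)) (y (a + 2 * h)) s| ≤ 4 * M * h ^ 2 := by
  set P := quadInterp h a (y a) (y (a + h)) (y (a + 2 * h)) with hP
  set P₁ := quadInterpDeriv h a (y a) (y (a + h)) (y (a + 2 * h)) with hP₁
  set c := (y (a + 2 * h) - 2 * y (a + h) + y a) / h ^ 2 with hc
  have hPd : ∀ x, HasDerivAt P (P₁ x) x := fun x => hasDerivAt_quadInterp hh.ne' _ _ _ _ x
  have hP₁d : ∀ x, HasDerivAt P₁ c x := fun x => hasDerivAt_quadInterpDeriv _ _ _ _ _ x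
  have hPc : Continuous P := continuous_iff_continuousAt.2 fun x => (hPd x).continuousAt
  have hP₁c : Continuous P₁ := continuous_iff_continuousAt.2 fun x => (hP₁d x).continuousAt
  have e0 : (y - P) a = 0 := by
    simp only [Pi.sub_apply, hP, quadInterp]; field_simp; ring
  have e1 : (y - P) (a + h) = 0 := by
    simp [hP, quadInterp]
  have e2 : (y - P) (a + 2 * h) = 0 := by
    simp only [Pi.sub_apply, hP, quadInterp]; field_simp; ring
  have hec : ContinuousOn (y - P) (Set.Icc a (a + 2 * h)) := hy.sub hPc.continuousOn
  have he₁c : ContinuousOn (y₁ - P₁) (Set.Icc a (a + 2 * h)) := hy₁.sub hP₁c.continuousOn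
  have hed : ∀ x ∈ Set.Ioo a (a + 2 * h), HasDerivAt (y - P) ((y₁ - P₁) x) x :=
    fun x hx => (hd x hx).sub (hPd x)
  have he₁d : ∀ x ∈ Set.Ioo a (a + 2 * h), HasDerivAt (y₁ - P₁) (y₂ x - c) x :=
    fun x hx => (hd₁ x hx).sub (hP₁d x)
  obtain ⟨ξ, hξ, hξ0⟩ := exists_hasDerivAt_eq_zero (f := y - P) (f' := y₁ - P₁)
    (by linarith : a < a + h) (hec.mono (Set.Icc_subset_Icc le_rfl (by linarith)))
    (e0.trans e1.symm) fun x hx => hed x ⟨hx.1, by linarith [hx.2]⟩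
  obtain ⟨ζ, hζ, hζ0⟩ := exists_hasDerivAt_eq_zero (f := y - P) (f' := y₁ - P₁)
    (by linarith : a + h < a + 2 * h) (hec.mono (Set.Icc_subset_Icc (by linarith) le_rfl))
    (e1.trans e2.symm) fun x hx => hed x ⟨by linarith [hx.1], hx.2⟩
  obtain ⟨η, hη, hη0⟩ := exists_hasDerivAt_eq_zero (f := y₁ - P₁) (f' := fun x => y₂ x - c)
    (hξ.2.trans hζ.1) (he₁c.mono (Set.Icc_subset_Icc hξ.1.le hζ.2.le))
    (hξ0.trans hζ0.symm) fun x hx => he₁d x ⟨hξ.1.trans hx.1, hx.2.trans hζ.2⟩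
  have hηI : η ∈ Set.Icc a (a + 2 * h) := ⟨(hξ.1.trans hη.1).le, (hη.2.trans hζ.2).le⟩
  have hξI : ξ ∈ Set.Icc a (a + 2 * h) := ⟨hξ.1.le, by linarith [hξ.2]⟩
  have hM0 : 0 ≤ M := (abs_nonneg _).trans (hM (a + h) ⟨by linarith, by linarith⟩)
  have hdist : ∀ u ∈ Set.Icc a (a + 2 * h), ∀ v ∈ Set.Icc a (a + 2 * h), |u - v| ≤ 2 * h :=
    fun u hu v hv => abs_sub_le_iff.2 ⟨by linarith [hu.2, hv.1], by linarith [hv.2, hu.1]⟩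
  have hb₂ : ∀ x ∈ Set.Ioo a (a + 2 * h), |y₂ x - c| ≤ M * (2 * h) := by
    intro x hx
    have hxI := Set.Ioo_subset_Icc_self hx
    have hcη : c = y₂ η := (sub_eq_zero.1 hη0).symm
    rw [hcη]
    exact (abs_sub_le_of_abs_hasDerivAt_le hy₂ hd₂ hM hxI hηI).trans
      (mul_le_mul_of_nonneg_left (hdist x hxI η hηI) hM0)
  have hb₁ := abs_sub_le_of_abs_hasDerivAt_le he₁c he₁d hb₂ hs hξI
  rw [hξ0, sub_zero] at hb₁
  calc |y₁ s - P₁ s| ≤ M * (2 * h) * |s - ξ| := hb₁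
    _ ≤ M * (2 * h) * (2 * h) :=
        mul_le_mul_of_nonneg_left (hdist s hs ξ hξI) (by positivity)
    _ = 4 * M * h ^ 2 := by ring

lemma exists_quadApprox {T : ℝ} (hT : 0 < T) {y : ℝ → ℝ}
    (hy : ContDiffOn ℝ 3 y (Set.Icc 0 T)) :
    ∃ K, 0 ≤ K ∧ QuadApprox T K y (derivWithin y (Set.Icc 0 T)) := by
  have hu := uniqueDiffOn_Icc hT
  set S := Set.Icc 0 T
  set y₁ := derivWithin y S
  set y₂ := derivWithin y₁ S
  set y₃ := derivWithin y₂ S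
  have c₁ : ContDiffOn ℝ 2 y₁ S := hy.derivWithin hu (by norm_num)
  have c₂ : ContDiffOn ℝ 1 y₂ S := c₁.derivWithin hu (by norm_num)
  have c₃ : ContinuousOn y₃ S :=
    (c₂.derivWithin (m := 0) hu (by norm_num)).continuousOn
  have hder : ∀ f : ℝ → ℝ, DifferentiableOn ℝ f S → ∀ x ∈ Set.Ioo 0 T,
      HasDerivAt f (derivWithin f S x) x := fun f hf x hx =>
    ((hf x (Set.Ioo_subset_Icc_self hx)).hasDerivWithinAt).hasDerivAt (Icc_mem_nhds hx.1 hx.2)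
  obtain ⟨M, hM⟩ := isCompact_Icc.exists_bound_of_continuousOn c₃
  have hM0 : 0 ≤ M := (norm_nonneg _).trans (hM 0 ⟨le_rfl, hT.le⟩)
  refine ⟨4 * M, by positivity, hy.continuousOn, c₁.continuousOn,
    hder y (hy.differentiableOn (by norm_num)), fun h a hh ha hT' s hs => ?_⟩
  have hsub : Set.Icc a (a + 2 * h) ⊆ S := Set.Icc_subset_Icc ha hT'
  have hsub' : Set.Ioo a (a + 2 * h) ⊆ Set.Ioo 0 T := Set.Ioo_subset_Ioo ha hT'
  exact abs_sub_quadInterpDeriv_le hh (hy.continuousOn.mono hsub) (c₁.continuousOn.mono hsub)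
    (c₂.continuousOn.mono hsub)
    (fun x hx => hder y (hy.differentiableOn (by norm_num)) x (hsub' hx))
    (fun x hx => hder y₁ (c₁.differentiableOn (by norm_num)) x (hsub' hx))
    (fun x hx => hder y₂ (c₂.differentiableOn (by norm_num)) x (hsub' hx))
    (fun x hx => hM x (hsub (Set.Ioo_subset_Icc_self hx))) hs

lemma rpow_two_sub_eq {ν x : ℝ} (hν : ν < 1) (hx : 0 ≤ x) :
    x ^ (2 - ν) = x * x ^ (1 - ν) := by
  rw [show 2 - ν = (1 - ν) + 1 by ring, Real.rpow_add_one' hx (by linarith), mul_comm]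

lemma intervalIntegrable_kernel {ν : ℝ} (hν : ν < 1) (t a b : ℝ) :
    IntervalIntegrable (fun s => (t - s) ^ (-ν)) MeasureTheory.volume a b := by
  have h := (intervalIntegral.intervalIntegrable_rpow' (r := -ν) (by linarith)
    (a := t - a) (b := t - b)).comp_sub_left t
  simpa using h

lemma integral_kernel {ν : ℝ} (hν : ν < 1) (t a : ℝ) :
    ∫ s in a..t, (t - s) ^ (-ν) = (t - a) ^ (1 - ν) / (1 - ν) := by
  rw [intervalIntegral.integral_comp_sub_left (fun u => u ^ (-ν)) t,
    integral_rpow (Or.inl (by linarith)), sub_self, show -ν + 1 = 1 - ν by ring,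
    Real.zero_rpow (by linarith), sub_zero]

lemma integral_kernel_affine {ν h p q : ℝ} (hν : ν < 1) (hh : 0 < h) (hq : 0 ≤ q) (hqp : q ≤ p)
    (t A B : ℝ) :
    ∫ s in (t - p * h)..(t - q * h), (t - s) ^ (-ν) * (A + B * (t - s)) =
      h ^ (-ν) * (A * h * ((p ^ (1 - ν) - q ^ (1 - ν)) / (1 - ν))
        + B * h ^ 2 * ((p ^ (2 - ν) - q ^ (2 - ν)) / (2 - ν))) := by
  have hp : 0 ≤ p := hq.trans hqp
  have hle : q * h ≤ p * h := mul_le_mul_of_nonneg_right hqp hh.le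
  have h1 : h ^ (1 - ν) = h ^ (-ν) * h := by
    rw [show 1 - ν = -ν + 1 by ring, Real.rpow_add_one hh.ne']
  have h2 : h ^ (2 - ν) = h ^ (-ν) * h ^ 2 := by
    rw [rpow_two_sub_eq hν hh.le, h1]; ring
  rw [intervalIntegral.integral_comp_sub_left (fun u => u ^ (-ν) * (A + B * u)) t,
    sub_sub_cancel, sub_sub_cancel]
  have hcongr : ∫ u in (q * h)..(p * h), u ^ (-ν) * (A + B * u) =
      ∫ u in (q * h)..(p * h), (A * u ^ (-ν) + B * u ^ (1 - ν)) := by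
    refine intervalIntegral.integral_congr fun u hu => ?_
    rw [Set.uIcc_of_le hle] at hu
    have hu0 : 0 ≤ u := (mul_nonneg hq hh.le).trans hu.1
    have : u ^ (1 - ν) = u ^ (-ν) * u := by
      rw [show 1 - ν = -ν + 1 by ring, Real.rpow_add_one' hu0 (by linarith)]
    simp only [this]
    ring
  rw [hcongr, intervalIntegral.integral_add
      ((intervalIntegral.intervalIntegrable_rpow' (by linarith)).const_mul A)
      ((intervalIntegral.intervalIntegrable_rpow' (by linarith)).const_mul B),
    intervalIntegral.integral_const_mul, intervalIntegral.integral_const_mul,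
    integral_rpow (Or.inl (by linarith)), integral_rpow (Or.inl (by linarith)),
    show -ν + 1 = 1 - ν by ring, show 1 - ν + 1 = 2 - ν by ring,
    Real.mul_rpow hp hh.le, Real.mul_rpow hp hh.le, Real.mul_rpow hq hh.le,
    Real.mul_rpow hq hh.le, h1, h2]
  ring

lemma integral_kernel_quadInterpDeriv {ν h p q : ℝ} (hν : ν < 1) (hh : 0 < h) (hq : 0 ≤ q)
    (hqp : q ≤ p) {a b t : ℝ} (ha : a = t - p * h) (hb : b = t - q * h) (Y₀ Y₁ Y₂ : ℝ) :
    ∫ s in a..b, (t - s) ^ (-ν) * quadInterpDeriv h a Y₀ Y₁ Y₂ s =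
      Real.Gamma (1 - ν) * (h ^ (-ν) *
        (leftWeight ν p q * Y₀ + midWeight ν p q * Y₁ + rightWeight ν p q * Y₂)) := by
  have hΓ : Real.Gamma (3 - ν) = (2 - ν) * ((1 - ν) * Real.Gamma (1 - ν)) := by
    rw [← Real.Gamma_add_one (by linarith : 1 - ν ≠ 0), show 1 - ν + 1 = 2 - ν by ring,
      ← Real.Gamma_add_one (by linarith : 2 - ν ≠ 0), show 2 - ν + 1 = 3 - ν by ring]
  have hΓ1 : Real.Gamma (1 - ν) ≠ 0 := (Real.Gamma_pos_of_pos (by linarith)).ne'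
  have h1 : 1 - ν ≠ 0 := by linarith
  have h2 : 2 - ν ≠ 0 := by linarith
  have key := integral_kernel_affine hν hh hq hqp t
    ((Y₂ - Y₀) / (2 * h) + (p - 1) * h * ((Y₂ - 2 * Y₁ + Y₀) / h ^ 2))
    (-((Y₂ - 2 * Y₁ + Y₀) / h ^ 2))
  rw [← ha, ← hb] at key
  have hcongr : ∀ s, quadInterpDeriv h a Y₀ Y₁ Y₂ s =
      (Y₂ - Y₀) / (2 * h) + (p - 1) * h * ((Y₂ - 2 * Y₁ + Y₀) / h ^ 2)
        + -((Y₂ - 2 * Y₁ + Y₀) / h ^ 2) * (t - s) := by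
    intro s
    rw [quadInterpDeriv, ha]
    ring
  simp only [hcongr]
  rw [key, leftWeight, midWeight, rightWeight, hΓ]
  field_simp
  ring

/-- A function of mean zero, integrated against the kernel away from its singularity, only sees the
oscillation of the kernel. -/
lemma abs_integral_kernel_mul_le {ν a b t G : ℝ} (hν0 : 0 ≤ ν) (hν : ν < 1) (hab : a ≤ b)
    (hbt : b < t) {g : ℝ → ℝ} (hg : ContinuousOn g (Set.Icc a b)) (hg0 : ∫ s in a..b, g s = 0)
    (hG : ∀ s ∈ Set.Icc a b, |g s| ≤ G) :
    |∫ s in a..b, (t - s) ^ (-ν) * g s| ≤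
      ((t - b) ^ (-ν) - (t - a) ^ (-ν)) * G * (b - a) := by
  have hg' : ContinuousOn g (Set.uIcc a b) := by rwa [Set.uIcc_of_le hab]
  have heq : ∫ s in a..b, (t - s) ^ (-ν) * g s =
      ∫ s in a..b, ((t - s) ^ (-ν) - (t - a) ^ (-ν)) * g s := by
    simp only [sub_mul]
    rw [intervalIntegral.integral_sub ((intervalIntegrable_kernel hν t a b).mul_continuousOn hg')
      (hg'.intervalIntegrable.const_mul _), intervalIntegral.integral_const_mul, hg0]
    ring
  rw [heq, ← Real.norm_eq_abs]
  refine (intervalIntegral.norm_integral_le_of_norm_le_const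
    (C := ((t - b) ^ (-ν) - (t - a) ^ (-ν)) * G) fun s hs => ?_).trans_eq ?_
  · rw [Set.uIoc_of_le hab] at hs
    have h1 : (t - a) ^ (-ν) ≤ (t - s) ^ (-ν) :=
      Real.rpow_le_rpow_of_nonpos (by linarith [hs.2]) (by linarith [hs.1]) (by linarith)
    have h2 : (t - s) ^ (-ν) ≤ (t - b) ^ (-ν) :=
      Real.rpow_le_rpow_of_nonpos (by linarith) (by linarith [hs.2]) (by linarith)
    rw [Real.norm_eq_abs, abs_mul, abs_of_nonneg (by linarith)]
    exact mul_le_mul (by linarith) (hG s ⟨hs.1.le, hs.2⟩) (abs_nonneg _) (by linarith)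
  · rw [abs_of_nonneg (by linarith)]

lemma abs_integral_kernel_mul_le_of_end {ν a t G : ℝ} (hν : ν < 1) (hat : a ≤ t) {g : ℝ → ℝ}
    (hG : ∀ s ∈ Set.Icc a t, |g s| ≤ G) :
    |∫ s in a..t, (t - s) ^ (-ν) * g s| ≤ G * ((t - a) ^ (1 - ν) / (1 - ν)) := by
  rw [← integral_kernel hν, ← intervalIntegral.integral_const_mul, ← Real.norm_eq_abs]
  refine intervalIntegral.norm_integral_le_of_norm_le hat
    (Filter.Eventually.of_forall fun s hs => ?_)
    ((intervalIntegrable_kernel hν t a t).const_mul G)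
  have h0 : 0 ≤ (t - s) ^ (-ν) := Real.rpow_nonneg (by linarith [hs.2]) _
  rw [Real.norm_eq_abs, abs_mul, abs_of_nonneg h0, mul_comm]
  exact mul_le_mul_of_nonneg_right (hG s ⟨hs.1.le, hs.2⟩) h0

namespace QuadApprox

variable {T K ν : ℝ} {y y₁ : ℝ → ℝ}

lemma intervalIntegrable_kernel_mul (H : QuadApprox T K y y₁) (hν : ν < 1) (t : ℝ) {a b : ℝ}
    (ha : 0 ≤ a) (hab : a ≤ b) (hb : b ≤ T) :
    IntervalIntegrable (fun s => (t - s) ^ (-ν) * y₁ s) MeasureTheory.volume a b := by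
  refine (intervalIntegrable_kernel hν t a b).mul_continuousOn (H.contOn_deriv.mono ?_)
  rw [Set.uIcc_of_le hab]
  exact Set.Icc_subset_Icc ha hb

lemma integral_sub_quadInterpDeriv (H : QuadApprox T K y y₁) {h a b : ℝ} (hh : 0 < h) (ha : 0 ≤ a)
    (hT : a + 2 * h ≤ T) (hb : b = a + h ∨ b = a + 2 * h) :
    ∫ s in a..b, (y₁ s - quadInterpDeriv h a (y a) (y (a + h)) (y (a + 2 * h)) s) = 0 := by
  have hab : a ≤ b := by rcases hb with rfl | rfl <;> linarith
  have hbT : b ≤ T := by rcases hb with rfl | rfl <;> linarith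
  have hsub : Set.Icc a b ⊆ Set.Icc 0 T := Set.Icc_subset_Icc ha hbT
  have hPd := hasDerivAt_quadInterp hh.ne' a (y a) (y (a + h)) (y (a + 2 * h))
  have hPc : Continuous (quadInterp h a (y a) (y (a + h)) (y (a + 2 * h))) :=
    continuous_iff_continuousAt.2 fun x => (hPd x).continuousAt
  rw [intervalIntegral.integral_eq_sub_of_hasDerivAt_of_le hab
    ((H.contOn.mono hsub).sub hPc.continuousOn)
    (fun x hx => (H.hasDerivAt x ⟨ha.trans_lt hx.1, hx.2.trans_le hbT⟩).sub (hPd x))]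
  · rcases hb with rfl | rfl <;> simp only [Pi.sub_apply, quadInterp] <;> field_simp <;> ring
  · refine ContinuousOn.intervalIntegrable ?_
    rw [Set.uIcc_of_le hab]
    exact (H.contOn_deriv.mono hsub).sub (continuous_quadInterpDeriv _ _ _ _ _).continuousOn

/-- The quadrature error on one panel, in terms of the error of the interpolant. -/
lemma integral_kernel_sub_eq (H : QuadApprox T K y y₁) (hν : ν < 1) {h a b t p q : ℝ}
    (hh : 0 < h) (ha : 0 ≤ a) (hbT : b ≤ T) (hq : 0 ≤ q) (hqp : q ≤ p) (hap : a = t - p * h)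
    (hbq : b = t - q * h) (Y₀ Y₁ Y₂ : ℝ) :
    (∫ s in a..b, (t - s) ^ (-ν) * y₁ s) - Real.Gamma (1 - ν) * (h ^ (-ν) *
        (leftWeight ν p q * Y₀ + midWeight ν p q * Y₁ + rightWeight ν p q * Y₂)) =
      ∫ s in a..b, (t - s) ^ (-ν) * (y₁ s - quadInterpDeriv h a Y₀ Y₁ Y₂ s) := by
  have hab : a ≤ b := by
    have := mul_le_mul_of_nonneg_right hqp hh.le
    linarith
  rw [← integral_kernel_quadInterpDeriv hν hh hq hqp hap hbq Y₀ Y₁ Y₂,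
    ← intervalIntegral.integral_sub (H.intervalIntegrable_kernel_mul hν t ha hab hbT)
      ((intervalIntegrable_kernel hν t a b).mul_continuousOn
        (continuous_quadInterpDeriv _ _ _ _ _).continuousOn)]
  simp only [mul_sub]

lemma abs_panel_le (H : QuadApprox T K y y₁) (hν0 : 0 ≤ ν) (hν : ν < 1) {h a b t p q : ℝ}
    (hh : 0 < h) (ha : 0 ≤ a) (hT : a + 2 * h ≤ T) (hq : 0 < q) (hap : a = t - p * h)
    (hbq : b = t - q * h) (hpq : p = q + 1 ∨ p = q + 2) :
    |(∫ s in a..b, (t - s) ^ (-ν) * y₁ s) - Real.Gamma (1 - ν) * (h ^ (-ν) *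
        (leftWeight ν p q * y a + midWeight ν p q * y (a + h)
          + rightWeight ν p q * y (a + 2 * h)))| ≤
      2 * K * h ^ 3 * ((t - b) ^ (-ν) - (t - a) ^ (-ν)) := by
  have hb : b = a + h ∨ b = a + 2 * h := by
    rcases hpq with rfl | rfl
    · left; linarith
    · right; linarith
  have hab : a ≤ b := by rcases hb with rfl | rfl <;> linarith
  have hb2 : b ≤ a + 2 * h := by rcases hb with rfl | rfl <;> linarith
  have hqh : 0 < q * h := mul_pos hq hh
  have hbt : b < t := by linarith
  have hsub : Set.Icc a b ⊆ Set.Icc a (a + 2 * h) := Set.Icc_subset_Icc le_rfl hb2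
  have hK := H.abs_sub_le h a hh ha hT
  rw [H.integral_kernel_sub_eq hν hh ha (hb2.trans hT) hq.le
    (by rcases hpq with rfl | rfl <;> linarith) hap hbq]
  refine (abs_integral_kernel_mul_le hν0 hν hab hbt
    ((H.contOn_deriv.mono (hsub.trans (Set.Icc_subset_Icc ha hT))).sub
      (continuous_quadInterpDeriv _ _ _ _ _).continuousOn)
    (H.integral_sub_quadInterpDeriv hh ha hT hb) fun s hs => hK s (hsub hs)).trans ?_
  have hK0 : 0 ≤ K * h ^ 2 := (abs_nonneg _).trans (hK a ⟨le_rfl, by linarith⟩)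
  have hw : 0 ≤ (t - b) ^ (-ν) - (t - a) ^ (-ν) :=
    sub_nonneg.2 (Real.rpow_le_rpow_of_nonpos (by linarith) (by linarith) (by linarith))
  calc ((t - b) ^ (-ν) - (t - a) ^ (-ν)) * (K * h ^ 2) * (b - a)
      ≤ ((t - b) ^ (-ν) - (t - a) ^ (-ν)) * (K * h ^ 2) * (2 * h) :=
        mul_le_mul_of_nonneg_left (by linarith) (mul_nonneg hw hK0)
    _ = _ := by ring

lemma abs_end_panel_le (H : QuadApprox T K y y₁) (hν0 : 0 ≤ ν) (hν : ν < 1) {h a t p : ℝ}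
    (hh : 0 < h) (ha : 0 ≤ a) (hT : a + 2 * h ≤ T) (hp : 0 ≤ p) (hp2 : p ≤ 2)
    (hap : a = t - p * h) :
    |(∫ s in a..t, (t - s) ^ (-ν) * y₁ s) - Real.Gamma (1 - ν) * (h ^ (-ν) *
        (leftWeight ν p 0 * y a + midWeight ν p 0 * y (a + h)
          + rightWeight ν p 0 * y (a + 2 * h)))| ≤
      2 * K / (1 - ν) * h ^ (3 - ν) := by
  have hph : 0 ≤ p * h := mul_nonneg hp hh.le
  have hph2 : p * h ≤ 2 * h := mul_le_mul_of_nonneg_right hp2 hh.le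
  have hK := H.abs_sub_le h a hh ha hT
  have hK0 : 0 ≤ K := by
    have : 0 ≤ K * h ^ 2 := (abs_nonneg _).trans (hK a ⟨le_rfl, by linarith⟩)
    exact nonneg_of_mul_nonneg_left this (by positivity)
  rw [H.integral_kernel_sub_eq hν hh ha (by linarith) le_rfl hp hap (by ring)]
  refine (abs_integral_kernel_mul_le_of_end hν (by linarith)
    fun s hs => hK s ⟨hs.1, by linarith [hs.2]⟩).trans ?_
  have h1 : (t - a) ^ (1 - ν) ≤ 2 * h ^ (1 - ν) := by
    calc (t - a) ^ (1 - ν) ≤ (2 * h) ^ (1 - ν) :=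
          Real.rpow_le_rpow (by linarith) (by linarith) (by linarith)
      _ = 2 ^ (1 - ν) * h ^ (1 - ν) := Real.mul_rpow (by norm_num) hh.le
      _ ≤ 2 * h ^ (1 - ν) := by
          refine mul_le_mul_of_nonneg_right ?_ (Real.rpow_nonneg hh.le _)
          simpa using Real.rpow_le_rpow_of_exponent_le (x := 2) (by norm_num)
            (by linarith : 1 - ν ≤ 1)
  have h3 : h ^ (3 - ν) = h ^ 2 * h ^ (1 - ν) := by
    rw [show 3 - ν = (1 - ν) + (2 : ℕ) by push_cast; ring, Real.rpow_add_natCast hh.ne', mul_comm]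
  have h1ν : 0 < 1 - ν := by linarith
  calc K * h ^ 2 * ((t - a) ^ (1 - ν) / (1 - ν))
      ≤ K * h ^ 2 * (2 * h ^ (1 - ν) / (1 - ν)) := by gcongr
    _ = _ := by rw [h3]; ring

/-- The product quadrature on the consecutive panels `[a + 2kh, a + 2(k+1)h]`. -/
lemma abs_panels_le (H : QuadApprox T K y y₁) (hν0 : 0 ≤ ν) (hν : ν < 1) (hK0 : 0 ≤ K) {h a t : ℝ}
    (n : ℕ) (hh : 0 < h) (ha : 0 ≤ a) (ht : t = a + (2 * n + 2) * h) (hT : t ≤ T) :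
    |(∫ s in a..t, (t - s) ^ (-ν) * y₁ s) - Real.Gamma (1 - ν) * (h ^ (-ν) *
        ∑ k ∈ range (n + 1),
          (leftWeight ν (2 * ((n : ℝ) - k) + 2) (2 * ((n : ℝ) - k)) * y (a + 2 * k * h)
            + midWeight ν (2 * ((n : ℝ) - k) + 2) (2 * ((n : ℝ) - k)) * y (a + 2 * k * h + h)
            + rightWeight ν (2 * ((n : ℝ) - k) + 2) (2 * ((n : ℝ) - k))
              * y (a + 2 * k * h + 2 * h)))| ≤
      (2 * K + 2 * K / (1 - ν)) * h ^ (3 - ν) := by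
  set F : ℕ → ℝ := fun k =>
    leftWeight ν (2 * ((n : ℝ) - k) + 2) (2 * ((n : ℝ) - k)) * y (a + 2 * k * h)
      + midWeight ν (2 * ((n : ℝ) - k) + 2) (2 * ((n : ℝ) - k)) * y (a + 2 * k * h + h)
      + rightWeight ν (2 * ((n : ℝ) - k) + 2) (2 * ((n : ℝ) - k)) * y (a + 2 * k * h + 2 * h)
    with hF
  have hsplit : ∀ b c : ℝ, a ≤ b → b ≤ c → c ≤ T → (∫ s in a..c, (t - s) ^ (-ν) * y₁ s) =
      (∫ s in a..b, (t - s) ^ (-ν) * y₁ s) + ∫ s in b..c, (t - s) ^ (-ν) * y₁ s :=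
    fun b c hab hbc hc => (intervalIntegral.integral_add_adjacent_intervals
      (H.intervalIntegrable_kernel_mul hν t ha hab (hbc.trans hc))
      (H.intervalIntegrable_kernel_mul hν t (ha.trans hab) hbc hc)).symm
  have hind : ∀ k : ℕ, k ≤ n →
      |(∫ s in a..(a + 2 * k * h), (t - s) ^ (-ν) * y₁ s) - Real.Gamma (1 - ν) * (h ^ (-ν) *
        ∑ i ∈ range k, F i)| ≤ 2 * K * h ^ 3 * (t - (a + 2 * k * h)) ^ (-ν) := by
    intro k
    induction k with
    | zero =>
      intro _
      have : 0 ≤ (t - a) ^ (-ν) := Real.rpow_nonneg (by rw [ht, add_sub_cancel_left]; positivity) _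
      simp only [Nat.cast_zero, mul_zero, zero_mul, add_zero, intervalIntegral.integral_same,
        range_zero, sum_empty, sub_zero, abs_zero]
      positivity
    | succ k ih =>
      intro hk
      have hkn : (k : ℝ) + 1 ≤ n := by exact_mod_cast hk
      have hkh : ((k : ℝ) + 1) * h ≤ n * h := mul_le_mul_of_nonneg_right hkn hh.le
      have hkh0 : 0 ≤ (k : ℝ) * h := by positivity
      have hp := H.abs_panel_le hν0 hν (a := a + 2 * k * h) (b := a + 2 * (k + 1 : ℕ) * h) (t := t)
        (p := 2 * ((n : ℝ) - k) + 2) (q := 2 * ((n : ℝ) - k)) hh (by linarith) (by linarith)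
        (by linarith) (by rw [ht]; ring) (by rw [ht]; push_cast; ring) (Or.inr rfl)
      have ih' := ih (by omega)
      have hs := hsplit (a + 2 * k * h) (a + 2 * (k + 1 : ℕ) * h) (by linarith)
        (by push_cast; linarith) (by push_cast; linarith)
      rw [sum_range_succ, hs]
      rw [abs_le] at hp ih' ⊢
      simp only [hF] at hp ih' ⊢
      constructor <;> linarith
  have hn := hind n le_rfl
  have hnh : 0 ≤ (n : ℝ) * h := by positivity
  have hend := H.abs_end_panel_le hν0 hν (a := a + 2 * n * h) (t := t) (p := 2) hh (by linarith)
    (by linarith) (by norm_num) le_rfl (by rw [ht]; ring)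
  have hFn : F n = leftWeight ν 2 0 * y (a + 2 * n * h) + midWeight ν 2 0 * y (a + 2 * n * h + h)
      + rightWeight ν 2 0 * y (a + 2 * n * h + 2 * h) := by
    simp [hF]
  rw [← hFn] at hend
  have hpow : 2 * K * h ^ 3 * (t - (a + 2 * n * h)) ^ (-ν) ≤ 2 * K * h ^ (3 - ν) := by
    have h3 : h ^ (3 - ν) = h ^ 3 * h ^ (-ν) := by
      rw [show 3 - ν = -ν + (3 : ℕ) by push_cast; ring, Real.rpow_add_natCast hh.ne', mul_comm]
    rw [h3, ← mul_assoc]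
    exact mul_le_mul_of_nonneg_left
      (Real.rpow_le_rpow_of_nonpos hh (by linarith) (by linarith)) (by positivity)
  rw [sum_range_succ, hsplit (a + 2 * n * h) t (by linarith) (by linarith) hT]
  rw [abs_le] at hn hend ⊢
  constructor <;> linarith

end QuadApprox

lemma Dbar_zero {ν : ℝ} (hν : ν < 1) (m : ℕ) :
    Dbar ν m 0 = leftWeight ν (2 * m + 2) (2 * m) := by
  have h0 : (0 : ℝ) ≤ 2 * m := by positivity
  rw [Dbar, if_pos rfl, leftWeight, rpow_two_sub_eq hν h0,
    rpow_two_sub_eq hν (by linarith : (0 : ℝ) ≤ 2 * m + 2)]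
  ring

lemma Dbar_odd {ν : ℝ} (hν : ν < 1) {m k : ℕ} (hk : k ≤ m) {q : ℝ} (hq : q = 2 * m - 2 * k) :
    Dbar ν m (2 * k + 1) = midWeight ν (q + 2) q := by
  have hkm : (k : ℝ) ≤ m := by exact_mod_cast hk
  have h0 : 0 ≤ q := by linarith
  rw [Dbar, if_neg (by omega), if_neg (by omega), show (2 * k + 1) / 2 = k by omega, ← hq,
    midWeight, rpow_two_sub_eq hν h0, rpow_two_sub_eq hν (by linarith : 0 ≤ q + 2)]
  ring

lemma Dbar_even {ν : ℝ} (hν : ν < 1) {m k : ℕ} (hk0 : k ≠ 0) (hk : k ≤ m) {q : ℝ}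
    (hq : q = 2 * m - 2 * k) :
    Dbar ν m (2 * k) = leftWeight ν (q + 2) q + rightWeight ν (q + 4) (q + 2) := by
  have hkm : (k : ℝ) ≤ m := by exact_mod_cast hk
  have h0 : 0 ≤ q := by linarith
  rw [Dbar, if_neg (by omega), if_pos (by omega), show (2 * k) / 2 = k by omega, ← hq,
    leftWeight, rightWeight, rpow_two_sub_eq hν h0, rpow_two_sub_eq hν (by linarith : 0 ≤ q + 2),
    rpow_two_sub_eq hν (by linarith : 0 ≤ q + 4)]
  ring

lemma Dtil_eq_weights {ν : ℝ} (hν : ν < 1) :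
    Dtil0 ν = leftWeight ν 2 0 ∧ Dtil1 ν = midWeight ν 2 0 ∧ Dtil2 ν = rightWeight ν 2 0 := by
  have h : (2 : ℝ) ^ (1 - ν) * 2 ^ ν = 2 := by
    rw [← Real.rpow_add (by norm_num)]; simp
  have hpos : (2 : ℝ) ^ ν ≠ 0 := (Real.rpow_pos_of_pos (by norm_num) _).ne'
  have hΓ : Real.Gamma (3 - ν) ≠ 0 := (Real.Gamma_pos_of_pos (by linarith)).ne'
  rw [leftWeight, midWeight, rightWeight, Dtil0, Dtil1, Dtil2, rpow_two_sub_eq hν le_rfl,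
    rpow_two_sub_eq hν zero_le_two, Real.zero_rpow (by linarith : 1 - ν ≠ 0),
    eq_div_of_mul_eq hpos h]
  refine ⟨?_, ?_, ?_⟩ <;> field_simp <;> ring

lemma rightWeight_two_zero {ν : ℝ} (hν : ν < 1) : rightWeight ν 2 0 = alpha0 ν :=
  (Dtil_eq_weights hν).2.2.symm

lemma Dhat_eq_weights {ν : ℝ} (hν : ν < 1) :
    Dhat0 ν = leftWeight ν 1 0 ∧ Dhat1 ν = midWeight ν 1 0 ∧ Dhat2 ν = rightWeight ν 1 0 := by
  have hΓ : Real.Gamma (3 - ν) ≠ 0 := (Real.Gamma_pos_of_pos (by linarith)).ne'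
  rw [leftWeight, midWeight, rightWeight, Dhat0, Dhat1, Dhat2, rpow_two_sub_eq hν le_rfl,
    Real.zero_rpow (by linarith : 1 - ν ≠ 0), Real.one_rpow, Real.one_rpow]
  refine ⟨?_, ?_, ?_⟩ <;> field_simp <;> ring

lemma Dco_zero {ν : ℝ} (hν : ν < 1) (m : ℕ) :
    Dco ν m 0 = leftWeight ν (2 * m + 1) (2 * m) := by
  have h0 : (0 : ℝ) ≤ 2 * m := by positivity
  rw [Dco, if_pos rfl, leftWeight, rpow_two_sub_eq hν h0,
    rpow_two_sub_eq hν (by linarith : (0 : ℝ) ≤ 2 * m + 1)]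
  ring

lemma Dco_one {ν : ℝ} (hν : ν < 1) {m : ℕ} (hm : 1 ≤ m) :
    Dco ν m 1 = midWeight ν (2 * m + 1) (2 * m) + leftWeight ν (2 * m) (2 * m - 2) := by
  have h1 : (1 : ℝ) ≤ m := by exact_mod_cast hm
  rw [Dco, if_neg one_ne_zero, if_pos rfl, leftWeight, midWeight,
    rpow_two_sub_eq hν (by linarith : (0 : ℝ) ≤ 2 * m),
    rpow_two_sub_eq hν (by linarith : (0 : ℝ) ≤ 2 * m + 1),
    rpow_two_sub_eq hν (by linarith : (0 : ℝ) ≤ 2 * m - 2)]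
  ring

lemma Dco_two {ν : ℝ} (hν : ν < 1) {m : ℕ} (hm : 1 ≤ m) :
    Dco ν m 2 = rightWeight ν (2 * m + 1) (2 * m) + midWeight ν (2 * m) (2 * m - 2) := by
  have h1 : (1 : ℝ) ≤ m := by exact_mod_cast hm
  rw [Dco, if_neg two_ne_zero, if_neg (by norm_num), if_pos rfl, rightWeight, midWeight,
    rpow_two_sub_eq hν (by linarith : (0 : ℝ) ≤ 2 * m),
    rpow_two_sub_eq hν (by linarith : (0 : ℝ) ≤ 2 * m + 1),
    rpow_two_sub_eq hν (by linarith : (0 : ℝ) ≤ 2 * m - 2)]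
  ring

lemma Dco_of_three_le (ν : ℝ) (m : ℕ) {k : ℕ} (hk : 3 ≤ k) : Dco ν m k = Dbar ν m (k + 1) := by
  rw [Dco, if_neg (by omega), if_neg (by omega), if_neg (by omega)]

/-- Regrouping a nodal sum into a sum over panels of three nodes. -/
lemma sum_nodes_eq_sum_panels (f l m r Y : ℕ → ℝ) (n : ℕ)
    (heven : ∀ k < n, f (2 * k + 2) = l (k + 1) + r k)
    (hodd : ∀ k < n, f (2 * k + 3) = m (k + 1)) :
    ∑ k ∈ Finset.range (2 * n + 2), f k * Y k + r n * Y (2 * n + 2) =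
      ∑ k ∈ Finset.range (n + 1), (l k * Y (2 * k) + m k * Y (2 * k + 1) + r k * Y (2 * k + 2))
        + ((f 0 - l 0) * Y 0 + (f 1 - m 0) * Y 1) := by
  induction n with
  | zero =>
    simp [Finset.sum_range_succ]
    ring
  | succ n ih =>
    have ih' := ih (fun k hk => heven k (by omega)) fun k hk => hodd k (by omega)
    have he := heven n (by omega)
    have ho := hodd n (by omega)
    rw [Finset.sum_range_succ _ (n + 1), show 2 * (n + 1) + 2 = 2 * n + 2 + 1 + 1 by ring,
      Finset.sum_range_succ, Finset.sum_range_succ, he, show 2 * n + 2 + 1 = 2 * n + 3 by ring, ho,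
      show 2 * (n + 1) = 2 * n + 2 by ring]
    simp only [show 2 * n + 2 + 1 = 2 * n + 3 by ring]
    linarith

/-- The discrete derivative at even grid points, as a sum over panels. -/
lemma discCaputo_even {ν : ℝ} (hν : ν < 1) (h : ℝ) (y : ℝ → ℝ) (n : ℕ) :
    discCaputo ν h y (2 * n + 2) = h ^ (-ν) * ∑ k ∈ Finset.range (n + 1),
      (leftWeight ν (2 * ((n : ℝ) - k) + 2) (2 * ((n : ℝ) - k)) * y (0 + 2 * k * h)
        + midWeight ν (2 * ((n : ℝ) - k) + 2) (2 * ((n : ℝ) - k)) * y (0 + 2 * k * h + h)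
        + rightWeight ν (2 * ((n : ℝ) - k) + 2) (2 * ((n : ℝ) - k))
          * y (0 + 2 * k * h + 2 * h)) := by
  rcases Nat.eq_zero_or_pos n with rfl | hn
  · obtain ⟨h0, h1, h2⟩ := Dtil_eq_weights hν
    rw [discCaputo, if_neg (by omega), if_pos (by omega), h0, h1, h2]
    simp
  · rw [discCaputo, if_neg (by omega), if_neg (by omega), if_neg (by omega),
      show (2 * n + 2) / 2 - 1 = n by omega, ← rightWeight_two_zero hν]
    congr 1
    have key := sum_nodes_eq_sum_panels (Dbar ν n)
      (fun k => leftWeight ν (2 * ((n : ℝ) - k) + 2) (2 * ((n : ℝ) - k)))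
      (fun k => midWeight ν (2 * ((n : ℝ) - k) + 2) (2 * ((n : ℝ) - k)))
      (fun k => rightWeight ν (2 * ((n : ℝ) - k) + 2) (2 * ((n : ℝ) - k)))
      (fun k => y (k * h)) n
      (fun k hk => by
        rw [show 2 * k + 2 = 2 * (k + 1) by ring, Dbar_even hν (by omega) hk rfl]
        push_cast
        congr 2 <;> ring)
      (fun k hk => by
        rw [show 2 * k + 3 = 2 * (k + 1) + 1 by ring, Dbar_odd hν hk rfl]
        push_cast
        congr 1 <;> ring)
    have h1 := Dbar_odd hν (Nat.zero_le n) (q := 2 * n) (by simp)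
    simp only [mul_zero, zero_add] at h1
    simp only [sub_self, mul_zero, zero_add, Nat.cast_zero, sub_zero, Dbar_zero hν, h1, zero_mul,
      add_zero] at key
    rw [key]
    refine Finset.sum_congr rfl fun k _ => ?_
    push_cast
    congr 3 <;> ring_nf

/-- The discrete derivative at odd grid points: a short panel followed by full panels. -/
lemma discCaputo_odd {ν : ℝ} (hν : ν < 1) (h : ℝ) (y : ℝ → ℝ) (n : ℕ) :
    discCaputo ν h y (2 * n + 3) =
      h ^ (-ν) * (leftWeight ν (2 * n + 3) (2 * n + 2) * y 0
        + midWeight ν (2 * n + 3) (2 * n + 2) * y (0 + h)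
        + rightWeight ν (2 * n + 3) (2 * n + 2) * y (0 + 2 * h))
      + h ^ (-ν) * ∑ k ∈ Finset.range (n + 1),
      (leftWeight ν (2 * ((n : ℝ) - k) + 2) (2 * ((n : ℝ) - k)) * y (h + 2 * k * h)
        + midWeight ν (2 * ((n : ℝ) - k) + 2) (2 * ((n : ℝ) - k)) * y (h + 2 * k * h + h)
        + rightWeight ν (2 * ((n : ℝ) - k) + 2) (2 * ((n : ℝ) - k))
          * y (h + 2 * k * h + 2 * h)) := by
  rw [discCaputo, if_neg (by omega), if_neg (by omega), if_pos (by omega),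
    show (2 * n + 3) / 2 = n + 1 by omega, ← rightWeight_two_zero hν, ← mul_add]
  congr 1
  have key := sum_nodes_eq_sum_panels (fun k => Dco ν (n + 1) (k + 1))
    (fun k => leftWeight ν (2 * ((n : ℝ) - k) + 2) (2 * ((n : ℝ) - k)))
    (fun k => midWeight ν (2 * ((n : ℝ) - k) + 2) (2 * ((n : ℝ) - k)))
    (fun k => rightWeight ν (2 * ((n : ℝ) - k) + 2) (2 * ((n : ℝ) - k)))
    (fun k => y ((k + 1 : ℕ) * h)) n
    (fun k hk => by
      rw [Dco_of_three_le ν _ (by omega), show 2 * k + 2 + 1 + 1 = 2 * (k + 2) by ring,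
        Dbar_even hν (by omega) (by omega) rfl]
      push_cast
      congr 2 <;> ring)
    (fun k hk => by
      rw [Dco_of_three_le ν _ (by omega), show 2 * k + 3 + 1 + 1 = 2 * (k + 2) + 1 by ring,
        Dbar_odd hν (by omega) rfl]
      push_cast
      congr 1 <;> ring)
  have h0 := Dco_zero hν (n + 1)
  have h1 := Dco_one hν (Nat.le_add_left 1 n)
  have h2 := Dco_two hν (Nat.le_add_left 1 n)
  rw [Finset.sum_range_succ']
  push_cast at key h0 h1 h2 ⊢
  rw [show 2 * ((n : ℝ) + 1) + 1 = 2 * n + 3 by ring,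
    show 2 * ((n : ℝ) + 1) = 2 * n + 2 by ring] at h0 h1 h2
  rw [show 2 * (n : ℝ) + 2 - 2 = 2 * n by ring] at h1 h2
  simp only [sub_self, mul_zero, zero_add, sub_zero, one_mul, h1, h2,
    show 2 * (n : ℝ) + 2 + 1 = 2 * n + 3 by ring] at key
  rw [h0]
  have hsum : ∑ k ∈ Finset.range (n + 1),
      (leftWeight ν (2 * ((n : ℝ) - k) + 2) (2 * ((n : ℝ) - k)) * y (h + 2 * k * h)
        + midWeight ν (2 * ((n : ℝ) - k) + 2) (2 * ((n : ℝ) - k)) * y (h + 2 * k * h + h)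
        + rightWeight ν (2 * ((n : ℝ) - k) + 2) (2 * ((n : ℝ) - k)) * y (h + 2 * k * h + 2 * h)) =
      ∑ k ∈ Finset.range (n + 1),
      (leftWeight ν (2 * ((n : ℝ) - k) + 2) (2 * ((n : ℝ) - k)) * y ((2 * k + 1) * h)
        + midWeight ν (2 * ((n : ℝ) - k) + 2) (2 * ((n : ℝ) - k)) * y ((2 * k + 1 + 1) * h)
        + rightWeight ν (2 * ((n : ℝ) - k) + 2) (2 * ((n : ℝ) - k))
          * y ((2 * k + 2 + 1) * h)) := by
    refine Finset.sum_congr rfl fun k _ => ?_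
    congr 3 <;> ring_nf
  rw [hsum, zero_add, zero_add, zero_mul]
  linarith

lemma discCaputo_one {ν : ℝ} (hν : ν < 1) (h : ℝ) (y : ℝ → ℝ) :
    discCaputo ν h y 1 = h ^ (-ν) * (leftWeight ν 1 0 * y 0 + midWeight ν 1 0 * y (0 + h)
      + rightWeight ν 1 0 * y (0 + 2 * h)) := by
  obtain ⟨h0, h1, h2⟩ := Dhat_eq_weights hν
  rw [discCaputo, if_pos rfl, h0, h1, h2, zero_add, zero_add]

lemma caputo_eq_of_hasDerivAt {T ν : ℝ} {y y₁ : ℝ → ℝ}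
    (hd : ∀ x ∈ Set.Ioo 0 T, HasDerivAt y (y₁ x) x) {x : ℝ} (hx : 0 ≤ x) (hxT : x ≤ T) :
    caputo ν y x = (1 / Real.Gamma (1 - ν)) * ∫ s in (0 : ℝ)..x, (x - s) ^ (-ν) * y₁ s := by
  rw [caputo, intervalIntegral.integral_congr_Ioo_of_le hx]
  intro s hs
  simp only [(hd s ⟨hs.1, hs.2.trans_le hxT⟩).deriv]

/-- The quadrature error of the scheme, before division by `Γ(1 - ν)`. -/
lemma QuadApprox.abs_integral_sub_discCaputo_le {T K ν : ℝ} {y y₁ : ℝ → ℝ}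
    (H : QuadApprox T K y y₁) (hν0 : 0 ≤ ν) (hν : ν < 1) (hK0 : 0 ≤ K) {h : ℝ} (hh : 0 < h)
    (hT : 2 * h ≤ T) {j : ℕ} (hj : 1 ≤ j) (hjT : j * h ≤ T) :
    |(∫ s in (0 : ℝ)..(j * h), (j * h - s) ^ (-ν) * y₁ s)
        - Real.Gamma (1 - ν) * discCaputo ν h y j| ≤
      (4 * K + 2 * K / (1 - ν)) * h ^ (3 - ν) := by
  have hpow0 : 0 ≤ h ^ (3 - ν) := Real.rpow_nonneg hh.le _
  have hKp : 0 ≤ K * h ^ (3 - ν) := mul_nonneg hK0 hpow0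
  obtain rfl | ⟨n, rfl⟩ | ⟨n, rfl⟩ : j = 1 ∨ (∃ n, j = 2 * n + 2) ∨ ∃ n, j = 2 * n + 3 := by
    rcases Nat.even_or_odd' j with ⟨c, rfl | rfl⟩
    · exact Or.inr (Or.inl ⟨c - 1, by omega⟩)
    · rcases Nat.eq_zero_or_pos c with rfl | hc
      · exact Or.inl rfl
      · exact Or.inr (Or.inr ⟨c - 1, by omega⟩)
  · rw [discCaputo_one hν]
    have := H.abs_end_panel_le hν0 hν (a := 0) (t := (1 : ℕ) * h) (p := 1) hh le_rfl
      (by linarith) zero_le_one one_le_two (by push_cast; ring)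
    linarith
  · rw [discCaputo_even hν]
    have := H.abs_panels_le hν0 hν hK0 (a := 0) n hh le_rfl
      (by push_cast; ring : ((2 * n + 2 : ℕ) : ℝ) * h = _) hjT
    linarith
  · have ht : ((2 * n + 3 : ℕ) : ℝ) * h = h + (2 * n + 2) * h := by push_cast; ring
    rw [discCaputo_odd hν]
    rw [ht] at hjT ⊢
    have hnh : 0 ≤ (n : ℝ) * h := by positivity
    have h1 := H.abs_panels_le hν0 hν hK0 (a := h) n hh hh.le rfl hjT
    have h2 := H.abs_panel_le hν0 hν (a := 0) (b := h) (t := h + (2 * n + 2) * h)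
      (p := 2 * n + 3) (q := 2 * n + 2) hh le_rfl (by linarith) (by positivity) (by ring) (by ring)
      (Or.inl (by ring))
    have hsplit := intervalIntegral.integral_add_adjacent_intervals
      (H.intervalIntegrable_kernel_mul hν (h + (2 * n + 2) * h) le_rfl hh.le (by linarith))
      (H.intervalIntegrable_kernel_mul hν (h + (2 * n + 2) * h) hh.le (by linarith) hjT)
    have h3 : h ^ (3 - ν) = h ^ 3 * h ^ (-ν) := by
      rw [show 3 - ν = -ν + (3 : ℕ) by push_cast; ring, Real.rpow_add_natCast hh.ne', mul_comm]
    have hw : (h + (2 * n + 2) * h - h) ^ (-ν) - (h + (2 * n + 2) * h - 0) ^ (-ν) ≤ h ^ (-ν) := by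
      have e1 : (h + (2 * n + 2) * h - h) ^ (-ν) ≤ h ^ (-ν) :=
        Real.rpow_le_rpow_of_nonpos hh (by linarith) (by linarith)
      have e2 : 0 ≤ (h + (2 * n + 2) * h - 0) ^ (-ν) := Real.rpow_nonneg (by linarith) _
      linarith
    have h4 := h2.trans (mul_le_mul_of_nonneg_left hw (by positivity))
    rw [mul_assoc (2 * K), ← h3] at h4
    rw [← hsplit, mul_add]
    rw [abs_le] at h1 h4 ⊢
    constructor <;> linarith

theorem stmt13 (ν T : ℝ) (hν : ν ∈ Set.Ioo (0:ℝ) 1) (hT : 0 < T) (y : ℝ → ℝ)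
    (hy : ContDiffOn ℝ 3 y (Set.Icc 0 T)) :
    ∃ C₁ > 0, ∀ N : ℕ, 0 < N → ∀ j : ℕ, 1 ≤ j → j ≤ 2 * N →
      |trunc ν (T / (2 * (N : ℝ))) y j| ≤ C₁ * (T / (2 * (N : ℝ))) ^ (3 - ν) := by
  obtain ⟨hν0, hν1⟩ := hν
  obtain ⟨K, hK0, H⟩ := exists_quadApprox hT hy
  have hΓ : 0 < Real.Gamma (1 - ν) := Real.Gamma_pos_of_pos (by linarith)
  have h1ν : 0 < 1 - ν := by linarith
  refine ⟨(1 / Real.Gamma (1 - ν)) * (4 * K + 2 * K / (1 - ν)) + 1, by positivity,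
    fun N hN j hj hjN => ?_⟩
  have hN' : (0 : ℝ) < N := by exact_mod_cast hN
  set h := T / (2 * (N : ℝ)) with hh_def
  have hh : 0 < h := by positivity
  have hNh : 2 * (N : ℝ) * h = T := by rw [hh_def]; field_simp
  have hgrid : ∀ i : ℕ, i ≤ 2 * N → (i : ℝ) * h ≤ T := fun i hi => by
    rw [← hNh]
    exact mul_le_mul_of_nonneg_right (by exact_mod_cast hi) hh.le
  have hjT := hgrid j hjN
  have key := H.abs_integral_sub_discCaputo_le hν0.le hν1 hK0 hh
    (by exact_mod_cast hgrid 2 (by omega)) hj hjT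
  have hpow : 0 ≤ h ^ (3 - ν) := Real.rpow_nonneg hh.le _
  have htrunc : trunc ν h y j = (1 / Real.Gamma (1 - ν)) *
      ((∫ s in (0 : ℝ)..(j * h), (j * h - s) ^ (-ν) * derivWithin y (Set.Icc 0 T) s)
        - Real.Gamma (1 - ν) * discCaputo ν h y j) := by
    rw [trunc, caputo_eq_of_hasDerivAt H.hasDerivAt (by positivity) hjT]
    field_simp
  rw [htrunc, abs_mul, abs_of_pos (by positivity : 0 < 1 / Real.Gamma (1 - ν)), add_mul, one_mul,
    mul_assoc]
  exact (mul_le_mul_of_nonneg_left key (by positivity)).trans (le_add_of_nonneg_right hpow)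
end

section
/- Fix ν ∈ (0,1), T > 0, L > 0 and C₁ > 0. Let y : [0,T] → ℝ be three times continuously differentiable, let f : [0,T] × ℝ → ℝ satisfy |f(x,u) − f(x,v)| ≤ L·|u − v| for all x ∈ [0,T] and u, v ∈ ℝ, and suppose (D^ν y)(x) = f(x, y(x)) for all x ∈ (0,T]. Let N be a positive integer, Δx = T/(2N) with Δx^ν < 1/(7L), and suppose the truncation errors satisfy |r_1(Δx)| ≤ C₁·Δx^{3−ν} and |r_2(Δx)| ≤ C₁·Δx^{3−ν}. If y_0 = y(0) and y_1, y_2 are real numbers satisfying Δx^{−ν}(D̂_0 y_0 + D̂_1 y_1 + D̂_2 y_2) = f(x_1, y_1) and Δx^{−ν}(D̃_0 y_0 + D̃_1 y_1 + D̃_2 y_2) = f(x_2, y_2), then the errors e_j = y(x_j) − y_j satisfy |e_1| + |e_2| ≤ 10·C₁·Δx³ (in particular |e_1| ≤ 10C₁Δx³ and |e_2| ≤ 10C₁Δx³). -/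
open Real Finset

theorem gamma_le_one_of_mem_Icc {x : ℝ} (h1 : 1 ≤ x) (h2 : x ≤ 2) : Real.Gamma x ≤ 1 := by
  have h := Real.convexOn_Gamma.2 (x := 1) (y := 2) (by simp) (by simp)
    (sub_nonneg.2 h2) (sub_nonneg.2 h1) (by ring)
  have hx : (2 - x) • (1 : ℝ) + (x - 1) • (2 : ℝ) = x := by simp only [smul_eq_mul]; ring
  rw [hx, Real.Gamma_one, Real.Gamma_two] at h
  norm_num at h
  exact h

theorem two_rpow_le_one_add {ν : ℝ} (h0 : 0 ≤ ν) (h1 : ν ≤ 1) : (2 : ℝ) ^ ν ≤ 1 + ν := by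
  have h := rpow_one_add_le_one_add_mul_self (s := 1) (by norm_num) h0 h1
  norm_num at h
  exact h

/-- The right-hand sides `b₁`, `b₂` of the two starting equations control the errors. -/
theorem abs_add_abs_le_of_start_system {ν e1 e2 b1 b2 : ℝ} (h0 : 0 < ν) (h1 : ν < 1)
    (hb1 : Dhat1 ν * e1 + Dhat2 ν * e2 = b1) (hb2 : Dtil1 ν * e1 + Dtil2 ν * e2 = b2) :
    |e1| + |e2| ≤ 7 / 2 * |b1| + 3 / 2 * |b2| := by
  have hG : Real.Gamma (3 - ν) = (2 - ν) * Real.Gamma (2 - ν) := by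
    rw [← Real.Gamma_add_one (by linarith)]
    congr 1
    ring
  have hg0 : 0 < Real.Gamma (2 - ν) := Real.Gamma_pos_of_pos (by linarith)
  have hg1 : Real.Gamma (2 - ν) ≤ 1 := gamma_le_one_of_mem_Icc (by linarith) (by linarith)
  have hp0 : (0 : ℝ) < 2 ^ ν := by positivity
  have hp1 := two_rpow_le_one_add h0.le h1.le
  unfold Dhat1 Dhat2 at hb1
  unfold Dtil1 Dtil2 at hb2
  rw [hG] at hb1 hb2
  generalize Real.Gamma (2 - ν) = g at *
  generalize (2 : ℝ) ^ ν = p at *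
  have hn : (2 - ν) ≠ 0 := by linarith
  have he1 : e1 = g / 2 * ((ν + 2) * b1 - ν / 2 * (p * b2)) := by
    rw [← hb1, ← hb2]
    field_simp
    ring
  have he2 : e2 = g / 2 * (4 * ν * b1 + 2 * (1 - ν) * (p * b2)) := by
    rw [← hb1, ← hb2]
    field_simp
    ring
  have ha1 : |e1| ≤ 1 / 2 * ((ν + 2) * |b1| + ν / 2 * (p * |b2|)) := by
    rw [he1, abs_mul, abs_of_pos (half_pos hg0)]
    refine mul_le_mul (by linarith) ((abs_sub _ _).trans_eq ?_) (abs_nonneg _) (by norm_num)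
    simp only [abs_mul]
    rw [abs_of_pos hp0, abs_of_pos (half_pos h0), abs_of_pos (show 0 < ν + 2 by linarith)]
  have ha2 : |e2| ≤ 1 / 2 * (4 * ν * |b1| + 2 * (1 - ν) * (p * |b2|)) := by
    rw [he2, abs_mul, abs_of_pos (half_pos hg0)]
    refine mul_le_mul (by linarith) ((abs_add_le _ _).trans_eq ?_) (abs_nonneg _) (by norm_num)
    rw [abs_mul, abs_mul _ (p * b2), abs_mul p, abs_of_pos hp0,
      abs_of_pos (show 0 < 4 * ν by linarith), abs_of_pos (show 0 < 2 * (1 - ν) by linarith)]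
  have hc : (2 - 3 / 2 * ν) * p ≤ 3 := by
    nlinarith [mul_le_mul_of_nonneg_left hp1 (show 0 ≤ 2 - 3 / 2 * ν by linarith)]
  nlinarith [mul_le_mul_of_nonneg_right hc (abs_nonneg b2),
    mul_le_mul_of_nonneg_right h1.le (abs_nonneg b1)]

/-- An error equation at one node, where the exact solution has defect `r`. -/
theorem abs_le_of_defect {ν h L C E e F F' r : ℝ} (hh : 0 < h)
    (hE : h ^ (-ν) * E = F - F' - r) (hF : |F - F'| ≤ L * |e|)
    (hr : |r| ≤ C * h ^ (3 - ν)) :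
    |E| ≤ h ^ ν * L * |e| + C * h ^ (3 : ℕ) := by
  have hpos : 0 < h ^ ν := rpow_pos_of_pos hh ν
  have h3 : h ^ ν * h ^ (3 - ν) = h ^ (3 : ℕ) := by
    rw [← rpow_add hh, ← rpow_natCast]
    congr 1
    push_cast
    ring
  have hEq : E = h ^ ν * (F - F' - r) := by
    rw [← hE, ← mul_assoc, ← rpow_add hh]
    simp
  calc |E| = h ^ ν * |F - F' - r| := by rw [hEq, abs_mul, abs_of_pos hpos]
    _ ≤ h ^ ν * (L * |e| + C * h ^ (3 - ν)) := by
      gcongr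
      exact (abs_sub _ _).trans (add_le_add hF hr)
    _ = h ^ ν * L * |e| + C * h ^ (3 : ℕ) := by rw [← h3]; ring

theorem stmt14 (ν T L C₁ : ℝ) (hν : ν ∈ Set.Ioo (0:ℝ) 1) (hT : 0 < T) (hL : 0 < L)
    (hC : 0 < C₁) (y : ℝ → ℝ) (hy : ContDiffOn ℝ 3 y (Set.Icc 0 T))
    (f : ℝ → ℝ → ℝ)
    (hf : ∀ x ∈ Set.Icc (0:ℝ) T, ∀ u v : ℝ, |f x u - f x v| ≤ L * |u - v|)
    (hode : ∀ x ∈ Set.Ioc (0:ℝ) T, caputo ν y x = f x (y x))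
    (N : ℕ) (hN : 0 < N) (Δx : ℝ) (hΔx : Δx = T / (2 * (N : ℝ)))
    (hsmall : Δx ^ ν < 1 / (7 * L))
    (hr1 : |trunc ν Δx y 1| ≤ C₁ * Δx ^ (3 - ν))
    (hr2 : |trunc ν Δx y 2| ≤ C₁ * Δx ^ (3 - ν))
    (y1 y2 : ℝ)
    (hs1 : Δx ^ (-ν) * (Dhat0 ν * y 0 + Dhat1 ν * y1 + Dhat2 ν * y2) = f Δx y1)
    (hs2 : Δx ^ (-ν) * (Dtil0 ν * y 0 + Dtil1 ν * y1 + Dtil2 ν * y2) = f (2 * Δx) y2) :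
    |y Δx - y1| + |y (2 * Δx) - y2| ≤ 10 * C₁ * Δx ^ (3 : ℕ) ∧
    |y Δx - y1| ≤ 10 * C₁ * Δx ^ (3 : ℕ) ∧
    |y (2 * Δx) - y2| ≤ 10 * C₁ * Δx ^ (3 : ℕ) := by
  obtain ⟨h0, h1⟩ := hν
  have hN1 : (1 : ℝ) ≤ N := by exact_mod_cast hN
  have hx : 0 < Δx := by rw [hΔx]; positivity
  have hxT : 2 * Δx ≤ T := by
    have : Δx * (2 * N) = T := by rw [hΔx]; field_simp
    nlinarith
  have ho1 := hode Δx ⟨hx, by linarith⟩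
  have ho2 := hode (2 * Δx) ⟨by linarith, hxT⟩
  have hl1 := hf Δx ⟨hx.le, by linarith⟩ (y Δx) y1
  have hl2 := hf (2 * Δx) ⟨by linarith, hxT⟩ (y (2 * Δx)) y2
  have hb1 := abs_le_of_defect (ν := ν) (r := trunc ν Δx y 1)
    (E := Dhat1 ν * (y Δx - y1) + Dhat2 ν * (y (2 * Δx) - y2)) hx
    (by simp only [trunc, discCaputo, if_true, Nat.cast_one, one_mul]
        rw [ho1, ← hs1]; ring) hl1 hr1
  have hb2 := abs_le_of_defect (ν := ν) (r := trunc ν Δx y 2)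
    (E := Dtil1 ν * (y Δx - y1) + Dtil2 ν * (y (2 * Δx) - y2)) hx
    (by simp only [trunc, discCaputo, if_true, Nat.cast_ofNat, OfNat.ofNat_ne_one, if_false]
        rw [ho2, ← hs2]; ring) hl2 hr2
  have hS := abs_add_abs_le_of_start_system h0 h1 (e1 := y Δx - y1) (e2 := y (2 * Δx) - y2) rfl rfl
  have ha : Δx ^ ν * L ≤ 1 / 7 := by
    rw [lt_div_iff₀ (by positivity)] at hsmall
    linarith
  have n1 := abs_nonneg (y Δx - y1)
  have n2 := abs_nonneg (y (2 * Δx) - y2)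
  have hmain : |y Δx - y1| + |y (2 * Δx) - y2| ≤ 10 * C₁ * Δx ^ (3 : ℕ) := by
    linarith [mul_le_mul_of_nonneg_right ha n1, mul_le_mul_of_nonneg_right ha n2]
  exact ⟨hmain, by linarith, by linarith⟩
end
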